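/- arXiv:2005.09307 — 2 statements merged into one kernel-verified Lean document; each statement's English description precedes it below -/
import Mathlib

section
/- For every integer k ≥ 39, M(k) ≤ log(N_{⌊k/3⌋}); for every integer k ≥ 18, M(k) ≤ log(N_{⌊k/2⌋}); and for every integer k ≥ 969672728, M(k) ≤ log(N_{⌊k/14⌋}). -/
open Real Finset

/-- `Nk k` is the `k`-th primorial: the product of the first `k` primes
(`Nat.nth Nat.Prime i` is the `(i+1)`-st prime, so `Nat.nth Nat.Prime 0 = 2`). -/
noncomputable def Nk (k : ℕ) : ℕ := ∏ i ∈ Finset.range k, Nat.nth Nat.Prime i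

/-- `M k = exp (e^(-γ) * N_k / φ(N_k)) - log N_k`. -/
noncomputable def M (k : ℕ) : ℝ :=
  Real.exp (Real.exp (-Real.eulerMascheroniConstant) * (Nk k : ℝ) / (Nat.totient (Nk k) : ℝ))
    - Real.log (Nk k)


section
open ArithmeticFunction (vonMangoldt)

namespace MP

/-- basic double counting -/
theorem sum_lam_mul (F : ℕ → ℝ) (N : ℕ) :
    ∑ n ∈ Ioc 0 N, vonMangoldt n * ∑ i ∈ Ioc 0 (N / n), F (n * i)
      = ∑ m ∈ Ioc 0 N, F m * Real.log m := by
  have h1 : ∀ m ∈ Ioc 0 N, F m * Real.log m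
      = ∑ n ∈ Ioc 0 N, if n ∣ m then vonMangoldt n * F m else 0 := by
    intro m hm
    rw [mem_Ioc] at hm
    rw [← ArithmeticFunction.vonMangoldt_sum, Finset.mul_sum, ← Finset.sum_filter]
    apply Finset.sum_congr
    · ext d
      simp only [Nat.mem_divisors, mem_filter, mem_Ioc]
      constructor
      · rintro ⟨h, h0⟩
        exact ⟨⟨Nat.pos_of_dvd_of_pos h hm.1, (Nat.le_of_dvd hm.1 h).trans hm.2⟩, h⟩
      · rintro ⟨_, h⟩
        exact ⟨h, by omega⟩
    · intros; ring
  rw [Finset.sum_congr rfl h1, Finset.sum_comm]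
  apply Finset.sum_congr rfl
  intro n hn
  rw [mem_Ioc] at hn
  rw [← Finset.sum_filter, Finset.mul_sum]
  apply Finset.sum_nbij' (fun i => n * i) (fun m => m / n)
  · intro i hi
    simp only [mem_Ioc, mem_filter] at hi ⊢
    refine ⟨⟨Nat.mul_pos hn.1 hi.1, ?_⟩, Nat.dvd_mul_right n i⟩
    calc n * i ≤ n * (N / n) := Nat.mul_le_mul_left _ hi.2
      _ ≤ N := Nat.mul_div_le N n
  · intro m hm
    simp only [mem_Ioc, mem_filter] at hm ⊢
    exact ⟨Nat.div_pos (Nat.le_of_dvd hm.1.1 hm.2) hn.1, Nat.div_le_div_right hm.1.2⟩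
  · intro i hi
    exact Nat.mul_div_cancel_left i hn.1
  · intro m hm
    simp only [mem_Ioc, mem_filter] at hm ⊢
    exact Nat.mul_div_cancel' hm.2
  · intros; rfl

/-- `T z = log ⌊z⌋!`. -/
noncomputable def T (z : ℝ) : ℝ := ∑ m ∈ Ioc 0 ⌊z⌋₊, Real.log m

noncomputable def TT (z : ℝ) : ℝ := ∑ m ∈ Ioc 0 ⌊z⌋₊, (1 / (m:ℝ) - 1 / z) * Real.log m

noncomputable def K (x : ℝ) : ℝ := ∑ n ∈ Ioc 0 ⌊x⌋₊, vonMangoldt n * (1 / (n:ℝ) - 1 / x)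

noncomputable def L (v : ℝ) : ℝ := ∑ i ∈ Ioc 0 ⌊v⌋₊, (1 / (i:ℝ) - 1 / v)

theorem sum_ext_T (x : ℝ) (d : ℕ) :
    ∑ n ∈ Ioc 0 ⌊x⌋₊, vonMangoldt n * ((⌊x⌋₊ / n / d : ℕ) : ℝ) = T (x / d) := by
  have h := sum_lam_mul (fun _ => 1) (⌊x⌋₊ / d)
  simp only [one_mul, sum_const, Nat.card_Ioc, nsmul_eq_mul, mul_one] at h
  rw [T, Nat.floor_div_natCast, ← h]
  symm
  have : ∀ n, ⌊x⌋₊ / n / d = ⌊x⌋₊ / d / n := fun n => Nat.div_right_comm _ _ _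
  simp only [this, Nat.sub_zero]
  apply Finset.sum_subset
  · intro n hn
    rw [mem_Ioc] at hn ⊢
    exact ⟨hn.1, hn.2.trans (Nat.div_le_self _ _)⟩
  · intro n hn hn'
    rw [mem_Ioc] at hn hn'
    rw [Nat.div_eq_of_lt (by omega)]
    simp

theorem sum_ext_TT (x : ℝ) (d : ℕ) :
    ∑ n ∈ Ioc 0 ⌊x⌋₊, vonMangoldt n / n * L (x / n / d) = TT (x / d) := by
  have h := sum_lam_mul (fun m => 1 / (m:ℝ) - 1 / (x / d)) (⌊x⌋₊ / d)
  rw [TT, Nat.floor_div_natCast, ← h]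
  symm
  have h2 : ∀ n ∈ Ioc 0 ⌊x⌋₊, vonMangoldt n / n * L (x / n / d)
      = vonMangoldt n * ∑ i ∈ Ioc 0 (⌊x⌋₊ / d / n), (1 / ((n * i : ℕ):ℝ) - 1 / (x / d)) := by
    intro n hn
    rw [mem_Ioc] at hn
    have hn0 : (0:ℝ) < n := by exact_mod_cast hn.1
    rw [L, Nat.floor_div_natCast, Nat.floor_div_natCast, Nat.div_right_comm, div_mul_eq_mul_div,
      mul_div_assoc, Finset.sum_div]
    congr 1
    apply Finset.sum_congr rfl
    intro i hi
    rw [mem_Ioc] at hi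
    have hi0 : (0:ℝ) < i := by exact_mod_cast hi.1
    push_cast
    rw [sub_div]
    congr 1
    · rw [div_div, mul_comm]
    · rw [div_div]
      congr 1
      field_simp
  rw [Finset.sum_congr rfl h2]
  apply Finset.sum_subset
  · intro n hn
    rw [mem_Ioc] at hn ⊢
    exact ⟨hn.1, hn.2.trans (Nat.div_le_self _ _)⟩
  · intro n hn hn'
    rw [mem_Ioc] at hn hn'
    rw [Nat.div_eq_of_lt (by omega)]
    simp

/-- step functions -/
noncomputable def stp (Y : ℕ) (y : ℝ) : ℝ := if (Y:ℝ) ≤ y then 1 else 0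

theorem sum_stp (x : ℝ) (Y : ℕ) (hY : 1 ≤ Y) :
    ∑ n ∈ Ioc 0 ⌊x⌋₊, vonMangoldt n * stp Y (x / n) = Chebyshev.psi (x / Y) := by
  rw [Chebyshev.psi, Nat.floor_div_natCast]
  have : ∀ n ∈ Ioc 0 ⌊x⌋₊, vonMangoldt n * stp Y (x / n)
      = if n ≤ ⌊x⌋₊ / Y then vonMangoldt n else 0 := by
    intro n hn
    rw [mem_Ioc] at hn
    have hn0 : (0:ℝ) < n := by exact_mod_cast hn.1
    have hx : 1 ≤ x := by
      by_contra! hx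
      have := Nat.floor_eq_zero.mpr hx
      omega
    have : ((Y:ℝ) ≤ x / n) ↔ n ≤ ⌊x⌋₊ / Y := by
      rw [le_div_iff₀ hn0, Nat.le_div_iff_mul_le hY, Nat.le_floor_iff (by linarith)]
      push_cast
      rw [mul_comm]
    rw [stp]
    simp only [this]
    split_ifs <;> simp
  rw [Finset.sum_congr rfl this, ← Finset.sum_filter]
  apply Finset.sum_congr _ (fun _ _ => rfl)
  ext n
  simp only [mem_filter, mem_Ioc]
  have := Nat.div_le_self ⌊x⌋₊ Y
  omega

end MP
end

section
open ArithmeticFunction (vonMangoldt)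

namespace MP

noncomputable def A : ℝ := 49 * Real.log 2 + 35 * Real.log 3 + 21 * Real.log 5
  + 30 * Real.log 7 + 19 * Real.log 11

theorem A_eq : A = Real.log (2^49 * 3^35 * 5^21 * 7^30 * 11^19) := by
  rw [Real.log_mul (by positivity) (by positivity), Real.log_mul (by positivity) (by positivity),
    Real.log_mul (by positivity) (by positivity), Real.log_mul (by positivity) (by positivity)]
  simp only [Real.log_pow, A]
  norm_num

theorem pow_cert : 2 ^ 1515920 ≤ (2^49 * 3^35 * 5^21 * 7^30 * 11^19) ^ 5000 ∧
    (2^49 * 3^35 * 5^21 * 7^30 * 11^19) ^ 5000 ≤ 2 ^ 1515921 := by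
  decide +kernel

theorem A_bounds : 210.1511 < A ∧ A < 210.1513 := by
  have h1 : ((2:ℝ) ^ 1515920) ≤ ((2^49 * 3^35 * 5^21 * 7^30 * 11^19 : ℕ):ℝ) ^ 5000 := by
    exact_mod_cast pow_cert.1
  have h2 : ((2^49 * 3^35 * 5^21 * 7^30 * 11^19 : ℕ):ℝ) ^ 5000 ≤ ((2:ℝ) ^ 1515921) := by
    exact_mod_cast pow_cert.2
  have hA : A = Real.log ((2^49 * 3^35 * 5^21 * 7^30 * 11^19 : ℕ):ℝ) := by
    rw [A_eq]; norm_num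
  have hp : (0:ℝ) < ((2^49 * 3^35 * 5^21 * 7^30 * 11^19 : ℕ):ℝ) := by positivity
  have h1' := Real.log_le_log (pow_pos (by norm_num) _) h1
  have h2' := Real.log_le_log (pow_pos hp _) h2
  rw [Real.log_pow, Real.log_pow, ← hA] at h1' h2'
  have := Real.log_two_gt_d9
  have := Real.log_two_lt_d9
  push_cast at h1' h2'
  constructor <;> linarith

def gi (j : ℕ) : ℤ := 210 * ((j:ℤ) + (j/6:ℕ) + (j/10:ℕ)) - 210 * ((j/2:ℕ) + (j/3:ℕ) + (j/5:ℕ) + (j/7:ℕ)) - 209 * (j/11:ℕ)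

def gbnd (j : ℕ) : Bool :=
  if j < 11 then gi j == 210 else if j < 13 then gi j == 211 else
  if j < 131 then decide (-9 ≤ gi j ∧ gi j ≤ 430) else
  if j < 349 then decide (-29 ≤ gi j ∧ gi j ≤ 450) else
  if j < 616 then decide (-54 ≤ gi j ∧ gi j ≤ 475) else
  decide (-154 ≤ gi j ∧ gi j ≤ 575)

theorem gbnd_cert : ∀ j < 2310, gbnd (j+1) = true := by
  decide +kernel

def vok (j : ℕ) (s : ℤ) : Bool :=
  let B : ℤ := if j < 4 then 460000000 else if j < 7 then 910000000 else
    if j < 13 then 1640000000 else 16000000000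
  let g := gi j
  decide (j * (s - 210151300000) + 210151100000 - 1000000000 * g ≥ -B ∧
   (j+1) * (s - 210151300000) + 210151100000 - 1000000000 * g ≥ -B ∧
   j * (s + j - 210151100000) + 210151300000 - 1000000000 * g ≤ B ∧
   (j+1) * (s + j - 210151100000) + 210151300000 - 1000000000 * g ≤ B)

def vloop : ℕ → ℕ → ℤ → Bool
  | 0, _, _ => true
  | f+1, j, s => vok j s && vloop f (j+1) (s + (1000000000 * (gi (j+1) - gi j)) / ((j+1 : ℕ) : ℤ))

theorem vloop_cert : vloop 2309 1 210000000000 = true := by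
  decide +kernel

theorem gi_period (j : ℕ) : gi (j + 2310) = gi j := by
  simp only [gi]; push_cast; omega

theorem gi_mod (j : ℕ) : gi (j % 2310) = gi j := by
  conv_rhs => rw [← Nat.mod_add_div j 2310]
  generalize j / 2310 = q
  generalize j % 2310 = r
  induction q with
  | zero => simp
  | succ q ih => rw [show r + 2310 * (q+1) = (r + 2310 * q) + 2310 by ring, gi_period, ih]

noncomputable def comb (f : ℕ → ℝ) : ℝ := 210 * f 1 - 210 * f 2 - 210 * f 3 - 210 * f 5 + 210 * f 6
  - 210 * f 7 + 210 * f 10 - 209 * f 11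

theorem gi_comb (j : ℕ) : (gi j : ℝ) = comb (fun d => ((j / d : ℕ) : ℝ)) := by
  simp only [gi, comb, Nat.div_one]
  generalize j / 2 = a2
  generalize j / 3 = a3
  generalize j / 5 = a5
  generalize j / 6 = a6
  generalize j / 7 = a7
  generalize j / 10 = a10
  generalize j / 11 = a11
  push_cast
  ring

noncomputable def maj1 (y : ℝ) : ℝ := 0.16 * stp 1 y + 0.84 * stp 11 y + 219 * stp 13 y
  + 20 * stp 131 y + 25 * stp 349 y + 100 * stp 616 y

theorem stp_one {Y : ℕ} {y : ℝ} (h : (Y:ℝ) ≤ y) : stp Y y = 1 := by simp [stp, h]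
theorem stp_zero {Y : ℕ} {y : ℝ} (h : y < (Y:ℝ)) : stp Y y = 0 := by simp [stp, h]

theorem stp_floor (Y : ℕ) {y : ℝ} (hy : 0 ≤ y) : stp Y y = if Y ≤ ⌊y⌋₊ then 1 else 0 := by
  simp only [stp, Nat.le_floor_iff hy]

theorem gbnd_all (j : ℕ) (hj : 1 ≤ j) : |A - gi j| ≤ 0.16 + (if 11 ≤ j then 0.84 else 0)
    + (if 13 ≤ j then 219 else 0) + (if 131 ≤ j then 20 else 0) + (if 349 ≤ j then 25 else 0)
    + (if 616 ≤ j then 100 else 0) := by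
  obtain ⟨hA1, hA2⟩ := A_bounds
  by_cases h : j ≤ 2310
  · have h1 := gbnd_cert (j-1) (by omega)
    rw [Nat.sub_add_cancel hj] at h1
    rw [abs_le]
    unfold gbnd at h1
    by_cases c1 : j < 11
    · simp only [c1, if_true, beq_iff_eq] at h1
      rw [h1]
      simp only [show ¬ 11 ≤ j by omega, show ¬ 13 ≤ j by omega, show ¬ 131 ≤ j by omega,
        show ¬ 349 ≤ j by omega, show ¬ 616 ≤ j by omega, if_false]
      push_cast
      constructor <;> linarith
    by_cases c2 : j < 13
    · simp only [c1, c2, if_false, if_true, beq_iff_eq] at h1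
      rw [h1]
      simp only [show 11 ≤ j by omega, show ¬ 13 ≤ j by omega, show ¬ 131 ≤ j by omega,
        show ¬ 349 ≤ j by omega, show ¬ 616 ≤ j by omega, if_false, if_true]
      push_cast
      constructor <;> linarith
    by_cases c3 : j < 131
    · simp only [c1, c2, c3, if_false, if_true, decide_eq_true_eq] at h1
      simp only [show 11 ≤ j by omega, show 13 ≤ j by omega, show ¬ 131 ≤ j by omega,
        show ¬ 349 ≤ j by omega, show ¬ 616 ≤ j by omega, if_false, if_true]
      have ha : ((-9:ℤ):ℝ) ≤ gi j := by exact_mod_cast h1.1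
      have hb : (gi j : ℝ) ≤ ((430:ℤ):ℝ) := by exact_mod_cast h1.2
      push_cast at ha hb
      constructor <;> linarith
    by_cases c4 : j < 349
    · simp only [c1, c2, c3, c4, if_false, if_true, decide_eq_true_eq] at h1
      simp only [show 11 ≤ j by omega, show 13 ≤ j by omega, show 131 ≤ j by omega,
        show ¬ 349 ≤ j by omega, show ¬ 616 ≤ j by omega, if_false, if_true]
      have ha : ((-29:ℤ):ℝ) ≤ gi j := by exact_mod_cast h1.1
      have hb : (gi j : ℝ) ≤ ((450:ℤ):ℝ) := by exact_mod_cast h1.2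
      push_cast at ha hb
      constructor <;> linarith
    by_cases c5 : j < 616
    · simp only [c1, c2, c3, c4, c5, if_false, if_true, decide_eq_true_eq] at h1
      simp only [show 11 ≤ j by omega, show 13 ≤ j by omega, show 131 ≤ j by omega,
        show 349 ≤ j by omega, show ¬ 616 ≤ j by omega, if_false, if_true]
      have ha : ((-54:ℤ):ℝ) ≤ gi j := by exact_mod_cast h1.1
      have hb : (gi j : ℝ) ≤ ((475:ℤ):ℝ) := by exact_mod_cast h1.2
      push_cast at ha hb
      constructor <;> linarith
    · simp only [c1, c2, c3, c4, c5, if_false, decide_eq_true_eq] at h1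
      simp only [show 11 ≤ j by omega, show 13 ≤ j by omega, show 131 ≤ j by omega,
        show 349 ≤ j by omega, show 616 ≤ j by omega, if_true]
      have ha : ((-154:ℤ):ℝ) ≤ gi j := by exact_mod_cast h1.1
      have hb : (gi j : ℝ) ≤ ((575:ℤ):ℝ) := by exact_mod_cast h1.2
      push_cast at ha hb
      constructor <;> linarith
  · simp only [show 11 ≤ j by omega, show 13 ≤ j by omega, show 131 ≤ j by omega,
        show 349 ≤ j by omega, show 616 ≤ j by omega, if_true]
    have key : ∀ r < 2311, -154 ≤ gi r ∧ gi r ≤ 575 := by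
      intro r hr
      rcases Nat.eq_zero_or_pos r with h0 | h0
      · subst h0; decide
      have h1 := gbnd_cert (r-1) (by omega)
      rw [Nat.sub_add_cancel h0] at h1
      unfold gbnd at h1
      split_ifs at h1 <;> simp only [beq_iff_eq, decide_eq_true_eq] at h1 <;> omega
    have h1 := key (j % 2310) (by have := Nat.mod_lt j (show 2310 > 0 by norm_num); omega)
    rw [gi_mod] at h1
    have ha : ((-154:ℤ):ℝ) ≤ gi j := by exact_mod_cast h1.1
    have hb : (gi j : ℝ) ≤ ((575:ℤ):ℝ) := by exact_mod_cast h1.2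
    push_cast at ha hb
    rw [abs_le]
    constructor <;> linarith

theorem maj1_bound (y : ℝ) (hy : 1 ≤ y) : |A - gi ⌊y⌋₊| ≤ maj1 y := by
  have h0 : 0 ≤ y := by linarith
  have hj : 1 ≤ ⌊y⌋₊ := Nat.le_floor (by simpa using hy)
  have h := gbnd_all _ hj
  simp only [maj1, stp_floor _ h0, hj, if_true]
  split_ifs at h ⊢ <;> linarith

end MP
end

section
open ArithmeticFunction (vonMangoldt)

namespace MP

theorem T_nat (z : ℝ) : T z = Real.log (⌊z⌋₊.factorial) := by
  rw [T]
  induction ⌊z⌋₊ with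
  | zero => simp
  | succ n ih =>
    rw [Nat.factorial_succ, ← Finset.insert_Ioc_right_eq_Ioc_add_one (Nat.zero_le n), Finset.sum_insert (by simp), ih]
    push_cast
    rw [Real.log_mul (by positivity) (by positivity)]

theorem log_fact_upper (n : ℕ) (hn : 1 ≤ n) :
    Real.log n.factorial ≤ n * Real.log n - n + 1 + Real.log n := by
  induction n, hn using Nat.le_induction with
  | base => simp
  | succ n hn ih =>
    have hn0 : (0:ℝ) < n := by exact_mod_cast hn
    rw [Nat.factorial_succ]
    push_cast
    rw [Real.log_mul (by positivity) (by positivity)]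
    have h := Real.one_sub_inv_le_log_of_pos (show (0:ℝ) < (n+1)/n by positivity)
    rw [Real.log_div (by positivity) (by positivity), inv_div] at h
    have h2 : ((n:ℝ)+1) * (1 - n/(n+1)) = 1 := by field_simp; ring
    have h3 := mul_le_mul_of_nonneg_left h (show (0:ℝ) ≤ n+1 by positivity)
    nlinarith

theorem f_mono {a b : ℝ} (ha : 1 ≤ a) (hab : a ≤ b) :
    a * Real.log a - a ≤ b * Real.log b - b ∧
    b * Real.log b - b ≤ a * Real.log a - a + (b - a) * Real.log b := by
  have ha0 : 0 < a := by linarith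
  have hb0 : 0 < b := by linarith
  have h := Real.one_sub_inv_le_log_of_pos (show (0:ℝ) < b/a by positivity)
  have h' := Real.log_le_sub_one_of_pos (show (0:ℝ) < b/a by positivity)
  rw [Real.log_div (by positivity) (by positivity)] at h h'
  rw [inv_div] at h
  have e1 : b * (1 - a / b) = b - a := by field_simp
  have e2 : a * (b / a - 1) = b - a := by field_simp
  have h1 := mul_le_mul_of_nonneg_left h hb0.le
  have h2 := mul_le_mul_of_nonneg_left h' ha0.le
  have hla : 0 ≤ Real.log a := Real.log_nonneg ha
  rw [e1] at h1
  rw [e2] at h2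
  constructor
  · nlinarith [mul_nonneg (sub_nonneg.2 hab) hla]
  · nlinarith

theorem T_bound {z : ℝ} (hz : 1 ≤ z) : |T z - (z * Real.log z - z)| ≤ Real.log z + 1 := by
  have hj : 1 ≤ ⌊z⌋₊ := Nat.le_floor (by simpa using hz)
  have hj' : (1:ℝ) ≤ (⌊z⌋₊:ℝ) := by exact_mod_cast hj
  have hle : (⌊z⌋₊:ℝ) ≤ z := Nat.floor_le (by linarith)
  have hlt := Nat.lt_floor_add_one z
  rw [T_nat]
  have h1 := log_fact_upper _ hj
  have h2 := Stirling.le_log_factorial_stirling (n := ⌊z⌋₊) (by omega)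
  obtain ⟨h3, h4⟩ := f_mono hj' hle
  have hl1 : 0 ≤ Real.log (⌊z⌋₊:ℝ) := Real.log_nonneg hj'
  have hl2 : Real.log (⌊z⌋₊:ℝ) ≤ Real.log z := Real.log_le_log (by linarith) hle
  have hl3 : 0 ≤ Real.log (2 * π) := Real.log_nonneg (by nlinarith [Real.pi_gt_three])
  rw [abs_le]
  constructor
  · nlinarith
  · linarith

theorem comb_T {x : ℝ} (hx : 11 ≤ x) :
    |comb (fun d => T (x / d)) - A * x| ≤ 1679 * (Real.log x + 1) := by
  have key : ∀ d : ℕ, 1 ≤ d → d ≤ 11 → |T (x / d) - ((x/d) * (Real.log x - Real.log d) - x/d)| ≤ Real.log x + 1 := by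
    intro d hd hd'
    have h0 : (1:ℝ) ≤ d := by exact_mod_cast hd
    have h1 : (d:ℝ) ≤ 11 := by exact_mod_cast hd'
    have h := T_bound (z := x / d) (by rw [le_div_iff₀ (by linarith)]; linarith)
    rw [Real.log_div (by linarith) (by linarith)] at h
    have := Real.log_nonneg h0
    linarith
  have k1 := abs_le.1 (key 1 (by norm_num) (by norm_num))
  have k2 := abs_le.1 (key 2 (by norm_num) (by norm_num))
  have k3 := abs_le.1 (key 3 (by norm_num) (by norm_num))
  have k5 := abs_le.1 (key 5 (by norm_num) (by norm_num))
  have k6 := abs_le.1 (key 6 (by norm_num) (by norm_num))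
  have k7 := abs_le.1 (key 7 (by norm_num) (by norm_num))
  have k10 := abs_le.1 (key 10 (by norm_num) (by norm_num))
  have k11 := abs_le.1 (key 11 (by norm_num) (by norm_num))
  have l6 : Real.log ((6:ℕ):ℝ) = Real.log 2 + Real.log 3 := by
    rw [← Real.log_mul (by norm_num) (by norm_num)]; norm_num
  have l10 : Real.log ((10:ℕ):ℝ) = Real.log 2 + Real.log 5 := by
    rw [← Real.log_mul (by norm_num) (by norm_num)]; norm_num
  rw [l6] at k6
  rw [l10] at k10
  simp only [comb, A]
  push_cast at *
  simp only [Real.log_one] at k1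
  rw [abs_le]
  constructor <;> linarith

theorem comb_sum (s : Finset ℕ) (w : ℕ → ℝ) (F : ℕ → ℕ → ℝ) :
    ∑ n ∈ s, w n * comb (F n) = comb (fun d => ∑ n ∈ s, w n * F n d) := by
  simp only [comb, Finset.mul_sum, ← Finset.sum_sub_distrib, ← Finset.sum_add_distrib]
  apply Finset.sum_congr rfl
  intros; ring

theorem maj_sum (x : ℝ) : ∑ n ∈ Ioc 0 ⌊x⌋₊, vonMangoldt n * maj1 (x / n)
    = 0.16 * Chebyshev.psi x + 0.84 * Chebyshev.psi (x / 11) + 219 * Chebyshev.psi (x / 13)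
     + 20 * Chebyshev.psi (x / 131) + 25 * Chebyshev.psi (x / 349) + 100 * Chebyshev.psi (x / 616) := by
  have h1 := sum_stp x 1 (by norm_num)
  have h11 := sum_stp x 11 (by norm_num)
  have h13 := sum_stp x 13 (by norm_num)
  have h131 := sum_stp x 131 (by norm_num)
  have h349 := sum_stp x 349 (by norm_num)
  have h616 := sum_stp x 616 (by norm_num)
  push_cast at *
  rw [div_one] at h1
  rw [← h1, ← h11, ← h13, ← h131, ← h349, ← h616]
  simp only [maj1, Finset.mul_sum, ← Finset.sum_add_distrib]
  apply Finset.sum_congr rfl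
  intros; ring

theorem psi_main (x : ℝ) : |A * Chebyshev.psi x - comb (fun d => T (x / d))|
    ≤ 0.16 * Chebyshev.psi x + 0.84 * Chebyshev.psi (x / 11) + 219 * Chebyshev.psi (x / 13)
     + 20 * Chebyshev.psi (x / 131) + 25 * Chebyshev.psi (x / 349) + 100 * Chebyshev.psi (x / 616) := by
  have e : A * Chebyshev.psi x - comb (fun d => T (x / d)) = ∑ n ∈ Ioc 0 ⌊x⌋₊, vonMangoldt n * (A - gi ⌊x/n⌋₊) := by
    have : (fun d : ℕ => T (x / d)) = fun d : ℕ => ∑ n ∈ Ioc 0 ⌊x⌋₊, vonMangoldt n * ((⌊x⌋₊ / n / d : ℕ) : ℝ) := by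
      funext d; rw [sum_ext_T]
    rw [this, ← comb_sum, Chebyshev.psi, Finset.mul_sum, ← Finset.sum_sub_distrib]
    apply Finset.sum_congr rfl
    intro n _
    rw [Nat.floor_div_natCast, gi_comb]
    ring
  rw [e, ← maj_sum]
  refine (Finset.abs_sum_le_sum_abs _ _).trans (Finset.sum_le_sum ?_)
  intro n hn
  rw [mem_Ioc] at hn
  rw [abs_mul, abs_of_nonneg ArithmeticFunction.vonMangoldt_nonneg]
  apply mul_le_mul_of_nonneg_left _ ArithmeticFunction.vonMangoldt_nonneg
  apply maj1_bound
  have hn0 : (0:ℝ) < n := by exact_mod_cast hn.1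
  rw [le_div_iff₀ hn0, one_mul]
  exact (Nat.le_floor_iff' (by omega)).1 hn.2

end MP
end

section
open ArithmeticFunction (vonMangoldt)

namespace MP

/-- check `lcm(1..n) ≤ 2^(1.6158 n)` in a loop -/
def lloop : ℕ → ℕ → ℕ → Bool
  | 0, _, _ => true
  | f+1, n, l => Nat.ble l (2 ^ (n * 16158 / 10000)) && lloop f (n+1) (Nat.lcm l (n+1))

theorem lloop_cert : lloop 3000 1 1 = true := by decide +kernel

theorem lloop_sound : ∀ (f n l : ℕ), lloop f n l = true → l = (Icc 1 n).lcm id →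
    ∀ m, n ≤ m → m < n + f → (Icc 1 m).lcm id ≤ 2 ^ (m * 16158 / 10000) := by
  intro f
  induction f with
  | zero => intro n l _ _ m h1 h2; omega
  | succ f ih =>
    intro n l h hl m h1 h2
    rw [lloop, Bool.and_eq_true, Nat.ble_eq] at h
    rcases eq_or_lt_of_le h1 with rfl | h3
    · rw [← hl]; exact h.1
    · refine ih (n+1) _ h.2 ?_ m h3 (by omega)
      rw [← Finset.insert_Icc_right_eq_Icc_add_one (by omega), Finset.lcm_insert, hl]
      simp only [id]
      rw [Nat.lcm_comm]
      rfl

theorem psi_small (n : ℕ) (h1 : 1 ≤ n) (h2 : n ≤ 3000) : Chebyshev.psi n ≤ 1.12 * n := by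
  have h := lloop_sound 3000 1 1 lloop_cert (by decide) n h1 (by omega)
  rw [Chebyshev.psi_eq_log_lcmUpto]
  have hp := Nat.lcmUpto_pos n
  change Nat.lcmUpto n ≤ _ at h
  have h' : ((Nat.lcmUpto n : ℕ):ℝ) ≤ 2 ^ (n * 16158 / 10000) := by exact_mod_cast h
  have h3 := Real.log_le_log (by exact_mod_cast hp) h'
  rw [Real.log_pow] at h3
  have h4 : ((n * 16158 / 10000 : ℕ):ℝ) ≤ n * 16158 / 10000 := by
    refine Nat.cast_div_le.trans ?_
    push_cast; exact le_rfl
  have := Real.log_two_lt_d9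
  have := Real.log_two_gt_d9
  have hn : (0:ℝ) ≤ n := by positivity
  nlinarith

theorem psi_nat (n : ℕ) : Chebyshev.psi n ≤ 1.12 * n := by
  induction n using Nat.strong_induction_on with
  | _ n ih =>
    rcases Nat.lt_or_ge n 3001 with h | h
    · rcases Nat.eq_zero_or_pos n with h0 | h0
      · subst h0; simp [Chebyshev.psi]
      · exact psi_small n h0 (by omega)
    · have hn : (3001:ℝ) ≤ n := by exact_mod_cast h
      have key : ∀ d : ℕ, 2 ≤ d → Chebyshev.psi ((n:ℝ) / d) ≤ 1.12 * (n / d) := by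
        intro d hd
        rw [Chebyshev.psi_eq_psi_coe_floor, Nat.floor_div_natCast, Nat.floor_natCast]
        refine (ih _ (Nat.div_lt_self (by omega) (by omega))).trans ?_
        have : ((n / d : ℕ):ℝ) ≤ n / d := Nat.cast_div_le
        linarith
      have k11 := key 11 (by norm_num)
      have k13 := key 13 (by norm_num)
      have k131 := key 131 (by norm_num)
      have k349 := key 349 (by norm_num)
      have k616 := key 616 (by norm_num)
      have m1 := (abs_le.1 (psi_main n)).2
      have m2 := (abs_le.1 (comb_T (x := n) (by linarith))).2
      obtain ⟨hA1, hA2⟩ := A_bounds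
      have hl : Real.log n ≤ n / 4096 - 1 + 12 * Real.log 2 := by
        have := Real.log_le_sub_one_of_pos (show (0:ℝ) < n / 4096 by positivity)
        rw [Real.log_div (by positivity) (by norm_num), show (4096:ℝ) = 2 ^ 12 by norm_num,
          Real.log_pow] at this
        push_cast at this
        linarith
      have := Real.log_two_lt_d9
      push_cast at *
      have hAn : A * n ≤ 210.1513 * n := by nlinarith
      have hpsi : 0 ≤ Chebyshev.psi (n:ℝ) := Chebyshev.psi_nonneg _
      have hAp : 210.1511 * Chebyshev.psi (n:ℝ) ≤ A * Chebyshev.psi n := by nlinarith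
      linarith

theorem psi_le {x : ℝ} (hx : 0 ≤ x) : Chebyshev.psi x ≤ 1.12 * x := by
  rw [Chebyshev.psi_eq_psi_coe_floor]
  have := psi_nat ⌊x⌋₊
  have := Nat.floor_le hx
  linarith

theorem psi_asymp {x : ℝ} (hx : 11 ≤ x) : |Chebyshev.psi x - x| ≤ 0.0932 * x + 8 * (Real.log x + 1) := by
  have m1 := (abs_le.1 (psi_main x))
  have m2 := (abs_le.1 (comb_T hx))
  have k1 := psi_le (x := x) (by linarith)
  have k11 := psi_le (x := x / 11) (by positivity)
  have k13 := psi_le (x := x / 13) (by positivity)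
  have k131 := psi_le (x := x / 131) (by positivity)
  have k349 := psi_le (x := x / 349) (by positivity)
  have k616 := psi_le (x := x / 616) (by positivity)
  obtain ⟨hA1, hA2⟩ := A_bounds
  have hl : 0 ≤ Real.log x := Real.log_nonneg (by linarith)
  have hb : |A * (Chebyshev.psi x - x)| ≤ 1679 * (Real.log x + 1) + 19.57 * x := by
    rw [abs_le, mul_sub]; constructor <;> linarith
  rw [abs_mul, abs_of_pos (by linarith)] at hb
  nlinarith [abs_nonneg (Chebyshev.psi x - x)]

end MP
end

section
open ArithmeticFunction (vonMangoldt)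

namespace MP

noncomputable def Gu (u : ℝ → ℝ) (a : ℕ → ℝ) (z : ℝ) : ℝ := ∑ m ∈ Ioc 0 ⌊z⌋₊, (u m - u z) * a m

theorem Gu_cont {u : ℝ → ℝ} {a : ℕ → ℝ} {c : ℝ} (hc : 0 ≤ c) (hu : ContinuousOn u (Set.Ioi c))
    (ha : AntitoneOn u (Set.Ioi c)) (h0 : ∀ m : ℕ, 0 < m → (m:ℝ) ≤ c → a m = 0) :
    ContinuousOn (Gu u a) (Set.Ioi c) := by
  intro z hz
  rw [Set.mem_Ioi] at hz
  set N := ⌊z⌋₊ + 1 with hN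
  have hzN : z < N := by rw [hN]; exact_mod_cast Nat.lt_floor_add_one z
  have hev : ∀ᶠ t : ℝ in nhdsWithin z (Set.Ioi c),
      Gu u a t = ∑ m ∈ Ioc 0 N, max (u m - u t) 0 * a m := by
    have : ∀ᶠ t : ℝ in nhdsWithin z (Set.Ioi c), t < N := 
      (Filter.Eventually.filter_mono nhdsWithin_le_nhds (eventually_lt_nhds hzN))
    filter_upwards [this, self_mem_nhdsWithin] with t ht htc
    rw [Set.mem_Ioi] at htc
    have ht0 : 0 ≤ t := by linarith
    have hfl : ⌊t⌋₊ ≤ N := by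
      have := Nat.floor_le ht0
      have : (⌊t⌋₊:ℝ) < N := by linarith
      exact_mod_cast this.le
    rw [Gu, ← Finset.sum_subset (s₁ := Ioc 0 ⌊t⌋₊) (s₂ := Ioc 0 N)]
    · apply Finset.sum_congr rfl
      intro m hm
      rw [mem_Ioc] at hm
      by_cases hmc : (m:ℝ) ≤ c
      · rw [h0 m hm.1 hmc]; simp
      · rw [max_eq_left]
        rw [sub_nonneg]
        exact ha (Set.mem_Ioi.2 (not_le.1 hmc)) (Set.mem_Ioi.2 htc) ((Nat.le_floor_iff ht0).1 hm.2)
    · intro m hm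
      rw [mem_Ioc] at hm ⊢
      exact ⟨hm.1, hm.2.trans hfl⟩
    · intro m hm hm'
      rw [mem_Ioc] at hm hm'
      have : t < m := by
        rw [← Nat.floor_lt ht0]; omega
      rw [max_eq_right, zero_mul]
      rw [sub_nonpos]
      exact ha (Set.mem_Ioi.2 htc) (Set.mem_Ioi.2 (by linarith)) this.le
  have hcont : ContinuousWithinAt (fun t => ∑ m ∈ Ioc 0 N, max (u m - u t) 0 * a m) (Set.Ioi c) z := by
    refine ContinuousOn.continuousWithinAt ?_ hz
    fun_prop
  refine hcont.congr_of_eventuallyEq hev ?_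
  exact hev.self_of_nhdsWithin hz

theorem Gu_deriv {u : ℝ → ℝ} {a : ℕ → ℝ} {z u' : ℝ} (hz : 0 ≤ z) (hu : HasDerivAt u u' z) :
    HasDerivWithinAt (Gu u a) (- u' * ∑ m ∈ Ioc 0 ⌊z⌋₊, a m) (Set.Ici z) z := by
  have hev : ∀ᶠ t : ℝ in nhdsWithin z (Set.Ici z),
      Gu u a t = ∑ m ∈ Ioc 0 ⌊z⌋₊, (u m - u t) * a m := by
    have : ∀ᶠ t : ℝ in nhdsWithin z (Set.Ici z), t < ⌊z⌋₊ + 1 := 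
      (Filter.Eventually.filter_mono nhdsWithin_le_nhds (eventually_lt_nhds (Nat.lt_floor_add_one z)))
    filter_upwards [this, self_mem_nhdsWithin] with t ht htc
    rw [Set.mem_Ici] at htc
    have : ⌊t⌋₊ = ⌊z⌋₊ := by
      rw [Nat.floor_eq_iff (by linarith)]
      exact ⟨(Nat.floor_le hz).trans htc, ht⟩
    rw [Gu, this]
  have hd : HasDerivAt (fun t => ∑ m ∈ Ioc 0 ⌊z⌋₊, (u m - u t) * a m) (∑ m ∈ Ioc 0 ⌊z⌋₊, (- u') * a m) z := by
    apply HasDerivAt.fun_sum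
    intro m _
    exact (hu.const_sub _).mul_const _
  rw [Finset.mul_sum]
  exact hd.hasDerivWithinAt.congr_of_eventuallyEq hev (hev.self_of_nhdsWithin (Set.mem_Ici.2 le_rfl))

/-- If the right derivative of `D` is dominated by `-V'`, then `D` converges with rate `V`. -/
theorem conv_of_deriv {D V D' V' : ℝ → ℝ} {c : ℝ} (hD : ContinuousOn D (Set.Ici c))
    (hV : ContinuousOn V (Set.Ici c))
    (hD' : ∀ x, c ≤ x → HasDerivWithinAt D (D' x) (Set.Ici x) x)
    (hV' : ∀ x, c ≤ x → HasDerivWithinAt V (- V' x) (Set.Ici x) x)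
    (hb : ∀ x, c ≤ x → |D' x| ≤ V' x) {x y : ℝ} (hx : c ≤ x) (hxy : x ≤ y) :
    |D y - D x| ≤ V x - V y := by
  have sub : Set.Icc x y ⊆ Set.Ici c := fun t ht => le_trans hx ht.1
  have key : ∀ E E' : ℝ → ℝ, ContinuousOn E (Set.Icc x y) →
      (∀ t ∈ Set.Ico x y, HasDerivWithinAt E (E' t) (Set.Ici t) t) →
      (∀ t ∈ Set.Ico x y, E' t ≤ 0) → E y ≤ E x := by
    intro E E' h1 h2 h3
    have := image_le_of_deriv_right_le_deriv_boundary (f := E) (f' := E') (B := fun _ => E x)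
      (B' := fun _ => 0) (a := x) (b := y) h1 h2 le_rfl continuousOn_const
      (fun t _ => hasDerivWithinAt_const _ _ _) h3
    exact this (Set.right_mem_Icc.2 hxy)
  have k1 := key (fun t => D t + V t) (fun t => D' t + - V' t) ((hD.mono sub).add (hV.mono sub))
    (fun t ht => (hD' t (hx.trans ht.1)).add (hV' t (hx.trans ht.1)))
    (fun t ht => by have := (abs_le.1 (hb t (hx.trans ht.1))).2; linarith)
  have k2 := key (fun t => - D t + V t) (fun t => - D' t + - V' t) ((hD.mono sub).neg.add (hV.mono sub))
    (fun t ht => (hD' t (hx.trans ht.1)).neg.add (hV' t (hx.trans ht.1)))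
    (fun t ht => by have := (abs_le.1 (hb t (hx.trans ht.1))).1; linarith)
  rw [abs_le]
  constructor <;> linarith

theorem limit_of_rate {D V : ℝ → ℝ} {c : ℝ} (hV : Filter.Tendsto V Filter.atTop (nhds 0))
    (h : ∀ x y, c ≤ x → x ≤ y → |D y - D x| ≤ V x - V y) :
    ∃ C, Filter.Tendsto D Filter.atTop (nhds C) ∧ ∀ x, c ≤ x → |D x - C| ≤ V x := by
  have hV0 : ∀ x, c ≤ x → 0 ≤ V x := by
    intro x hx
    refine le_of_tendsto hV ?_
    filter_upwards [Filter.eventually_ge_atTop x] with y hy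
    have := h x y hx hy
    have := abs_nonneg (D y - D x)
    linarith
  have hc : CauchySeq D := by
    rw [Metric.cauchySeq_iff']
    intro ε hε
    have : ∀ᶠ x in Filter.atTop, V x < ε := hV.eventually_lt_const hε
    obtain ⟨x, hx1, hx2⟩ := (this.and (Filter.eventually_ge_atTop c)).exists
    refine ⟨x, fun y hy => ?_⟩
    rw [Real.dist_eq]
    have := h x y hx2 hy
    have := hV0 y (hx2.trans hy)
    linarith
  obtain ⟨C, hC⟩ := cauchySeq_tendsto_of_complete hc
  refine ⟨C, hC, fun x hx => ?_⟩
  have t1 : Filter.Tendsto (fun y => |D y - D x|) Filter.atTop (nhds |C - D x|) := (hC.sub_const _).abs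
  rw [abs_sub_comm]
  refine le_of_tendsto t1 ?_
  filter_upwards [Filter.eventually_ge_atTop x] with y hy
  have := h x y hx hy
  have := hV0 y (hx.trans hy)
  linarith

theorem inv_anti : AntitoneOn (fun z : ℝ => 1 / z) (Set.Ioi 0) := by
  intro a ha b hb hab
  exact one_div_le_one_div_of_le ha hab

theorem inv_cont : ContinuousOn (fun z : ℝ => 1 / z) (Set.Ioi 0) := by
  intro x hx
  have : x ≠ 0 := ne_of_gt hx
  fun_prop (disch := assumption)

theorem inv_deriv {z : ℝ} (hz : 0 < z) : HasDerivAt (fun z : ℝ => 1 / z) (- (1 / z ^ 2)) z := by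
  have := hasDerivAt_inv hz.ne'
  simpa [one_div] using this

theorem TT_eq (z : ℝ) : TT z = Gu (fun z => 1 / z) (fun m => Real.log m) z := rfl

theorem K_eq (z : ℝ) : K z = Gu (fun z => 1 / z) (fun m => vonMangoldt m) z := by
  simp only [K, Gu, mul_comm]

theorem K_cont : ContinuousOn K (Set.Ioi 0) := by
  have := Gu_cont (a := fun m => vonMangoldt m) le_rfl inv_cont inv_anti
    (by intro m h h'; exfalso; have : (0:ℝ) < m := by exact_mod_cast h
        linarith)
  exact this.congr (fun z _ => K_eq z)

theorem K_deriv {z : ℝ} (hz : 0 < z) : HasDerivWithinAt K (Chebyshev.psi z / z ^ 2) (Set.Ici z) z := by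
  have := Gu_deriv (a := fun m => vonMangoldt m) hz.le (inv_deriv hz)
  have h2 := this.congr (f₁ := K) (fun z _ => K_eq z) (K_eq z)
  refine h2.congr_deriv ?_
  simp only [Chebyshev.psi]; ring

theorem TT_asymp : ∃ C, ∀ z, 1 ≤ z →
    |TT z - (Real.log z ^ 2 / 2 - Real.log z) - C| ≤ (Real.log z + 2) / z := by
  have hTc : ContinuousOn TT (Set.Ioi 0) := 
    Gu_cont (a := fun m => Real.log m) le_rfl inv_cont inv_anti
    (by intro m h h'; exfalso; have : (0:ℝ) < m := by exact_mod_cast h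
        linarith)
  have hTd : ∀ z, 0 < z → HasDerivWithinAt TT (T z / z ^ 2) (Set.Ici z) z := by
    intro z hz
    have := Gu_deriv (a := fun m => Real.log m) hz.le (inv_deriv hz)
    have h2 : HasDerivWithinAt TT _ (Set.Ici z) z := this
    refine h2.congr_deriv ?_
    rw [T]; ring
  have sub : Set.Ici (1:ℝ) ⊆ Set.Ioi 0 := fun t ht => lt_of_lt_of_le one_pos (Set.mem_Ici.1 ht)
  have hne : ∀ x ∈ Set.Ici (1:ℝ), x ≠ 0 := fun t ht => (lt_of_lt_of_le one_pos ht).ne'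
  have hV : Filter.Tendsto (fun z => (Real.log z + 2) / z) Filter.atTop (nhds 0) := by
    have h1 := Real.isLittleO_log_id_atTop.tendsto_div_nhds_zero
    have h2 : Filter.Tendsto (fun z : ℝ => 2 / z) Filter.atTop (nhds 0) := tendsto_const_nhds.div_atTop Filter.tendsto_id
    have := h1.add h2
    simp only [add_zero] at this
    refine this.congr (fun z => ?_)
    simp only [id]; ring
  obtain ⟨C, _, hC⟩ := limit_of_rate (D := fun z => TT z - (Real.log z ^ 2 / 2 - Real.log z)) (c := 1) hV
    (fun x y hx hxy => conv_of_deriv (c := 1)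
      (D' := fun z => (T z - (z * Real.log z - z)) / z ^ 2) (V' := fun z => (Real.log z + 1) / z ^ 2)
      (D := fun z => TT z - (Real.log z ^ 2 / 2 - Real.log z)) (V := fun z => (Real.log z + 2) / z)
      ((hTc.mono sub).sub (by fun_prop (disch := exact hne)))
      (by fun_prop (disch := exact hne))
      (by
        intro x hx
        have hx0 : 0 < x := by linarith
        have hl := Real.hasDerivAt_log hx0.ne'
        have := (hTd x hx0).sub ((((hl.pow 2).div_const 2).sub hl).hasDerivWithinAt (s := Set.Ici x))
        refine this.congr_deriv ?_
        field_simp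
        push_cast
        ring)
      (by
        intro x hx
        have hx0 : 0 < x := by linarith
        have hl := Real.hasDerivAt_log hx0.ne'
        have := ((hl.add_const 2).div (hasDerivAt_id x) hx0.ne').hasDerivWithinAt (s := Set.Ici x)
        refine this.congr_deriv ?_
        simp only [id]
        field_simp
        ring)
      (by
        intro x hx
        rw [abs_div, abs_of_pos (show 0 < x ^ 2 by positivity)]
        exact div_le_div_of_nonneg_right (T_bound hx) (by positivity))
      hx hxy)
  exact ⟨C, hC⟩

end MP
end

section
open ArithmeticFunction (vonMangoldt)

namespace MP

noncomputable def Hr (n : ℕ) : ℝ := ∑ i ∈ Ioc 0 n, 1 / (i:ℝ)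

theorem Hr_succ (n : ℕ) : Hr (n+1) = Hr n + 1 / ((n:ℝ)+1) := by
  rw [Hr, ← Finset.insert_Ioc_right_eq_Ioc_add_one (Nat.zero_le n), Finset.sum_insert (by simp), ← Hr]
  push_cast; ring

theorem Hr_harmonic (n : ℕ) : Hr n = (harmonic n : ℝ) := by
  induction n with
  | zero => simp [Hr]
  | succ n ih => rw [Hr_succ, harmonic_succ, ih]; push_cast; simp

theorem L_eq (v : ℝ) : L v = Hr ⌊v⌋₊ - ⌊v⌋₊ / v := by
  rw [L, Finset.sum_sub_distrib, ← Hr]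
  simp [div_eq_mul_inv]

theorem Hr_gamma_low (n : ℕ) : Hr n - Real.log (n+1) ≤ Real.eulerMascheroniConstant := by
  have := Real.eulerMascheroniSeq_lt_eulerMascheroniConstant n
  rw [Real.eulerMascheroniSeq, ← Hr_harmonic] at this
  exact this.le

theorem Hr_gamma_up (n : ℕ) (hn : 1 ≤ n) : Real.eulerMascheroniConstant ≤ Hr n - Real.log n := by
  have := Real.eulerMascheroniConstant_lt_eulerMascheroniSeq' n
  rw [Real.eulerMascheroniSeq', if_neg (by omega), ← Hr_harmonic] at this
  exact this.le

theorem L_bound {v : ℝ} (hv : 1 ≤ v) :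
    0 ≤ v * (L v - Real.log v - Real.eulerMascheroniConstant + 1) ∧
    v * (L v - Real.log v - Real.eulerMascheroniConstant + 1) ≤ 1 := by
  have hv0 : 0 < v := by linarith
  rw [L_eq]
  set n := ⌊v⌋₊ with hn
  have h1 : (n:ℝ) ≤ v := Nat.floor_le hv0.le
  have h2 : v < n + 1 := Nat.lt_floor_add_one v
  have g1 := Hr_gamma_low n
  have g2 := Hr_gamma_up (n+1) (by omega)
  rw [Hr_succ] at g2
  push_cast at g2
  have hn0 : (0:ℝ) ≤ n := by positivity
  have hn1 : (0:ℝ) < n + 1 := by positivity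
  have hl := Real.one_sub_inv_le_log_of_pos (show (0:ℝ) < (n+1)/v by positivity)
  have hl' := Real.log_le_sub_one_of_pos (show (0:ℝ) < (n+1)/v by positivity)
  rw [Real.log_div (by positivity) (by positivity)] at hl hl'
  rw [inv_div] at hl
  constructor
  · apply mul_nonneg hv0.le
    have : (n:ℝ) / v - n / (n+1) ≤ 1 - v / (n+1) := by
      rw [div_sub_div _ _ hv0.ne' hn1.ne', one_sub_div hn1.ne', div_le_div_iff₀ (by positivity) hn1]
      have : 0 ≤ (v - n) * ((n+1-v) * (n+1)) := by
        apply mul_nonneg (by linarith) (mul_nonneg (by linarith) hn1.le)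
      nlinarith
    have e : (n:ℝ)/(n+1) = 1 - 1/(n+1) := by field_simp; ring
    linarith
  · have : Hr n - n / v - Real.log v - Real.eulerMascheroniConstant + 1 ≤ 1 / v := by
      have e : ((n:ℝ)+1)/v = n/v + 1/v := by ring
      linarith
    calc _ ≤ v * (1/v) := mul_le_mul_of_nonneg_left this hv0.le
      _ = 1 := by field_simp

noncomputable def W (y : ℝ) : ℝ := y * comb (fun d => L (y / d) / d) - A * (y - 1)

noncomputable def Sj (j : ℕ) : ℝ := comb (fun d => Hr (j / d) / d)

theorem Hr_div_succ (j d : ℕ) (hd : 1 ≤ d) : Hr ((j+1)/d) / d - Hr (j/d) / d =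
    (((j+1)/d : ℕ) - ((j/d:ℕ):ℝ)) / (j+1) := by
  rw [Nat.succ_div]
  have hd0 : (0:ℝ) < d := by exact_mod_cast hd
  split_ifs with h
  · obtain ⟨q, hq⟩ := h
    have hq0 : 0 < q := by
      rcases Nat.eq_zero_or_pos q with h0 | h0
      · subst h0; omega
      · exact h0
    have : j / d = q - 1 := by
      have e : j = d * (q - 1) + (d - 1) := by
        obtain ⟨q', rfl⟩ : ∃ q', q = q' + 1 := ⟨q-1, by omega⟩
        rw [Nat.add_sub_cancel]
        rw [mul_add] at hq
        omega
      rw [e, Nat.mul_add_div (by omega), Nat.div_eq_of_lt (by omega), add_zero]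
    rw [this, Hr_succ]
    have hq1 : (0:ℝ) < q := by exact_mod_cast hq0
    have hj : (j:ℝ) + 1 = d * q := by exact_mod_cast hq
    rw [hj]
    push_cast [Nat.cast_sub hq0]
    have hq2 : (q:ℝ) ≠ 0 := hq1.ne'
    have hd2 : (d:ℝ) ≠ 0 := hd0.ne'
    rw [show (q:ℝ) - 1 + 1 = q by ring]
    field_simp
    ring
  · simp

theorem Sj_succ (j : ℕ) : Sj (j+1) = Sj j + ((gi (j+1) - gi j : ℤ) : ℝ) / (j+1) := by
  have h1 := Hr_div_succ j 1 (by norm_num)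
  have h2 := Hr_div_succ j 2 (by norm_num)
  have h3 := Hr_div_succ j 3 (by norm_num)
  have h5 := Hr_div_succ j 5 (by norm_num)
  have h6 := Hr_div_succ j 6 (by norm_num)
  have h7 := Hr_div_succ j 7 (by norm_num)
  have h10 := Hr_div_succ j 10 (by norm_num)
  have h11 := Hr_div_succ j 11 (by norm_num)
  rw [Int.cast_sub, gi_comb, gi_comb]
  simp only [Sj, comb]
  rw [sub_div] at *
  simp only [add_div, sub_div, mul_div_assoc]
  linarith

theorem W_eq {y : ℝ} (hy : 1 ≤ y) : W y = y * (Sj ⌊y⌋₊ - A) + A - gi ⌊y⌋₊ := by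
  have hy0 : 0 < y := by linarith
  have key : ∀ d : ℕ, 1 ≤ d → y * (L (y/d) / d) = y * (Hr (⌊y⌋₊ / d) / d) - ((⌊y⌋₊ / d : ℕ) : ℝ) := by
    intro d hd
    have hd0 : (0:ℝ) < d := by exact_mod_cast hd
    rw [L_eq, Nat.floor_div_natCast]
    field_simp
  have h1 := key 1 (by norm_num)
  have h2 := key 2 (by norm_num)
  have h3 := key 3 (by norm_num)
  have h5 := key 5 (by norm_num)
  have h6 := key 6 (by norm_num)
  have h7 := key 7 (by norm_num)
  have h10 := key 10 (by norm_num)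
  have h11 := key 11 (by norm_num)
  rw [W, gi_comb]
  simp only [Sj, comb]
  linarith

def Bj (j : ℕ) : ℤ := if j < 4 then 460000000 else if j < 7 then 910000000 else
    if j < 13 then 1640000000 else 16000000000

theorem vloop_sound : ∀ (f j : ℕ) (s : ℤ), vloop f j s = true → (s:ℝ) ≤ 10^9 * Sj j → 
    10^9 * Sj j ≤ s + j → ∀ i, j ≤ i → i < j + f → ∃ s : ℤ, vok i s = true ∧ 
    (s:ℝ) ≤ 10^9 * Sj i ∧ 10^9 * Sj i ≤ s + i := by
  intro f
  induction f with
  | zero => intro j s _ _ _ i h1 h2; omega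
  | succ f ih =>
    intro j s h h1 h2 i hi1 hi2
    rw [vloop, Bool.and_eq_true] at h
    rcases eq_or_lt_of_le hi1 with rfl | h3
    · exact ⟨s, h.1, h1, h2⟩
    · refine ih (j+1) _ h.2 ?_ ?_ i h3 (by omega)
      · rw [Sj_succ]
        have hd := Int.ediv_mul_le (1000000000 * (gi (j+1) - gi j)) (b := ((j+1:ℕ):ℤ)) (by omega)
        have hd' : (((1000000000 * (gi (j+1) - gi j)) / ((j+1:ℕ):ℤ) : ℤ) : ℝ) * ((j:ℝ)+1) ≤ 1000000000 * ((gi (j+1) - gi j : ℤ):ℝ) := by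
          exact_mod_cast hd
        have hj : (0:ℝ) < (j:ℝ)+1 := by positivity
        rw [← le_div_iff₀ hj] at hd'
        rw [Int.cast_add, mul_add, ← mul_div_assoc]
        refine add_le_add h1 (hd'.trans (le_of_eq ?_))
        norm_num
      · rw [Sj_succ]
        have hd := (Int.lt_ediv_add_one_mul_self (1000000000 * (gi (j+1) - gi j)) (b := ((j+1:ℕ):ℤ)) (by omega)).le
        have hd' : 1000000000 * ((gi (j+1) - gi j : ℤ):ℝ) ≤ ((((1000000000 * (gi (j+1) - gi j)) / ((j+1:ℕ):ℤ) : ℤ) : ℝ) + 1) * ((j:ℝ)+1) := by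
          exact_mod_cast hd
        have hj : (0:ℝ) < (j:ℝ)+1 := by positivity
        rw [← div_le_iff₀ hj] at hd'
        rw [Int.cast_add, mul_add, ← mul_div_assoc]
        rw [show (10:ℝ)^9 = 1000000000 by norm_num] at *
        push_cast at *
        linarith

theorem W_small {y : ℝ} (hy : 1 ≤ y) (hy2 : ⌊y⌋₊ < 2310) : |W y| ≤ (Bj ⌊y⌋₊ : ℝ) / 10^9 := by
  have hj : 1 ≤ ⌊y⌋₊ := Nat.le_floor (by simpa using hy)
  have hle : (⌊y⌋₊:ℝ) ≤ y := Nat.floor_le (by linarith)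
  have hlt := Nat.lt_floor_add_one y
  have hS1 : Sj 1 = 210 := by
    simp [Sj, comb, Hr]
  obtain ⟨s, h1, h2, h3⟩ := vloop_sound 2309 1 210000000000 vloop_cert (by rw [hS1]; norm_num)
    (by rw [hS1]; norm_num) ⌊y⌋₊ hj (by omega)
  rw [W_eq hy]
  generalize hjj : ⌊y⌋₊ = j at *
  obtain ⟨hA1, hA2⟩ := A_bounds
  unfold vok at h1
  change decide ((j:ℤ) * (s - 210151300000) + 210151100000 - 1000000000 * gi j ≥ -Bj j ∧
   (j+1:ℤ) * (s - 210151300000) + 210151100000 - 1000000000 * gi j ≥ -Bj j ∧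
   (j:ℤ) * (s + j - 210151100000) + 210151300000 - 1000000000 * gi j ≤ Bj j ∧
   (j+1:ℤ) * (s + j - 210151100000) + 210151300000 - 1000000000 * gi j ≤ Bj j) = true at h1
  rw [decide_eq_true_eq] at h1
  obtain ⟨a1, a2, a3, a4⟩ := h1
  have b1 : (-Bj j : ℝ) ≤ (j:ℝ) * (s - 210151300000) + 210151100000 - 1000000000 * gi j := by exact_mod_cast a1
  have b2 : (-Bj j : ℝ) ≤ (j+1:ℝ) * (s - 210151300000) + 210151100000 - 1000000000 * gi j := by exact_mod_cast a2
  have b3 : (j:ℝ) * (s + j - 210151100000) + 210151300000 - 1000000000 * gi j ≤ Bj j := by exact_mod_cast a3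
  have b4 : (j+1:ℝ) * (s + j - 210151100000) + 210151300000 - 1000000000 * gi j ≤ Bj j := by exact_mod_cast a4
  set t := y - j with ht
  have ht0 : 0 ≤ t := by linarith
  have ht1 : 0 ≤ 1 - t := by linarith
  have hy0 : 0 ≤ y := by linarith
  have hyt : y = (1 - t) * j + t * (j+1) := by rw [ht]; ring
  have lo : y * (s - 210151300000) + 210151100000 - 1000000000 * gi j ≥ -Bj j := by
    have := mul_le_mul_of_nonneg_left b1 ht1
    have := mul_le_mul_of_nonneg_left b2 ht0
    rw [hyt]; nlinarith
  have hi : y * (s + j - 210151100000) + 210151300000 - 1000000000 * gi j ≤ Bj j := by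
    have := mul_le_mul_of_nonneg_left b3 ht1
    have := mul_le_mul_of_nonneg_left b4 ht0
    rw [hyt]; nlinarith
  rw [show (10:ℝ)^9 = 1000000000 by norm_num] at *
  rw [abs_le, le_div_iff₀ (by norm_num), ← neg_div, div_le_iff₀ (by norm_num)]
  have c1 : y * s ≤ y * (1000000000 * Sj j) := mul_le_mul_of_nonneg_left h2 hy0
  have c2 : y * (1000000000 * Sj j) ≤ y * (s + j) := mul_le_mul_of_nonneg_left h3 hy0
  have c3 : y * A ≤ y * 210.1513 := mul_le_mul_of_nonneg_left hA2.le hy0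
  have c4 : y * 210.1511 ≤ y * A := mul_le_mul_of_nonneg_left hA1.le hy0
  constructor <;> nlinarith

theorem W_tail {y : ℝ} (hy : 11 ≤ y) : |W y| ≤ 841 := by
  have hy0 : 0 < y := by linarith
  have key : ∀ d : ℕ, 1 ≤ d → d ≤ 11 → 0 ≤ y * (L (y/d) / d) - (y/d) * (Real.log y - Real.log d + Real.eulerMascheroniConstant - 1) ∧ y * (L (y/d) / d) - (y/d) * (Real.log y - Real.log d + Real.eulerMascheroniConstant - 1) ≤ 1 := by
    intro d hd hd'
    have h0 : (1:ℝ) ≤ d := by exact_mod_cast hd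
    have h1 : (d:ℝ) ≤ 11 := by exact_mod_cast hd'
    have h := L_bound (v := y / d) (by rw [le_div_iff₀ (by linarith)]; linarith)
    rw [Real.log_div (by linarith) (by linarith)] at h
    have e : y * (L (y/d) / d) - (y/d) * (Real.log y - Real.log d + Real.eulerMascheroniConstant - 1) = y / d * (L (y / d) - (Real.log y - Real.log d) - eulerMascheroniConstant + 1) := by ring
    rw [e]; exact h
  have k1 := (key 1 (by norm_num) (by norm_num))
  have k2 := (key 2 (by norm_num) (by norm_num))
  have k3 := (key 3 (by norm_num) (by norm_num))
  have k5 := (key 5 (by norm_num) (by norm_num))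
  have k6 := (key 6 (by norm_num) (by norm_num))
  have k7 := (key 7 (by norm_num) (by norm_num))
  have k10 := (key 10 (by norm_num) (by norm_num))
  have k11 := (key 11 (by norm_num) (by norm_num))
  have l6 : Real.log ((6:ℕ):ℝ) = Real.log 2 + Real.log 3 := by
    rw [← Real.log_mul (by norm_num) (by norm_num)]; norm_num
  have l10 : Real.log ((10:ℕ):ℝ) = Real.log 2 + Real.log 5 := by
    rw [← Real.log_mul (by norm_num) (by norm_num)]; norm_num
  rw [l6] at k6
  rw [l10] at k10
  obtain ⟨hA1, hA2⟩ := A_bounds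
  have hA : A * y = (49 * Real.log 2 + 35 * Real.log 3 + 21 * Real.log 5
  + 30 * Real.log 7 + 19 * Real.log 11) * y := rfl
  simp only [W, comb]
  push_cast at *
  simp only [Real.log_one] at k1
  rw [abs_le]
  constructor <;> linarith

noncomputable def maj2 (y : ℝ) : ℝ := 0.46 * stp 1 y + 0.45 * stp 4 y + 0.73 * stp 7 y
  + 14.36 * stp 13 y + 825 * stp 2310 y

theorem maj2_bound {y : ℝ} (hy : 1 ≤ y) : |W y| ≤ maj2 y := by
  have h0 : 0 ≤ y := by linarith
  have hj : 1 ≤ ⌊y⌋₊ := Nat.le_floor (by simpa using hy)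
  simp only [maj2, stp_floor _ h0, hj, if_true]
  by_cases h : ⌊y⌋₊ < 2310
  · have hw := W_small hy h
    unfold Bj at hw
    split_ifs at hw with c1 c2 c3
    all_goals push_cast at hw
    · rw [if_neg (by omega), if_neg (by omega), if_neg (by omega), if_neg (by omega)]
      linarith
    · rw [if_pos (by omega), if_neg (by omega), if_neg (by omega), if_neg (by omega)]
      linarith
    · rw [if_pos (by omega), if_pos (by omega), if_neg (by omega), if_neg (by omega)]
      linarith
    · rw [if_pos (by omega), if_pos (by omega), if_pos (by omega), if_neg (by omega)]
      linarith
  · have h3 : (11:ℝ) ≤ y := by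
      have : ((11:ℕ):ℝ) ≤ y := (Nat.le_floor_iff h0).1 (by omega)
      exact_mod_cast this
    have := W_tail h3
    rw [if_pos (by omega), if_pos (by omega), if_pos (by omega), if_pos (by omega)]
    linarith

theorem maj2_sum (x : ℝ) : ∑ n ∈ Ioc 0 ⌊x⌋₊, vonMangoldt n * maj2 (x / n)
    = 0.46 * Chebyshev.psi x + 0.45 * Chebyshev.psi (x / 4) + 0.73 * Chebyshev.psi (x / 7)
     + 14.36 * Chebyshev.psi (x / 13) + 825 * Chebyshev.psi (x / 2310) := by
  have h1 := sum_stp x 1 (by norm_num)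
  have h4 := sum_stp x 4 (by norm_num)
  have h7 := sum_stp x 7 (by norm_num)
  have h13 := sum_stp x 13 (by norm_num)
  have h2310 := sum_stp x 2310 (by norm_num)
  push_cast at *
  rw [div_one] at h1
  rw [← h1, ← h4, ← h7, ← h13, ← h2310]
  simp only [maj2, Finset.mul_sum, ← Finset.sum_add_distrib]
  apply Finset.sum_congr rfl
  intros; ring

theorem K_ident {x : ℝ} (hx : 0 < x) : comb (fun d => TT (x / d) / d) - A * K x
    = (∑ n ∈ Ioc 0 ⌊x⌋₊, vonMangoldt n * W (x / n)) / x := by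
  have : (fun d : ℕ => TT (x / d) / d) = fun d : ℕ => ∑ n ∈ Ioc 0 ⌊x⌋₊, vonMangoldt n / n * (L (x / n / d) / d) := by
    funext d; rw [← sum_ext_TT, Finset.sum_div]
    apply Finset.sum_congr rfl
    intros; ring
  rw [this, ← comb_sum, K, Finset.mul_sum, ← Finset.sum_sub_distrib, Finset.sum_div]
  apply Finset.sum_congr rfl
  intro n hn
  rw [mem_Ioc] at hn
  have hn0 : (0:ℝ) < n := by exact_mod_cast hn.1
  rw [W]
  generalize comb _ = c
  field_simp

theorem comb_quad (C l e : ℝ) (F : ℕ → ℝ)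
    (key : ∀ d : ℕ, 1 ≤ d → d ≤ 11 →
      |F d - ((l - Real.log d)^2 / 2 - (l - Real.log d) + C) / d| ≤ e) :
    |comb F - A * l - comb (fun d => ((Real.log d) ^ 2 / 2 + Real.log d) / d)| ≤ 1679 * e := by
  have k1 := abs_le.1 (key 1 (by norm_num) (by norm_num))
  have k2 := abs_le.1 (key 2 (by norm_num) (by norm_num))
  have k3 := abs_le.1 (key 3 (by norm_num) (by norm_num))
  have k5 := abs_le.1 (key 5 (by norm_num) (by norm_num))
  have k6 := abs_le.1 (key 6 (by norm_num) (by norm_num))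
  have k7 := abs_le.1 (key 7 (by norm_num) (by norm_num))
  have k10 := abs_le.1 (key 10 (by norm_num) (by norm_num))
  have k11 := abs_le.1 (key 11 (by norm_num) (by norm_num))
  have e6 : Real.log ((6:ℕ):ℝ) = Real.log 2 + Real.log 3 := by
    rw [← Real.log_mul (by norm_num) (by norm_num)]; norm_num
  have e10 : Real.log ((10:ℕ):ℝ) = Real.log 2 + Real.log 5 := by
    rw [← Real.log_mul (by norm_num) (by norm_num)]; norm_num
  clear key
  simp only [comb, A]
  have e1 : Real.log ((1:ℕ):ℝ) = 0 := by simp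
  rw [e1] at k1
  simp only [e1]
  clear e1
  push_cast at *
  generalize Real.log 6 = l6 at *
  generalize Real.log 10 = l10 at *
  generalize Real.log 2 = l2 at *
  generalize Real.log 3 = l3 at *
  generalize Real.log 5 = l5 at *
  generalize Real.log 7 = l7 at *
  generalize Real.log 11 = l11 at *
  subst e6
  subst e10
  have id : 210 * F 1 - 210 * F 2 - 210 * F 3 - 210 * F 5 + 210 * F 6 - 210 * F 7 + 210 * F 10 - 209 * F 11
    - (49 * l2 + 35 * l3 + 21 * l5 + 30 * l7 + 19 * l11) * l
    - (210 * ((0 ^ 2 / 2 + 0) / 1) - 210 * ((l2 ^ 2 / 2 + l2) / 2) - 210 * ((l3 ^ 2 / 2 + l3) / 3) - 210 * ((l5 ^ 2 / 2 + l5) / 5)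
      + 210 * (((l2+l3) ^ 2 / 2 + (l2+l3)) / 6) - 210 * ((l7 ^ 2 / 2 + l7) / 7) + 210 * (((l2+l5) ^ 2 / 2 + (l2+l5)) / 10) - 209 * ((l11 ^ 2 / 2 + l11) / 11))
    = 210 * (F 1 - ((l - 0)^2 / 2 - (l - 0) + C) / 1) - 210 * (F 2 - ((l - l2)^2 / 2 - (l - l2) + C) / 2)
    - 210 * (F 3 - ((l - l3)^2 / 2 - (l - l3) + C) / 3) - 210 * (F 5 - ((l - l5)^2 / 2 - (l - l5) + C) / 5)
    + 210 * (F 6 - ((l - (l2+l3))^2 / 2 - (l - (l2+l3)) + C) / 6) - 210 * (F 7 - ((l - l7)^2 / 2 - (l - l7) + C) / 7)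
    + 210 * (F 10 - ((l - (l2+l5))^2 / 2 - (l - (l2+l5)) + C) / 10) - 209 * (F 11 - ((l - l11)^2 / 2 - (l - l11) + C) / 11) := by ring
  rw [id]
  generalize (F 1 - ((l - 0)^2 / 2 - (l - 0) + C) / 1) = a1 at *
  generalize (F 2 - ((l - l2)^2 / 2 - (l - l2) + C) / 2) = a2 at *
  generalize (F 3 - ((l - l3)^2 / 2 - (l - l3) + C) / 3) = a3 at *
  generalize (F 5 - ((l - l5)^2 / 2 - (l - l5) + C) / 5) = a5 at *
  generalize (F 6 - ((l - (l2+l3))^2 / 2 - (l - (l2+l3)) + C) / 6) = a6 at *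
  generalize (F 7 - ((l - l7)^2 / 2 - (l - l7) + C) / 7) = a7 at *
  generalize (F 10 - ((l - (l2+l5))^2 / 2 - (l - (l2+l5)) + C) / 10) = a10 at *
  generalize (F 11 - ((l - l11)^2 / 2 - (l - l11) + C) / 11) = a11 at *
  clear id
  rw [abs_le]
  constructor <;> linarith

theorem K_bound : ∃ c, ∀ x, 11 ≤ x → |K x - Real.log x - c| ≤ 0.0114 + 8 * (Real.log x + 2) / x := by
  obtain ⟨C, hC⟩ := TT_asymp
  set q : ℝ → ℝ := fun t => t ^ 2 / 2 + t with hq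
  refine ⟨comb (fun d => q (Real.log d) / d) / A, ?_⟩
  intro x hx
  have hx0 : 0 < x := by linarith
  have hlx : 0 ≤ Real.log x := Real.log_nonneg (by linarith)
  have key : ∀ d : ℕ, 1 ≤ d → d ≤ 11 → |TT (x / d) / d - ((Real.log x - Real.log d)^2 / 2 - (Real.log x - Real.log d) + C) / d| ≤ (Real.log x + 2) / x := by
    intro d hd hd'
    have h0 : (1:ℝ) ≤ d := by exact_mod_cast hd
    have h1 : (d:ℝ) ≤ 11 := by exact_mod_cast hd'
    have h := hC (x / d) (by rw [le_div_iff₀ (by linarith)]; linarith)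
    have h2 := Real.log_nonneg h0
    rw [Real.log_div (by linarith) (by linarith)] at h
    rw [← sub_div, abs_div, abs_of_pos (by linarith : (0:ℝ) < d), div_le_iff₀ (by linarith)]
    rw [← sub_sub]
    refine h.trans ?_
    rw [div_div_eq_mul_div, div_mul_eq_mul_div]
    gcongr
    linarith
  obtain ⟨hA1, hA2⟩ := A_bounds
  have main : |comb (fun d => TT (x / d) / d) - A * Real.log x - comb (fun d => q (Real.log d) / d)| ≤ 1679 * ((Real.log x + 2) / x) :=
    comb_quad C _ _ _ key
  have hW : |comb (fun d => TT (x / d) / d) - A * K x| ≤ 2.3952 := by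
    rw [K_ident hx0, abs_div, abs_of_pos hx0, div_le_iff₀ hx0]
    have : |∑ n ∈ Ioc 0 ⌊x⌋₊, vonMangoldt n * W (x / n)| ≤ ∑ n ∈ Ioc 0 ⌊x⌋₊, vonMangoldt n * maj2 (x / n) := by
      refine (Finset.abs_sum_le_sum_abs _ _).trans (Finset.sum_le_sum ?_)
      intro n hn
      rw [mem_Ioc] at hn
      rw [abs_mul, abs_of_nonneg ArithmeticFunction.vonMangoldt_nonneg]
      apply mul_le_mul_of_nonneg_left _ ArithmeticFunction.vonMangoldt_nonneg
      apply maj2_bound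
      have hn0 : (0:ℝ) < n := by exact_mod_cast hn.1
      rw [le_div_iff₀ hn0, one_mul]
      exact (Nat.le_floor_iff' (by omega)).1 hn.2
    rw [maj2_sum] at this
    have k1 := psi_le (x := x) (by linarith)
    have k4 := psi_le (x := x / 4) (by positivity)
    have k7 := psi_le (x := x / 7) (by positivity)
    have k13 := psi_le (x := x / 13) (by positivity)
    have k2310 := psi_le (x := x / 2310) (by positivity)
    linarith
  have hfin : |A * (K x - Real.log x - comb (fun d => q (Real.log d) / d) / A)| ≤ 2.3952 + 1679 * ((Real.log x + 2) / x) := by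
    have e : A * (K x - Real.log x - comb (fun d => q (Real.log d) / d) / A) = A * K x - A * Real.log x - comb (fun d => q (Real.log d) / d) := by
      have : A ≠ 0 := by linarith
      field_simp
    rw [e]
    rw [abs_le] at *
    constructor <;> linarith
  rw [abs_mul, abs_of_pos (by linarith), mul_comm, ← le_div_iff₀ (by linarith)] at hfin
  refine hfin.trans ?_
  rw [mul_div_assoc]
  have he : 0 ≤ (Real.log x + 2) / x := by positivity
  rw [div_le_iff₀ (by linarith)]
  nlinarith

end MP
end

section
open ArithmeticFunction (vonMangoldt)

namespace MP

noncomputable def P (x : ℝ) : ℝ := ∑ n ∈ Ioc 0 ⌊x⌋₊, vonMangoldt n / (n * Real.log n)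

noncomputable def uu (z : ℝ) : ℝ := 1 / (z * Real.log z)
noncomputable def vv (z : ℝ) : ℝ := 1 / Real.log z + 1 / Real.log z ^ 2
noncomputable def ww (z : ℝ) : ℝ := 1 / (z * Real.log z ^ 2) + 2 / (z * Real.log z ^ 3)

theorem uu_anti : AntitoneOn uu (Set.Ioi 1) := by
  intro a ha b hb hab
  rw [Set.mem_Ioi] at ha hb
  have h1 : 0 < Real.log a := Real.log_pos ha
  have h2 : Real.log a ≤ Real.log b := Real.log_le_log (by linarith) hab
  apply one_div_le_one_div_of_le
  · apply mul_pos (by linarith) h1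
  · apply mul_le_mul hab h2 h1.le (by linarith)

theorem uu_deriv {z : ℝ} (hz : 1 < z) : HasDerivAt uu (- ((Real.log z + 1) / (z * Real.log z) ^ 2)) z := by
  have hz0 : z ≠ 0 := by linarith
  have h1 : 0 < Real.log z := Real.log_pos hz
  have hl := Real.hasDerivAt_log hz0
  have h := ((hasDerivAt_id z).mul hl).fun_inv (mul_ne_zero hz0 h1.ne')
  have e : uu = fun y => (((id : ℝ → ℝ) * Real.log) y)⁻¹ := by funext y; simp [uu, mul_comm]
  rw [e]
  refine h.congr_deriv ?_
  simp
  field_simp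
  ring

theorem vv_deriv {z : ℝ} (hz : 1 < z) : HasDerivAt vv (- ww z) z := by
  have hz0 : z ≠ 0 := by linarith
  have h1 : 0 < Real.log z := Real.log_pos hz
  have hl := Real.hasDerivAt_log hz0
  have h := (hl.fun_inv h1.ne').add ((hl.fun_pow 2).fun_inv (by positivity))
  have e : vv = ((fun y => (Real.log y)⁻¹) + fun y => (Real.log y ^ 2)⁻¹) := by funext y; simp [vv]
  rw [e]
  refine h.congr_deriv ?_
  simp [ww]
  field_simp
  ring

theorem P_Gu (x : ℝ) : Gu uu (fun m => vonMangoldt m) x = P x - Chebyshev.psi x / (x * Real.log x) := by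
  rw [Gu, P, Chebyshev.psi, Finset.sum_div, ← Finset.sum_sub_distrib]
  apply Finset.sum_congr rfl
  intros; rw [uu, uu]; ring

noncomputable def eb (x : ℝ) : ℝ := 0.0114 + 8 * (Real.log x + 2) / x

theorem eb_anti {x y : ℝ} (hx : 1 ≤ x) (hxy : x ≤ y) : eb y ≤ eb x := by
  have hx0 : 0 < x := by linarith
  have hy0 : 0 < y := by linarith
  have h := Real.log_le_sub_one_of_pos (show (0:ℝ) < y/x by positivity)
  rw [Real.log_div (by positivity) (by positivity)] at h
  have hl := Real.log_nonneg hx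
  rw [eb, eb]
  have : (Real.log y + 2) / y ≤ (Real.log x + 2) / x := by
    rw [div_le_div_iff₀ hy0 hx0]
    have h2 : x * (y / x - 1) = y - x := by field_simp
    have h3 := mul_le_mul_of_nonneg_left h hx0.le
    nlinarith
  rw [mul_div_assoc, mul_div_assoc]
  linarith

noncomputable def DD (c x : ℝ) : ℝ := Gu uu (fun m => vonMangoldt m) x - K x * vv x
  - Real.log (Real.log x) + 2 / Real.log x + c * vv x

theorem DD_deriv (c : ℝ) {x : ℝ} (hx : 1 < x) : HasDerivWithinAt (DD c) ((K x - Real.log x - c) * ww x) (Set.Ici x) x := by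
  have hx0 : 0 < x := by linarith
  have h1 : 0 < Real.log x := Real.log_pos hx
  have hl := Real.hasDerivAt_log hx0.ne'
  have d1 := Gu_deriv (a := fun m => vonMangoldt m) hx0.le (uu_deriv hx)
  have d2 := K_deriv hx0
  have d3 := (vv_deriv hx).hasDerivWithinAt (s := Set.Ici x)
  have d4 := (hl.log h1.ne').hasDerivWithinAt (s := Set.Ici x)
  have d5 := ((hl.fun_inv h1.ne').const_mul 2).hasDerivWithinAt (s := Set.Ici x)
  have h := (((d1.sub (d2.mul d3)).sub d4).add d5).add (d3.const_mul c)
  have e : DD c = (((Gu uu fun m ↦ vonMangoldt m) - K * vv - fun t ↦ log (log t)) + fun y ↦ 2 * (log y)⁻¹) + fun y ↦ c * vv y := by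
    funext y; simp [DD, div_eq_mul_inv]
  rw [e]
  refine h.congr_deriv ?_
  have e2 : ∑ m ∈ Ioc 0 ⌊x⌋₊, vonMangoldt m = Chebyshev.psi x := rfl
  rw [e2]
  simp only [ww, vv]
  field_simp
  ring

theorem DD_cont (c : ℝ) : ContinuousOn (DD c) (Set.Ioi 1) := by
  have h1 : ContinuousOn (Gu uu (fun m => vonMangoldt m)) (Set.Ioi 1) := by
    apply Gu_cont zero_le_one _ uu_anti
    · intro m hm hm'
      have : m ≤ 1 := by exact_mod_cast hm'
      have : m = 1 := by omega
      subst this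
      simp
    · intro x hx
      exact (uu_deriv hx).continuousAt.continuousWithinAt
  have h2 : ContinuousOn K (Set.Ioi 1) := K_cont.mono (fun x hx => lt_trans one_pos (Set.mem_Ioi.1 hx))
  have h3 : ContinuousOn vv (Set.Ioi 1) := fun x hx => (vv_deriv hx).continuousAt.continuousWithinAt
  have hl : ContinuousOn Real.log (Set.Ioi 1) := fun x hx => 
    (Real.continuousAt_log (by have := Set.mem_Ioi.1 hx; linarith)).continuousWithinAt
  have hne : ∀ x ∈ Set.Ioi (1:ℝ), Real.log x ≠ 0 := fun x hx => (Real.log_pos (Set.mem_Ioi.1 hx)).ne'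
  have h4 := hl.log hne
  have h5 : ContinuousOn (fun x => 2 / Real.log x) (Set.Ioi 1) := continuousOn_const.div hl hne
  exact (((h1.sub (h2.mul h3)).sub h4).add h5).add (continuousOn_const.mul h3)

theorem vv_tendsto : Filter.Tendsto vv Filter.atTop (nhds 0) := by
  have h1 : Filter.Tendsto (fun x => 1 / Real.log x) Filter.atTop (nhds 0) :=
    tendsto_const_nhds.div_atTop Real.tendsto_log_atTop
  have h2 := h1.add (h1.pow 2)
  simp only [ne_eq, OfNat.ofNat_ne_zero, not_false_eq_true, zero_pow, add_zero] at h2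
  refine h2.congr (fun x => ?_)
  rw [vv]; ring

theorem ww_nonneg {x : ℝ} (hx : 1 < x) : 0 ≤ ww x := by
  have := Real.log_pos hx
  have : 0 < x := by linarith
  rw [ww]; positivity

theorem P_asymp : ∃ Γ, ∀ x, 11 ≤ x →
    |P x - Real.log (Real.log x) - Γ - (Chebyshev.psi x / x - 1) / Real.log x| ≤ 2 * eb x * vv x := by
  obtain ⟨c, hc⟩ := K_bound
  have hconv : ∀ x, 11 ≤ x → ∀ y, x ≤ y → |DD c y - DD c x| ≤ eb x * vv x - eb x * vv y := by
    intro x hx y hy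
    refine conv_of_deriv (c := x) (D := DD c) (V := fun t => eb x * vv t) (D' := fun t => (K t - Real.log t - c) * ww t)
      (V' := fun t => eb x * ww t) ((DD_cont c).mono ?_) ?_ ?_ ?_ ?_ le_rfl hy
    · intro t ht; rw [Set.mem_Ici] at ht; rw [Set.mem_Ioi]; linarith
    · intro t ht; rw [Set.mem_Ici] at ht
      exact ((vv_deriv (by linarith)).const_mul _).continuousAt.continuousWithinAt
    · intro t ht; exact DD_deriv c (by linarith)
    · intro t ht; 
      have := ((vv_deriv (z := t) (by linarith)).const_mul (eb x)).hasDerivWithinAt (s := Set.Ici t)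
      refine this.congr_deriv (by ring)
    · intro t ht
      have hw := ww_nonneg (x := t) (by linarith)
      rw [abs_mul, abs_of_nonneg hw]
      apply mul_le_mul_of_nonneg_right _ hw
      exact (hc t (by linarith)).trans (eb_anti (by linarith) ht)
  have hVt : ∀ x, Filter.Tendsto (fun t => eb x * vv t) Filter.atTop (nhds 0) := by
    intro x; simpa using vv_tendsto.const_mul (eb x)
  obtain ⟨Γ, hΓ, _⟩ := limit_of_rate (D := DD c) (V := fun t => eb 11 * vv t) (c := 11) (hVt 11)
    (by
      intro x y hx hy
      refine conv_of_deriv (c := 11) (D := DD c) (V := fun t => eb 11 * vv t) (D' := fun t => (K t - Real.log t - c) * ww t)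
        (V' := fun t => eb 11 * ww t) ((DD_cont c).mono ?_) ?_ ?_ ?_ ?_ hx hy
      · intro t ht; rw [Set.mem_Ici] at ht; rw [Set.mem_Ioi]; linarith
      · intro t ht; rw [Set.mem_Ici] at ht
        exact ((vv_deriv (by linarith)).const_mul _).continuousAt.continuousWithinAt
      · intro t ht; exact DD_deriv c (by linarith)
      · intro t ht; 
        have := ((vv_deriv (z := t) (by linarith)).const_mul (eb 11)).hasDerivWithinAt (s := Set.Ici t)
        refine this.congr_deriv (by ring)
      · intro t ht
        have hw := ww_nonneg (x := t) (by linarith)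
        rw [abs_mul, abs_of_nonneg hw]
        apply mul_le_mul_of_nonneg_right _ hw
        exact (hc t (by linarith)).trans (eb_anti (by linarith) ht))
  refine ⟨Γ + 1, fun x hx => ?_⟩
  have h1 : |Γ - DD c x| ≤ eb x * vv x - 0 := by
    refine le_of_tendsto_of_tendsto (hΓ.sub_const _).abs ((hVt x).const_sub (eb x * vv x)) ?_
    filter_upwards [Filter.eventually_ge_atTop x] with y hy
    exact hconv x hx y hy
  have h2 := hc x hx
  have hl : 0 < Real.log x := Real.log_pos (by linarith)
  have hx0 : 0 < x := by linarith
  have hv : 0 ≤ vv x := by rw [vv]; positivity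
  have h3 : |(K x - Real.log x - c) * vv x| ≤ eb x * vv x := by
    rw [abs_mul, abs_of_nonneg hv]
    exact mul_le_mul_of_nonneg_right h2 hv
  have e : P x - Real.log (Real.log x) - (Γ + 1) - (Chebyshev.psi x / x - 1) / Real.log x
      = - (Γ - DD c x) + (K x - Real.log x - c) * vv x := by
    rw [DD, P_Gu, vv]
    field_simp
    ring
  rw [e]
  refine (abs_add_le _ _).trans ?_
  rw [abs_neg]
  linarith

end MP
end

section
open ArithmeticFunction (vonMangoldt)

namespace MP

theorem sum_pp (N : ℕ) (h : ℕ → ℝ) :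
    ∑ n ∈ Ioc 0 N, vonMangoldt n / Real.log n * h n
      = ∑ p ∈ (Ioc 0 N).filter Nat.Prime, ∑ k ∈ Ioc 0 (Nat.log p N), h (p ^ k) / k := by
  have h1 : ∑ n ∈ Ioc 0 N, vonMangoldt n / Real.log n * h n
      = ∑ n ∈ (Ioc 0 N).filter IsPrimePow, vonMangoldt n / Real.log n * h n := by
    symm
    apply Finset.sum_subset (Finset.filter_subset _ _)
    intro n hn hn'
    rw [mem_filter, not_and] at hn'
    rw [ArithmeticFunction.vonMangoldt_eq_zero_iff.2 (hn' hn)]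
    simp
  rw [h1, Finset.sum_sigma']
  symm
  apply Finset.sum_nbij (fun x : (_ : ℕ) × ℕ => x.1 ^ x.2)
  · rintro ⟨p, k⟩ hx
    simp only [mem_sigma, mem_filter, mem_Ioc] at hx ⊢
    obtain ⟨⟨⟨hp0, hpN⟩, hp⟩, hk0, hk⟩ := hx
    refine ⟨⟨pow_pos hp0 _, Nat.pow_le_of_le_log (by omega) hk⟩, ?_⟩
    exact hp.isPrimePow.pow (by omega)
  · rintro ⟨p, k⟩ hx ⟨q, l⟩ hy hxy
    simp only [coe_sigma, Set.mem_sigma_iff, mem_coe, mem_filter, mem_Ioc] at hx hy hxy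
    obtain ⟨⟨_, hp⟩, hk0, hk⟩ := hx
    obtain ⟨⟨_, hq⟩, hl0, hl⟩ := hy
    have hpq : p = q := by
      have : p ∣ q ^ l := by rw [← hxy]; exact dvd_pow_self p (by omega)
      exact (Nat.prime_dvd_prime_iff_eq hp hq).1 (hp.dvd_of_dvd_pow this)
    subst hpq
    have := Nat.pow_right_injective hp.two_le hxy
    subst this
    rfl
  · intro n hn
    simp only [coe_filter, mem_Ioc, Set.mem_ofPred_eq] at hn
    obtain ⟨⟨hn0, hnN⟩, hpp⟩ := hn
    rw [isPrimePow_nat_iff] at hpp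
    obtain ⟨p, k, hp, hk, rfl⟩ := hpp
    refine ⟨⟨p, k⟩, ?_, rfl⟩
    simp only [coe_sigma, Set.mem_sigma_iff, mem_coe, mem_filter, mem_Ioc]
    refine ⟨⟨⟨hp.pos, (Nat.le_self_pow (by omega) p).trans hnN⟩, hp⟩, hk, ?_⟩
    exact Nat.le_log_of_pow_le hp.one_lt hnN
  · rintro ⟨p, k⟩ hx
    simp only [mem_sigma, mem_filter, mem_Ioc] at hx ⊢
    obtain ⟨⟨⟨hp0, hpN⟩, hp⟩, hk0, hk⟩ := hx
    rw [ArithmeticFunction.vonMangoldt_apply_pow (by omega), ArithmeticFunction.vonMangoldt_apply_prime hp]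
    push_cast
    rw [Real.log_pow]
    have : 0 < Real.log p := Real.log_pos (by exact_mod_cast hp.one_lt)
    have : (0:ℝ) < k := by exact_mod_cast hk0
    field_simp

theorem P_pp (x : ℝ) : P x = ∑ p ∈ (Ioc 0 ⌊x⌋₊).filter Nat.Prime, ∑ k ∈ Ioc 0 (Nat.log p ⌊x⌋₊), 1 / ((p:ℝ) ^ k * k) := by
  have := sum_pp ⌊x⌋₊ (fun n => 1 / (n:ℝ))
  rw [P]
  convert this using 1
  · apply Finset.sum_congr rfl
    intros
    rw [div_mul_div_comm, mul_one, mul_comm (Real.log _)]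
  · push_cast
    simp only [div_div]

theorem log_series_le {t : ℝ} (h0 : 0 ≤ t) (h1 : t < 1) (m : ℕ) :
    ∑ k ∈ Ioc 0 m, t ^ k / k ≤ - Real.log (1 - t) := by
  have h := Real.hasSum_pow_div_log_of_abs_lt_one (x := t) (by rw [abs_of_nonneg h0]; exact h1)
  have := sum_le_hasSum (range m) (fun i _ => by positivity) h
  refine le_trans (le_of_eq ?_) this
  clear this h
  induction m with
  | zero => simp
  | succ m ih =>
    rw [Finset.sum_range_succ, ← ih, ← Finset.insert_Ioc_right_eq_Ioc_add_one (Nat.zero_le m),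
      Finset.sum_insert (by simp), add_comm]
    push_cast
    rfl

theorem zeta_bound {σ : ℝ} (hσ : 1 < σ) (N : ℕ) :
    ∑ n ∈ Ioc 0 N, vonMangoldt n / Real.log n * (n:ℝ) ^ (-σ) ≤ Real.log (∑' n : ℕ, 1 / (n:ℝ) ^ σ) := by
  rw [sum_pp N (fun n => (n:ℝ) ^ (-σ))]
  let f : ℕ →* ℝ := 
    { toFun := fun n => (n:ℝ) ^ (-σ)
      map_one' := by simp
      map_mul' := by
        intro a b
        push_cast
        exact Real.mul_rpow (by positivity) (by positivity) }
  have hf : ∀ n, f n = (n:ℝ) ^ (-σ) := fun n => rfl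
  have hsum : Summable f := by
    have := Real.summable_nat_rpow (p := -σ) |>.2 (by linarith)
    exact this
  have hprod := EulerProduct.prod_primesBelow_geometric_eq_tsum_smoothNumbers hsum (N+1)
  have hle : ∑' m : (N+1).smoothNumbers, f m ≤ ∑' n : ℕ, f n := by
    exact hsum.tsum_subtype_le f _ (fun n => by rw [hf]; positivity)
  have hset : (N+1).primesBelow = (Ioc 0 N).filter Nat.Prime := by
    ext p
    simp only [Nat.mem_primesBelow, mem_filter, mem_Ioc]
    constructor
    · rintro ⟨h1, h2⟩; exact ⟨⟨h2.pos, by omega⟩, h2⟩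
    · rintro ⟨⟨_, h1⟩, h2⟩; exact ⟨by omega, h2⟩
  have hfp : ∀ p : ℕ, p.Prime → 0 < f p ∧ f p < 1 := by
    intro p hp
    have : (0:ℝ) < p := by exact_mod_cast hp.pos
    refine ⟨by rw [hf]; positivity, ?_⟩
    rw [hf]
    exact Real.rpow_lt_one_of_one_lt_of_neg (by exact_mod_cast hp.one_lt) (by linarith)
  rw [hset] at hprod
  have e : ∑' n : ℕ, 1 / (n:ℝ) ^ σ = ∑' n, f n := by
    apply tsum_congr
    intro n
    rw [hf, Real.rpow_neg (by positivity), one_div]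
  rw [e]
  have hpos : 0 < ∏ p ∈ (Ioc 0 N).filter Nat.Prime, (1 - f p)⁻¹ := by
    apply Finset.prod_pos
    intro p hp
    rw [mem_filter] at hp
    have := (hfp p hp.2).2
    apply inv_pos.2; linarith
  refine le_trans ?_ (Real.log_le_log hpos (hprod.trans_le hle))
  rw [Real.log_prod (by
    intro p hp
    rw [mem_filter] at hp
    have := (hfp p hp.2).2
    apply inv_ne_zero; linarith)]
  apply Finset.sum_le_sum
  intro p hp
  rw [mem_filter] at hp
  rw [Real.log_inv]
  refine le_trans (le_of_eq ?_) (log_series_le (hfp p hp.2).1.le (hfp p hp.2).2 (Nat.log p N))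
  apply Finset.sum_congr rfl
  intro k _
  rw [← hf, map_pow]

end MP
end

section
open ArithmeticFunction (vonMangoldt)

namespace MP

theorem P_tendsto {Γ : ℝ} (h : ∀ x, 11 ≤ x → |P x - Real.log (Real.log x) - Γ - (Chebyshev.psi x/x - 1)/Real.log x| ≤ 2*eb x*vv x) :
    Filter.Tendsto (fun x => P x - Real.log (Real.log x)) Filter.atTop (nhds Γ) := by
  have hl : Filter.Tendsto (fun x : ℝ => 1 / Real.log x) Filter.atTop (nhds 0) := by
    simp only [one_div]
    exact Real.tendsto_log_atTop.inv_tendsto_atTop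
  have hb : Filter.Tendsto (fun x : ℝ => 2 * eb 11 * vv x + 3 * (1 / Real.log x)) Filter.atTop (nhds 0) := by
    simpa using (vv_tendsto.const_mul (2 * eb 11)).add (hl.const_mul 3)
  rw [tendsto_iff_dist_tendsto_zero]
  refine squeeze_zero' (Filter.Eventually.of_forall fun _ => dist_nonneg) ?_ hb
  filter_upwards [Filter.eventually_ge_atTop (11:ℝ)] with x hx
  have hlog : 0 < Real.log x := Real.log_pos (by linarith)
  have h1 := h x hx
  have h2 : eb x ≤ eb 11 := eb_anti (by norm_num) hx
  have hv : 0 ≤ vv x := by rw [vv]; positivity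
  have h3 : |Chebyshev.psi x/x - 1| ≤ 3 := by
    have hx0 : 0 < x := by linarith
    have a := psi_le hx0.le
    have b : 0 ≤ Chebyshev.psi x := Chebyshev.psi_nonneg x
    have : Chebyshev.psi x / x ≤ 1.12 := by rw [div_le_iff₀ hx0]; exact a
    have : 0 ≤ Chebyshev.psi x / x := by positivity
    rw [abs_le]; constructor <;> linarith
  have h4 : |(Chebyshev.psi x/x - 1)/Real.log x| ≤ 3 * (1 / Real.log x) := by
    rw [abs_div, abs_of_pos hlog, mul_one_div]
    gcongr
  rw [Real.dist_eq]
  have h5 : 2 * eb x * vv x ≤ 2 * eb 11 * vv x := by gcongr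
  have := abs_add_le (P x - Real.log (Real.log x) - Γ - (Chebyshev.psi x/x - 1)/Real.log x) ((Chebyshev.psi x/x - 1)/Real.log x)
  rw [sub_add_cancel] at this
  linarith

noncomputable def Q (m : ℕ) : ℝ := P (Real.exp m)
noncomputable def qf (n : ℕ) : ℝ := (Q (n+1) - Q n) - 1 / ((n:ℝ) + 1)

theorem qf_sum (n : ℕ) : ∑ i ∈ range n, qf i = Q n - Q 0 - Hr n := by
  induction n with
  | zero => simp [Hr]
  | succ n ih => 
    rw [Finset.sum_range_succ, ih, qf, Hr_succ]; ring

theorem Q_zero : Q 0 = 0 := by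
  simp [Q, P]

theorem qf_tendsto {Γ : ℝ} (h : ∀ x, 11 ≤ x → |P x - Real.log (Real.log x) - Γ - (Chebyshev.psi x/x - 1)/Real.log x| ≤ 2*eb x*vv x) :
    Filter.Tendsto (fun n => ∑ i ∈ range n, qf i) Filter.atTop (nhds (Γ - Real.eulerMascheroniConstant)) := by
  have h1 := (P_tendsto h).comp (Real.tendsto_exp_atTop.comp (tendsto_natCast_atTop_atTop (R := ℝ)))
  have h2 := Real.tendsto_harmonic_sub_log
  refine (h1.sub h2).congr ?_
  intro n
  simp only [Function.comp, Real.log_exp]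
  rw [qf_sum, Q_zero, Hr_harmonic, Q]
  ring

theorem Q_block (σ : ℝ) (hσ : 1 < σ) (M : ℕ) :
    ∑ m ∈ range M, (Q (m+1) - Q m) * Real.exp (-(σ - 1)) ^ (m+1) 
      ≤ ∑ n ∈ Ioc 0 ⌊Real.exp M⌋₊, vonMangoldt n / Real.log n * (n:ℝ) ^ (-σ) := by
  induction M with
  | zero => simp
  | succ M ih =>
    rw [Finset.sum_range_succ]
    have hle : ⌊Real.exp (M:ℝ)⌋₊ ≤ ⌊Real.exp ((M+1:ℕ):ℝ)⌋₊ := by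
      apply Nat.floor_le_floor
      apply Real.exp_le_exp.2
      push_cast; linarith
    rw [← Finset.sum_Ioc_consecutive _ (Nat.zero_le _) hle]
    refine add_le_add ih ?_
    have e : Q (M+1) - Q M = ∑ n ∈ Ioc ⌊Real.exp (M:ℝ)⌋₊ ⌊Real.exp ((M+1:ℕ):ℝ)⌋₊, vonMangoldt n / (n * Real.log n) := by
      rw [Q, Q, P, P, ← Finset.sum_Ioc_consecutive _ (Nat.zero_le _) hle]
      ring
    rw [e, Finset.sum_mul]
    apply Finset.sum_le_sum
    intro n hn
    rw [mem_Ioc] at hn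
    have hn0 : 0 < n := by omega
    have hn0' : (0:ℝ) < n := by exact_mod_cast hn0
    have hnle : (n:ℝ) ≤ Real.exp ((M+1:ℕ):ℝ) := (Nat.le_floor_iff (Real.exp_pos _).le).1 hn.2
    have hΛ : 0 ≤ vonMangoldt n := ArithmeticFunction.vonMangoldt_nonneg
    have hlog : 0 ≤ Real.log n := Real.log_nonneg (by exact_mod_cast hn0)
    have e2 : (n:ℝ) ^ (-σ) = 1 / n * (n:ℝ) ^ (-(σ-1)) := by
      rw [show -σ = -1 + -(σ-1) by ring, Real.rpow_add hn0', Real.rpow_neg_one, one_div]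
    have e3 : Real.exp (-(σ - 1)) ^ (M+1) ≤ (n:ℝ) ^ (-(σ-1)) := by
      rw [← Real.exp_nat_mul, Real.rpow_def_of_pos hn0']
      apply Real.exp_le_exp.2
      have : Real.log n ≤ ((M+1:ℕ):ℝ) := by
        rw [Real.log_le_iff_le_exp hn0']; exact hnle
      nlinarith
    rw [e2]
    calc vonMangoldt n / (n * Real.log n) * Real.exp (-(σ - 1)) ^ (M+1) ≤ vonMangoldt n / (n * Real.log n) * (n:ℝ) ^ (-(σ-1)) := by gcongr
      _ = _ := by rw [div_mul_eq_div_div_swap]; ring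

theorem abel_bound {Γ : ℝ} (h : Filter.Tendsto (fun n => ∑ i ∈ range n, qf i) Filter.atTop (nhds Γ))
    {σ : ℝ} (hσ : 1 < σ) : 
    Real.exp (-(σ-1)) * ∑' n, qf n * Real.exp (-(σ-1)) ^ n ≤ Real.log ((σ - 1) * ∑' n : ℕ, 1 / (n:ℝ) ^ σ) := by
  set z := Real.exp (-(σ-1)) with hz
  have hz0 : 0 < z := Real.exp_pos _
  have hz1 : z < 1 := by rw [hz, Real.exp_lt_one_iff]; linarith
  have habs : |z| < 1 := by rw [abs_of_pos hz0]; exact hz1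
  set Z := ∑' n : ℕ, 1 / (n:ℝ) ^ σ with hZ
  have hZ1 : 0 < Z := by
    have hs := Real.summable_one_div_nat_rpow.2 hσ
    exact hs.tsum_pos (fun i => by positivity) 1 (by simp)
  have hlogser := Real.hasSum_pow_div_log_of_abs_lt_one habs
  -- qf bounded, so summable
  have hq0 : Filter.Tendsto qf Filter.atTop (nhds 0) := by
    have h' := (h.comp (Filter.tendsto_add_atTop_nat 1)).sub h
    rw [sub_self] at h'
    refine h'.congr ?_
    intro n
    simp only [Function.comp]
    rw [Finset.sum_range_succ]; ring
  obtain ⟨C, hC⟩ := hq0.norm.bddAbove_range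
  have hqs : Summable (fun n => qf n * z ^ n) := by
    refine Summable.of_norm_bounded (g := fun n => C * z ^ n) ((summable_geometric_of_lt_one hz0.le hz1).mul_left C) ?_
    intro n
    rw [norm_mul, norm_pow, Real.norm_of_nonneg hz0.le]
    have : ‖qf n‖ ≤ C := hC ⟨n, rfl⟩
    gcongr
  have hqs' : HasSum (fun n => z * (qf n * z ^ n)) (z * ∑' n, qf n * z ^ n) := hqs.hasSum.mul_left z
  have htot := hqs'.add hlogser
  have hbd : z * (∑' n, qf n * z ^ n) + -Real.log (1 - z) ≤ Real.log Z := by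
    refine le_of_tendsto' htot.tendsto_sum_nat ?_
    intro M
    refine le_trans (le_of_eq ?_) ((Q_block σ hσ M).trans (zeta_bound hσ _))
    apply Finset.sum_congr rfl
    intro n _
    rw [← hz, qf]
    field_simp
    ring
  have h1 : 1 - z ≤ σ - 1 := by
    have := Real.add_one_le_exp (-(σ-1))
    rw [← hz] at this; linarith
  have h2 : Real.log (1 - z) ≤ Real.log (σ - 1) := Real.log_le_log (by linarith) h1
  rw [Real.log_mul (by linarith) hZ1.ne']
  linarith

theorem gamma_le {Γ : ℝ} (h : ∀ x, 11 ≤ x → |P x - Real.log (Real.log x) - Γ - (Chebyshev.psi x/x - 1)/Real.log x| ≤ 2*eb x*vv x) :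
    Γ ≤ Real.eulerMascheroniConstant := by
  have h1 := qf_tendsto h
  have h2 := Real.tendsto_tsum_powerSeries_nhdsWithin_lt h1
  have hz : Filter.Tendsto (fun σ : ℝ => Real.exp (-(σ-1))) (nhdsWithin 1 (Set.Ioi 1)) (nhdsWithin 1 (Set.Iio 1)) := by
    apply tendsto_nhdsWithin_of_tendsto_nhds_of_eventually_within
    · have : ContinuousAt (fun σ : ℝ => Real.exp (-(σ-1))) 1 := by fun_prop
      have := this.tendsto
      simp only [sub_self, neg_zero, Real.exp_zero] at this
      exact this.mono_left nhdsWithin_le_nhds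
    · filter_upwards [self_mem_nhdsWithin] with (σ : ℝ) (hσ : 1 < σ)
      rw [Set.mem_Iio, Real.exp_lt_one_iff]; linarith
  have h3 := h2.comp hz
  have h4 := (hz.mono_right nhdsWithin_le_nhds).mul h3
  have h5 := (tendsto_sub_mul_tsum_nat_rpow).log one_ne_zero
  rw [Real.log_one] at h5
  rw [one_mul] at h4
  have := le_of_tendsto_of_tendsto h4 h5 ?_
  · linarith
  · filter_upwards [self_mem_nhdsWithin] with (σ : ℝ) (hσ : 1 < σ)
    exact abel_bound h1 hσ

end MP
end

section
open ArithmeticFunction (vonMangoldt)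

namespace MP

theorem range_Ioc (t : ℝ) (m : ℕ) : ∑ k ∈ Ioc 0 m, t ^ k / k = ∑ i ∈ range m, t ^ (i+1) / ((i:ℝ)+1) := by
  induction m with
  | zero => simp
  | succ m ih =>
    rw [Finset.sum_range_succ, ← ih, ← Finset.insert_Ioc_right_eq_Ioc_add_one (Nat.zero_le m),
      Finset.sum_insert (by simp), add_comm]
    push_cast
    rfl

theorem log_tail {t : ℝ} (h0 : 0 ≤ t) (h1 : t < 1) (m : ℕ) :
    - Real.log (1 - t) ≤ ∑ k ∈ Ioc 0 m, t ^ k / k + t ^ (m+1) / (((m:ℝ)+1) * (1 - t)) := by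
  have h := Real.hasSum_pow_div_log_of_abs_lt_one (x := t) (by rw [abs_of_nonneg h0]; exact h1)
  have ht := h.tendsto_sum_nat.comp (Filter.tendsto_add_atTop_nat m)
  have h2 : 0 < 1 - t := by linarith
  refine le_of_tendsto' ht ?_
  intro j
  simp only [Function.comp]
  have key : ∑ i ∈ range (j + m), t ^ (i+1) / ((i:ℝ)+1) ≤ ∑ k ∈ Ioc 0 m, t ^ k / k
      + (t ^ (m+1) - t ^ (m+1+j)) / (((m:ℝ)+1) * (1 - t)) := by
    induction j with
    | zero => simp [range_Ioc]
    | succ j ih =>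
      rw [show j + 1 + m = (j + m) + 1 by ring, Finset.sum_range_succ]
      have : t ^ (j+m+1) / (((j+m:ℕ):ℝ)+1) ≤ t ^ (j+m+1) / ((m:ℝ)+1) := by
        apply div_le_div_of_nonneg_left (by positivity) (by positivity)
        push_cast
        have : (0:ℝ) ≤ j := by positivity
        linarith
      have e : (t ^ (m+1) - t ^ (m+1+(j+1))) / (((m:ℝ)+1) * (1 - t)) = 
        (t ^ (m+1) - t ^ (m+1+j)) / (((m:ℝ)+1) * (1 - t)) + t ^ (j+m+1) / ((m:ℝ)+1) := by
        field_simp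
        ring
      rw [e]
      linarith
  refine key.trans ?_
  gcongr
  have : 0 ≤ t ^ (m+1+j) := by positivity
  linarith

theorem telesc (s N : ℕ) (hN : s ≤ N) :
    ∑ n ∈ Ioc s N, (1/2) * (1 / ((n:ℝ) - 1) - 1 / n) = (1/2) * (1 / (s:ℝ) - 1 / N) := by
  induction N, hN using Nat.le_induction with
  | base => simp
  | succ N hN ih =>
    rw [← Finset.insert_Ioc_right_eq_Ioc_add_one hN, Finset.sum_insert (by simp), ih]
    push_cast
    ring

theorem mertens_log {x : ℝ} (hx : 11 ≤ x) :
    ∑ p ∈ (Ioc 0 ⌊x⌋₊).filter Nat.Prime, - Real.log (1 - 1 / (p:ℝ)) ≤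
      P x + 1 / (2 * (√x - 1)) + 2.24 / (√x * Real.log x) := by
  set N := ⌊x⌋₊ with hN
  set s := Nat.sqrt N with hs
  have hx0 : 0 < x := by linarith
  have hNx : (N:ℝ) ≤ x := Nat.floor_le hx0.le
  have hxN : x < N + 1 := Nat.lt_floor_add_one x
  have hN11 : 11 ≤ N := Nat.le_floor (by exact_mod_cast hx)
  have hlog : 0 < Real.log x := Real.log_pos (by linarith)
  have hs1 : s * s ≤ N := Nat.sqrt_le N
  have hs2 : N < (s+1) * (s+1) := Nat.lt_succ_sqrt N
  have hs3 : 3 ≤ s := by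
    by_contra hc
    have : s + 1 ≤ 3 := by omega
    have := Nat.mul_le_mul this this
    omega
  have hsx : (s:ℝ) ≤ √x := by
    apply Real.le_sqrt_of_sq_le
    have : ((s * s : ℕ):ℝ) ≤ N := by exact_mod_cast hs1
    push_cast at this
    nlinarith
  have hxs : √x ≤ s + 1 := by
    rw [Real.sqrt_le_left (by positivity)]
    have : ((N + 1 : ℕ):ℝ) ≤ (((s+1) * (s+1) : ℕ):ℝ) := by exact_mod_cast hs2
    push_cast at this
    nlinarith
  have hsq : 0 < √x := Real.sqrt_pos.2 hx0
  have hsqx : √x * √x = x := Real.mul_self_sqrt hx0.le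
  have h3x : 3 < √x := by
    apply Real.lt_sqrt_of_sq_lt; linarith
  have hsN : s ≤ N := Nat.sqrt_le_self N
  rw [P_pp]
  have step : ∀ p ∈ (Ioc 0 N).filter Nat.Prime, - Real.log (1 - 1 / (p:ℝ)) ≤
      ∑ k ∈ Ioc 0 (Nat.log p N), 1 / ((p:ℝ) ^ k * k) + 
        if p ≤ s then 2 * Real.log p / (x * Real.log x) else (1/2) * (1 / ((p:ℝ) - 1) - 1 / p) := by
    intro p hp
    rw [mem_filter, mem_Ioc] at hp
    obtain ⟨⟨_, hpN⟩, hp⟩ := hp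
    have hp2 : (2:ℝ) ≤ p := by exact_mod_cast hp.two_le
    have hp0 : (0:ℝ) < p := by linarith
    have ht : 1 / (p:ℝ) ≤ 1/2 := by
      apply one_div_le_one_div_of_le <;> linarith
    have := log_tail (t := 1 / (p:ℝ)) (by positivity) (by linarith) (Nat.log p N)
    refine this.trans ?_
    have e : ∑ k ∈ Ioc 0 (Nat.log p N), (1 / (p:ℝ)) ^ k / k = ∑ k ∈ Ioc 0 (Nat.log p N), 1 / ((p:ℝ) ^ k * k) := by
      apply Finset.sum_congr rfl
      intros
      rw [one_div_pow, div_div]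
    rw [e]
    gcongr
    have hlt : N + 1 ≤ p ^ (Nat.log p N + 1) := Nat.lt_pow_succ_log_self hp.one_lt N
    set m := Nat.log p N with hm
    have hlt' : x ≤ (p:ℝ) ^ (m+1) := by
      have : ((N+1:ℕ):ℝ) ≤ ((p ^ (m+1) : ℕ):ℝ) := by exact_mod_cast hlt
      push_cast at this
      linarith
    split_ifs with hps
    · have hlp : Real.log x ≤ (m+1) * Real.log p := by
        have := Real.log_le_log hx0 hlt'
        rw [Real.log_pow] at this
        push_cast at this
        exact this
      rw [one_div_pow, div_le_div_iff₀ (by apply mul_pos (by positivity); linarith) (by positivity)]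
      have h1 : 1 / (p:ℝ) ^ (m+1) ≤ 1 / x := one_div_le_one_div_of_le hx0 hlt'
      have h2 : 1 / (p:ℝ) ^ (m+1) * (x * Real.log x) ≤ 1 / x * (x * Real.log x) := by gcongr
      have h3 : 1 / x * (x * Real.log x) = Real.log x := by field_simp
      have hlp0 : 0 ≤ Real.log p := Real.log_nonneg (by linarith)
      have h4 : ((m:ℝ)+1) * Real.log p * 1 ≤ ((m:ℝ)+1) * Real.log p * (2 * (1 - 1/p)) := by
        gcongr; linarith
      nlinarith
    · have hm1 : m = 1 := by
        rw [hm, Nat.log_eq_iff (by left; norm_num)]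
        refine ⟨by simpa using hpN, ?_⟩
        have : s + 1 ≤ p := by omega
        have := Nat.mul_le_mul this this
        rw [show 1 + 1 = 2 by rfl, pow_two]; omega
      rw [hm1]
      apply le_of_eq
      have : (p:ℝ) - 1 ≠ 0 := by linarith
      push_cast
      field_simp
      ring
  refine (Finset.sum_le_sum step).trans ?_
  rw [Finset.sum_add_distrib, add_assoc]
  apply add_le_add le_rfl
  have hfilt : (Ioc 0 N).filter Nat.Prime = (Ioc 0 s).filter Nat.Prime ∪ (Ioc s N).filter Nat.Prime := by
    rw [← Finset.filter_union, Finset.Ioc_union_Ioc_eq_Ioc (Nat.zero_le _) hsN]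
  have hdisj : Disjoint ((Ioc 0 s).filter Nat.Prime) ((Ioc s N).filter Nat.Prime) := by
    apply Finset.disjoint_filter_filter
    rw [Finset.disjoint_left]
    intro a ha hb
    rw [mem_Ioc] at ha hb; omega
  rw [hfilt, Finset.sum_union hdisj, add_comm]
  apply add_le_add
  · have : ∑ p ∈ (Ioc s N).filter Nat.Prime, (if p ≤ s then 2 * Real.log p / (x * Real.log x) else (1/2) * (1 / ((p:ℝ) - 1) - 1 / p)) ≤ ∑ n ∈ Ioc s N, (1/2) * (1 / ((n:ℝ) - 1) - 1 / n) := by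
      rw [Finset.sum_filter]
      apply Finset.sum_le_sum
      intro n hn
      rw [mem_Ioc] at hn
      have : (1:ℝ) < n := by
        have : 1 < n := by omega
        exact_mod_cast this
      have h0 : 0 ≤ (1/2) * (1 / ((n:ℝ) - 1) - 1 / n) := by
        have : 1 / (n:ℝ) ≤ 1 / ((n:ℝ) - 1) := one_div_le_one_div_of_le (by linarith) (by linarith)
        linarith
      rw [if_neg (show ¬ n ≤ s by omega)]
      split_ifs
      · exact le_rfl
      · exact h0
    refine this.trans ?_
    rw [telesc s N hsN]
    have h1 : 1 / (s:ℝ) ≤ 1 / (√x - 1) := one_div_le_one_div_of_le (by linarith) (by linarith)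
    have h2 : (0:ℝ) ≤ 1 / N := by positivity
    rw [show 1 / (2 * (√x - 1)) = 1/2 * (1 / (√x - 1)) by rw [one_div_mul_one_div]]
    linarith
  · have : ∑ p ∈ (Ioc 0 s).filter Nat.Prime, (if p ≤ s then 2 * Real.log p / (x * Real.log x) else (1/2) * (1 / ((p:ℝ) - 1) - 1 / p)) = 2 / (x * Real.log x) * Chebyshev.theta s := by
      rw [Chebyshev.theta, Nat.floor_natCast, Finset.mul_sum]
      apply Finset.sum_congr rfl
      intro p hp
      rw [mem_filter, mem_Ioc] at hp
      rw [if_pos hp.1.2]; ring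
    rw [this]
    have h1 : Chebyshev.theta s ≤ 1.12 * √x := by
      have a := Chebyshev.theta_le_psi (s:ℝ)
      have b := psi_le (show (0:ℝ) ≤ s by positivity)
      linarith
    calc 2 / (x * Real.log x) * Chebyshev.theta s ≤ 2 / (x * Real.log x) * (1.12 * √x) := by gcongr
      _ = 2 / ((√x * √x) * Real.log x) * (1.12 * √x) := by rw [hsqx]
      _ = 2.24 / (√x * Real.log x) := by field_simp; norm_num

end MP
end

section
open ArithmeticFunction (vonMangoldt)
namespace MP

noncomputable def Rk (k : ℕ) : ℝ := ∏ i ∈ range k, ((Nat.nth Nat.Prime i : ℝ) / ((Nat.nth Nat.Prime i : ℝ) - 1))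

theorem pnth (i : ℕ) : (Nat.nth Nat.Prime i).Prime := Nat.prime_nth_prime i

theorem Nk_succ (k : ℕ) : Nk (k+1) = Nk k * Nat.nth Nat.Prime k := by
  rw [Nk, Finset.prod_range_succ]; rfl

theorem Nk_pos (k : ℕ) : 0 < Nk k := Finset.prod_pos fun i _ => (pnth i).pos

theorem Nk_coprime (k j : ℕ) (h : k ≤ j) : Nat.Coprime (Nk k) (Nat.nth Nat.Prime j) := by
  rw [Nk]
  apply Nat.Coprime.prod_left
  intro i hi
  rw [mem_range] at hi
  rw [Nat.coprime_primes (pnth i) (pnth j)]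
  intro he
  have := Nat.nth_injective Nat.infinite_setOfPred_prime he
  omega

theorem Rk_eq (k : ℕ) : (Nk k : ℝ) / (Nat.totient (Nk k) : ℝ) = Rk k := by
  induction k with
  | zero => simp [Nk, Rk]
  | succ k ih =>
    rw [Nk_succ, Nat.totient_mul (Nk_coprime k k le_rfl), Nat.totient_prime (pnth k), Rk, Finset.prod_range_succ]
    rw [Rk] at ih
    rw [← ih]
    have := (pnth k).one_lt
    rw [Nat.cast_mul, Nat.cast_mul, Nat.cast_sub this.le, Nat.cast_one, mul_div_mul_comm]

theorem M_eq (k : ℕ) : M k = Real.exp (Real.exp (-Real.eulerMascheroniConstant) * Rk k) - Real.log (Nk k) := by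
  rw [M, mul_div_assoc, Rk_eq]

theorem Nk_mono {a b : ℕ} (h : a ≤ b) : Real.log (Nk a) ≤ Real.log (Nk b) := by
  apply Real.log_le_log (by exact_mod_cast Nk_pos a)
  have : Nk a ∣ Nk b := Finset.prod_dvd_prod_of_subset _ _ _ (by intro i; simp only [mem_range]; omega)
  exact_mod_cast Nat.le_of_dvd (Nk_pos b) this

theorem filter_nth (k : ℕ) : (Ioc 0 (Nat.nth Nat.Prime k)).filter Nat.Prime = (range (k+1)).image (Nat.nth Nat.Prime) := by
  ext p
  simp only [mem_filter, mem_Ioc, mem_image, mem_range]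
  constructor
  · rintro ⟨⟨_, h1⟩, h2⟩
    refine ⟨Nat.count Nat.Prime p, ?_, Nat.nth_count h2⟩
    have := Nat.nth_count h2
    rw [← this] at h1
    have := (Nat.nth_le_nth Nat.infinite_setOfPred_prime).1 h1
    omega
  · rintro ⟨i, hi, rfl⟩
    exact ⟨⟨(pnth i).pos, (Nat.nth_le_nth Nat.infinite_setOfPred_prime).2 (by omega)⟩, pnth i⟩

theorem sum_nth (k : ℕ) (f : ℕ → ℝ) : 
    ∑ p ∈ (Ioc 0 (Nat.nth Nat.Prime k)).filter Nat.Prime, f p = ∑ i ∈ range (k+1), f (Nat.nth Nat.Prime i) := by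
  rw [filter_nth, Finset.sum_image]
  intro a _ b _ h
  exact Nat.nth_injective Nat.infinite_setOfPred_prime h

theorem log_Nk (k : ℕ) : Real.log (Nk k) = ∑ i ∈ range k, Real.log (Nat.nth Nat.Prime i) := by
  rw [Nk]
  push_cast
  rw [Real.log_prod]
  intro i _
  have := (pnth i).pos
  positivity

theorem theta_nth (k : ℕ) : Chebyshev.theta (Nat.nth Nat.Prime k) = Real.log (Nk (k+1)) := by
  rw [Chebyshev.theta, Nat.floor_natCast, sum_nth k (fun p => Real.log p), log_Nk]

theorem Rk_exp (k : ℕ) : Rk (k+1) = Real.exp (∑ p ∈ (Ioc 0 ⌊(Nat.nth Nat.Prime k:ℝ)⌋₊).filter Nat.Prime, - Real.log (1 - 1 / (p:ℝ))) := by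
  rw [Nat.floor_natCast, sum_nth k (fun p => - Real.log (1 - 1 / (p:ℝ))), Real.exp_sum, Rk]
  apply Finset.prod_congr rfl
  intro i _
  have h : (1:ℝ) < Nat.nth Nat.Prime i := by exact_mod_cast (pnth i).one_lt
  have h1 : 0 < 1 - 1 / (Nat.nth Nat.Prime i : ℝ) := by
    rw [sub_pos, div_lt_one (by linarith)]; exact h
  rw [Real.exp_neg, Real.exp_log h1]
  have : (Nat.nth Nat.Prime i : ℝ) - 1 ≠ 0 := by linarith
  field_simp

theorem exp_quad {u : ℝ} (hu : |u| ≤ 1) : Real.exp u ≤ 1 + u + 0.75 * u ^ 2 := by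
  have := Real.exp_bound hu (n := 2) (by norm_num)
  simp [Finset.sum_range_succ, Nat.factorial] at this
  have := (abs_le.1 this).2
  nlinarith

set_option maxHeartbeats 1000000 in
/-- main analytic bound -/
theorem M_upper {k : ℕ} {x η β : ℝ} (hxk : x = Nat.nth Nat.Prime k) (hx : 11 ≤ x) (hη : 0 ≤ η)
    (hpsi : |Chebyshev.psi x - x| ≤ η * x)
    (hβ : 2 * eb x * (1 + 1 / Real.log x) + Real.log x / (2 * (√x - 1)) + 2.24 / √x ≤ β)
    (hηβ : η + β ≤ 1/2) :
    M (k+1) ≤ x * (β + 0.75 * (η + β) ^ 2 / Real.log x + 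
       0.75 * (η + β + 0.75 * (η + β) ^ 2 / Real.log x) ^ 2) + 
       (Chebyshev.psi x - Chebyshev.theta x) := by
  obtain ⟨Γ, hΓ⟩ := P_asymp
  have hγ := gamma_le hΓ
  have h1 := (abs_le.1 (hΓ x hx)).2
  have h2 := mertens_log hx
  have hx0 : 0 < x := by linarith
  have hlog1 : 1 < Real.log x := by
    rw [Real.lt_log_iff_exp_lt hx0]
    have := Real.exp_one_lt_d9
    linarith
  have hlog : 0 < Real.log x := by linarith
  rw [M_eq, ← theta_nth, ← hxk]
  set a := Chebyshev.psi x / x - 1 with ha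
  set L := Real.log x with hL
  have hsq : 3 < √x := by apply Real.lt_sqrt_of_sq_lt; linarith
  have haη : |a| ≤ η := by
    rw [show a = (Chebyshev.psi x - x) / x by rw [ha]; field_simp, abs_div, abs_of_pos hx0, div_le_iff₀ hx0]
    exact hpsi
  have hβ0 : 0 ≤ β := by
    refine le_trans ?_ hβ
    have : 0 ≤ eb x := by rw [eb]; positivity
    have : 0 < √x - 1 := by linarith
    positivity
  obtain ⟨ha1, ha2⟩ := abs_le.1 haη
  have hS : ∑ p ∈ (Ioc 0 ⌊x⌋₊).filter Nat.Prime, - Real.log (1 - 1 / (p:ℝ)) ≤ Real.log L + Real.eulerMascheroniConstant + (a + β) / L := by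
    have e : 2 * eb x * vv x + 1 / (2 * (√x - 1)) + 2.24 / (√x * L) ≤ β / L := by
      rw [le_div_iff₀ hlog]
      refine le_trans (le_of_eq ?_) hβ
      rw [vv, ← hL]
      have : √x - 1 ≠ 0 := by linarith
      field_simp
    rw [add_div]
    linarith
  have hR : Real.exp (-Real.eulerMascheroniConstant) * Rk (k+1) ≤ L * Real.exp ((a + β) / L) := by
    rw [Rk_exp, ← hxk, ← Real.exp_add]
    calc _ ≤ Real.exp (Real.log L + (a + β) / L) := by
            apply Real.exp_le_exp.2; linarith
      _ = _ := by rw [Real.exp_add, Real.exp_log hlog]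
  have hab : |a + β| ≤ η + β := by
    rw [abs_le]; constructor <;> linarith
  have hab2 : (a + β) ^ 2 ≤ (η + β) ^ 2 := sq_le_sq' (by linarith [(abs_le.1 hab).1]) (by linarith)
  have hδ : |(a + β) / L| ≤ 1 := by
    rw [abs_div, abs_of_pos hlog, div_le_one hlog]; linarith
  have hq := exp_quad hδ
  set E := 0.75 * (η + β) ^ 2 / L with hE
  have hE0 : 0 ≤ E := by positivity
  have hE1 : E ≤ 0.1875 := by
    rw [hE, div_le_iff₀ hlog]
    have : (η + β) ^ 2 ≤ (1/2) ^ 2 := by gcongr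
    nlinarith
  have hLe : L * Real.exp ((a + β) / L) ≤ L + (a + β + E) := by
    calc _ ≤ L * (1 + (a + β) / L + 0.75 * ((a + β) / L) ^ 2) := by gcongr
      _ = L + (a + β) + 0.75 * (a + β) ^ 2 / L := by field_simp
      _ ≤ L + (a + β) + E := by rw [hE]; gcongr
      _ = _ := by ring
  have hu : |a + β + E| ≤ 1 := by
    rw [abs_le]; constructor <;> linarith
  have hq2 := exp_quad hu
  have hu2 : (a + β + E) ^ 2 ≤ (η + β + E) ^ 2 := sq_le_sq' (by linarith) (by linarith)
  have hfin : Real.exp (Real.exp (-Real.eulerMascheroniConstant) * Rk (k+1)) ≤ x * (1 + (a + β + E) + 0.75 * (η + β + E) ^ 2) := by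
    calc _ ≤ Real.exp (L + (a + β + E)) := Real.exp_le_exp.2 (hR.trans hLe)
      _ = x * Real.exp (a + β + E) := by rw [Real.exp_add, hL, Real.exp_log hx0]
      _ ≤ _ := by gcongr; linarith
  have hpsi' : Chebyshev.psi x = x * (1 + a) := by rw [ha]; field_simp; ring
  have hexp : x * (1 + (a + β + E) + 0.75 * (η + β + E) ^ 2) = x * (β + E + 0.75 * (η + β + E) ^ 2) + x * (1 + a) := by ring
  rw [hpsi']
  linarith

end MP
end

section
open ArithmeticFunction (vonMangoldt)
namespace MP

theorem int_log_sq_le {a b : ℝ} (hab : a ≤ b) (ha : 1 < a) :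
    ∫ x in a..b, 1 / Real.log x ^ 2 ≤ (b - a) / Real.log a ^ 2 := by
  have h0 := Real.log_pos ha
  calc _ ≤ ∫ x in a..b, 1 / Real.log a ^ 2 := by
        refine intervalIntegral.integral_mono_on hab ?_ (by simp) ?_
        · exact Chebyshev.intervalIntegrable_one_div_log_sq ha (by linarith)
        · intro x hx
          have := Real.log_le_log (by linarith) hx.1
          gcongr
    _ = _ := by rw [intervalIntegral.integral_const, smul_eq_mul, mul_one_div]

theorem log_256 : 16/3 ≤ Real.log 256 := by
  rw [show (256:ℝ) = 2 ^ 8 by norm_num, Real.log_pow]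
  have := Real.log_two_gt_d9
  push_cast; linarith

theorem int_big {y : ℝ} (hy : 256 ≤ y) : ∫ t in (256:ℝ)..y, 1 / Real.log t ^ 2 ≤ 1.6 * y / Real.log y ^ 2 := by
  have hpos : ∀ t : ℝ, 256 ≤ t → 16/3 ≤ Real.log t := fun t ht => log_256.trans (Real.log_le_log (by norm_num) ht)
  have hd : ∀ t : ℝ, 256 ≤ t → HasDerivAt (fun z => 1.6 * z / Real.log z ^ 2) (1.6 / Real.log t ^ 2 - 3.2 / Real.log t ^ 3) t := by
    intro t ht
    have hl := hpos t ht
    have h0 : Real.log t ≠ 0 := by linarith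
    have ht0 : t ≠ 0 := by linarith
    have := ((hasDerivAt_id t).const_mul 1.6).fun_div ((Real.hasDerivAt_log ht0).fun_pow 2) (pow_ne_zero 2 h0)
    refine this.congr_deriv ?_
    simp
    field_simp
    ring
  have key := intervalIntegral.integral_le_sub_of_hasDeriv_right_of_le (a := 256) (b := y) (g := fun z => 1.6 * z / Real.log z ^ 2)
    (g' := fun t => 1.6 / Real.log t ^ 2 - 3.2 / Real.log t ^ 3) (φ := fun t => 1 / Real.log t ^ 2) hy
    (fun t ht => (hd t ht.1).continuousAt.continuousWithinAt)
    (fun t ht => (hd t ht.1.le).hasDerivWithinAt) 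
    (by
      rw [← intervalIntegrable_iff_integrableOn_Icc_of_le hy]
      exact Chebyshev.intervalIntegrable_one_div_log_sq (by norm_num) (by linarith))
    (by
      intro t ht
      have hl := hpos t ht.1.le
      have h0 : 0 < Real.log t := by linarith
      have : 3.2 / Real.log t ^ 3 ≤ 0.6 / Real.log t ^ 2 := by
        rw [div_le_div_iff₀ (by positivity) (by positivity)]
        have : 0 ≤ Real.log t ^ 2 := by positivity
        nlinarith
      have e : 1.6 / Real.log t ^ 2 = 1 / Real.log t ^ 2 + 0.6 / Real.log t ^ 2 := by
        rw [← add_div]; norm_num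
      show 1 / Real.log t ^ 2 ≤ 1.6 / Real.log t ^ 2 - 3.2 / Real.log t ^ 3
      linarith)
  refine key.trans ?_
  have : 0 ≤ 1.6 * 256 / Real.log 256 ^ 2 := by positivity
  linarith

theorem int_all {y : ℝ} (hy : 256 ≤ y) : ∫ t in (2:ℝ)..y, 1 / Real.log t ^ 2 ≤ 1.6 * y / Real.log y ^ 2 + 61 := by
  have i1 := Chebyshev.intervalIntegrable_one_div_log_sq (a := 2) (b := 16) (by norm_num) (by norm_num)
  have i2 := Chebyshev.intervalIntegrable_one_div_log_sq (a := 16) (b := 256) (by norm_num) (by norm_num)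
  have i3 := Chebyshev.intervalIntegrable_one_div_log_sq (a := 256) (b := y) (by norm_num) (by linarith)
  rw [← intervalIntegral.integral_add_adjacent_intervals (i1.trans i2) i3,
    ← intervalIntegral.integral_add_adjacent_intervals i1 i2]
  have h1 := int_log_sq_le (a := 2) (b := 16) (by norm_num) (by norm_num)
  have h2 := int_log_sq_le (a := 16) (b := 256) (by norm_num) (by norm_num)
  have h3 := int_big hy
  have l2 := Real.log_two_gt_d9
  have l16 : Real.log 16 = 4 * Real.log 2 := by
    rw [show (16:ℝ) = 2 ^ 4 by norm_num, Real.log_pow]; norm_num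
  have a1 : (16 - 2) / Real.log 2 ^ 2 ≤ 29.5 := by
    rw [div_le_iff₀ (by positivity)]
    nlinarith
  have a2 : (256 - 16) / Real.log 16 ^ 2 ≤ 31.5 := by
    rw [l16, div_le_iff₀ (by positivity)]
    nlinarith
  linarith

theorem theta_le {x : ℝ} (hx : 0 ≤ x) : Chebyshev.theta x ≤ 1.12 * x :=
  (Chebyshev.theta_le_psi x).trans (psi_le hx)

theorem pi_le {y : ℝ} (hy : 256 ≤ y) : (Nat.primeCounting ⌊y⌋₊ : ℝ) ≤ 1.12 * (y / Real.log y + 1.6 * y / Real.log y ^ 2 + 61) := by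
  rw [Chebyshev.primeCounting_eq_theta_div_log_add_integral (by linarith)]
  have hl : 0 < Real.log y := Real.log_pos (by linarith)
  have h1 : Chebyshev.theta y / Real.log y ≤ 1.12 * (y / Real.log y) := by
    rw [← mul_div_assoc]
    gcongr
    exact theta_le (by linarith)
  have h2 : ∫ t in (2:ℝ)..y, Chebyshev.theta t / (t * Real.log t ^ 2) ≤ ∫ t in (2:ℝ)..y, 1.12 * (1 / Real.log t ^ 2) := by
    refine intervalIntegral.integral_mono_on (by linarith) ?_ ?_ ?_
    · rw [intervalIntegrable_iff_integrableOn_Icc_of_le (by linarith)]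
      exact Chebyshev.integrableOn_theta_div_id_mul_log_sq y
    · exact (Chebyshev.intervalIntegrable_one_div_log_sq (by norm_num) (by linarith)).const_mul _
    · intro t ht
      have ht0 : 0 < t := by linarith [ht.1]
      have : 0 < Real.log t := Real.log_pos (by linarith [ht.1])
      have := theta_le ht0.le
      rw [mul_one_div, div_le_div_iff₀ (by positivity) (by positivity)]
      nlinarith [sq_nonneg (Real.log t)]
  rw [intervalIntegral.integral_const_mul] at h2
  have := int_all hy
  linarith

theorem psi_theta {x : ℝ} (hx : 1 ≤ x) : Chebyshev.psi x - Chebyshev.theta x ≤ 3.36 * √x := by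
  have h := Chebyshev.psi_sub_theta_le_psi_add_psi_add_psi x
  have h0 : (0:ℝ) ≤ x := by linarith
  have a := psi_le (show 0 ≤ x ^ (2:ℝ)⁻¹ by positivity)
  have b := psi_le (show 0 ≤ x ^ (3:ℝ)⁻¹ by positivity)
  have c := psi_le (show 0 ≤ x ^ (5:ℝ)⁻¹ by positivity)
  have b' : x ^ (3:ℝ)⁻¹ ≤ x ^ (2:ℝ)⁻¹ := Real.rpow_le_rpow_of_exponent_le hx (by norm_num)
  have c' : x ^ (5:ℝ)⁻¹ ≤ x ^ (2:ℝ)⁻¹ := Real.rpow_le_rpow_of_exponent_le hx (by norm_num)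
  have e : √x = x ^ (2:ℝ)⁻¹ := by rw [Real.sqrt_eq_rpow, one_div]
  rw [e]; linarith

theorem log_near {x s lam d : ℝ} (hs : 1 ≤ s) (hd : 0 ≤ d) (hsx : s ≤ √x) (hx : 0 < x) (hlam : Real.log x ≤ lam * √x) (hlam0 : 0 ≤ lam) :
    8 * (Real.log x + d) ≤ 8 * (lam + d / s) / s * x := by
  have hsq : √x * √x = x := Real.mul_self_sqrt hx.le
  have h1 : 0 < √x := Real.sqrt_pos.2 hx
  have h2 : lam * √x ≤ lam / s * x := by
    rw [div_mul_eq_mul_div, le_div_iff₀ (by linarith)]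
    nlinarith [mul_nonneg hlam0 h1.le]
  have h3 : d ≤ d / s / s * x := by
    rw [div_mul_eq_mul_div, div_mul_eq_mul_div, le_div_iff₀ (by linarith), le_div_iff₀ (by linarith)]
    have : s * s ≤ x := by nlinarith
    nlinarith
  have e : 8 * (lam + d / s) / s * x = 8 * (lam / s * x + d / s / s * x) := by ring
  rw [e]; linarith

theorem sqrt_near {x s : ℝ} (hs : 1 ≤ s) (hsx : s ≤ √x) (hx : 0 < x) : 3.36 * √x ≤ 3.36 / s * x := by
  have hsq : √x * √x = x := Real.mul_self_sqrt hx.le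
  have h1 : 0 < √x := Real.sqrt_pos.2 hx
  rw [div_mul_eq_mul_div, le_div_iff₀ (by linarith)]
  nlinarith

theorem theta_ge' {x s lam : ℝ} (hs : 1 ≤ s) (hsx : s ≤ √x) (hx : 11 ≤ x) (hlam : Real.log x ≤ lam * √x) (hlam0 : 0 ≤ lam) :
    (1 - (0.0932 + 8 * (lam + 1 / s) / s + 3.36 / s)) * x ≤ Chebyshev.theta x := by
  have h1 := log_near hs zero_le_one hsx (by linarith) hlam hlam0
  have h2 := sqrt_near hs hsx (by linarith)
  have h3 := psi_theta (show 1 ≤ x by linarith)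
  have h4 := (abs_le.1 (psi_asymp hx)).1
  nlinarith

theorem theta_eq_Nk (y : ℝ) : Chebyshev.theta y = Real.log (Nk (Nat.primeCounting ⌊y⌋₊)) := by
  rw [Chebyshev.theta, Nk, Nat.cast_prod, Real.log_prod (by
    intro i _
    have := (pnth i).pos
    positivity)]
  symm
  have hinj := Nat.nth_injective Nat.infinite_setOfPred_prime
  rw [← Finset.sum_image (f := fun p : ℕ => Real.log p) (g := Nat.nth Nat.Prime) (fun a _ b _ h => hinj h)]
  apply Finset.sum_congr _ (fun _ _ => rfl)
  ext p
  simp only [mem_filter, mem_Ioc, mem_image, mem_range]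
  rw [Nat.primeCounting, Nat.primeCounting']
  constructor
  · rintro ⟨i, hi, rfl⟩
    have := Nat.nth_lt_of_lt_count hi
    exact ⟨⟨(pnth i).pos, by omega⟩, pnth i⟩
  · rintro ⟨⟨_, h1⟩, h2⟩
    exact ⟨Nat.count Nat.Prime p, Nat.count_strict_mono h2 (by omega), Nat.nth_count h2⟩

theorem pi_diff {x y : ℝ} (hy : 1 ≤ y) (hyx : y ≤ x) : Chebyshev.theta x - Chebyshev.theta y ≤ ((Nat.primeCounting ⌊x⌋₊ : ℝ) - Nat.primeCounting ⌊y⌋₊) * Real.log x := by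
  have hmono : ⌊y⌋₊ ≤ ⌊x⌋₊ := Nat.floor_le_floor hyx
  have hpi : Nat.primeCounting ⌊y⌋₊ ≤ Nat.primeCounting ⌊x⌋₊ := Nat.monotone_primeCounting hmono
  rw [theta_eq_Nk, theta_eq_Nk, log_Nk, log_Nk, ← Finset.sum_Ico_eq_sub _ hpi, ← Nat.cast_sub hpi, ← nsmul_eq_mul, ← Nat.card_Ico]
  apply Finset.sum_le_card_nsmul
  intro i hi
  rw [mem_Ico] at hi
  have := Nat.nth_lt_of_lt_count (show i < Nat.count Nat.Prime (⌊x⌋₊ + 1) from hi.2)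
  apply Real.log_le_log (by exact_mod_cast (pnth i).pos)
  have h2 : Nat.nth Nat.Prime i ≤ ⌊x⌋₊ := by omega
  exact (Nat.le_floor_iff (by linarith)).1 h2

set_option maxHeartbeats 2000000 in
theorem big {k c : ℕ} {x α s lam L0 sy lamy r ly η β τ : ℝ}
    (hxk : x = Nat.nth Nat.Prime k) (hx : 11 ≤ x) (hα : 0 < α) (hα1 : α ≤ 1) (hc : 1 ≤ c)
    (hs : 2 ≤ s) (hsx : s ≤ √x) (hlam0 : 0 ≤ lam) (hlam : Real.log x ≤ lam * √x) (hL00 : 0 < L0) (hL0 : L0 ≤ Real.log x)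
    (hy : 256 ≤ α * x) (hsy : 2 ≤ sy) (hsyx : sy ≤ √(α * x)) (hlamy0 : 0 ≤ lamy) (hlamy : Real.log (α * x) ≤ lamy * √(α * x))
    (hr : Real.log x ≤ r * Real.log (α * x)) (hly0 : 0 < ly) (hly : ly ≤ Real.log (α * x))
    (hη : 0.0932 + 8 * (lam + 1 / s) / s ≤ η)
    (hβ : 2 * (0.0114 + 8 * (lam + 2 / s) / s) * (1 + 1 / L0) + lam / 2 * (1 + 1 / (s - 1)) + 2.24 / s ≤ β)
    (hηβ : η + β ≤ 1/2)
    (hτ : 0.0932 + 8 * (lamy + 1 / sy) / sy + 3.36 / sy ≤ τ)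
    (h4 : β + 0.75 * (η + β) ^ 2 / L0 + 0.75 * (η + β + 0.75 * (η + β) ^ 2 / L0) ^ 2 + 3.36 / s ≤ α * (1 - τ))
    (h5 : ((c:ℝ) - 1) * (1.12 * (α * r * (1 + 1.6 / ly) + 61 * (lam / s))) ≤ 1 - η - 3.36 / s - 1.12 * α) :
    M (k+1) ≤ Real.log (Nk ((k+1)/c)) := by
  have hx0 : 0 < x := by linarith
  set y := α * x with hydef
  have hyx : y ≤ x := by rw [hydef]; nlinarith
  set L := Real.log x with hL
  have hLpos : 0 < L := by linarith
  have hsqpos : 0 < √x := by linarith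
  have hsq : √x * √x = x := Real.mul_self_sqrt hx0.le
  have n1 := log_near (by linarith) zero_le_one hsx hx0 hlam hlam0
  have n2 := log_near (d := 2) (by linarith) (by norm_num) hsx hx0 hlam hlam0
  have n3 := sqrt_near (by linarith) hsx hx0
  have hpsi : |Chebyshev.psi x - x| ≤ η * x := by
    refine (psi_asymp hx).trans ?_
    have := mul_le_mul_of_nonneg_right hη hx0.le
    rw [← hL]
    linarith
  have hη0 : 0 ≤ η := by
    refine le_trans ?_ hη
    positivity
  have heb : eb x ≤ 0.0114 + 8 * (lam + 2 / s) / s := by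
    rw [eb]
    have : 8 * (Real.log x + 2) / x ≤ 8 * (lam + 2 / s) / s := by
      rw [div_le_iff₀ hx0]
      exact n2
    linarith
  have hLs : L / (2 * (√x - 1)) ≤ lam / 2 * (1 + 1 / (s - 1)) := by
    have hs1 : 0 < s - 1 := by linarith
    have hx1 : 0 < √x - 1 := by linarith
    have h1 : 1 / (√x - 1) ≤ 1 / (s - 1) := one_div_le_one_div_of_le hs1 (by linarith)
    calc L / (2 * (√x - 1)) ≤ lam * √x / (2 * (√x - 1)) := by gcongr
      _ = lam / 2 * (1 + 1 / (√x - 1)) := by field_simp; ring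
      _ ≤ _ := by gcongr
  have hβ' : 2 * eb x * (1 + 1 / Real.log x) + Real.log x / (2 * (√x - 1)) + 2.24 / √x ≤ β := by
    refine le_trans ?_ hβ
    rw [← hL]
    have : 2.24 / √x ≤ 2.24 / s := by gcongr
    have : 2 * eb x * (1 + 1 / L) ≤ 2 * (0.0114 + 8 * (lam + 2 / s) / s) * (1 + 1 / L0) := by
      gcongr
    linarith
  have hβ0 : 0 ≤ β := by
    refine le_trans ?_ hβ
    have hs1 : 0 < s - 1 := by linarith
    positivity
  have hM := M_upper hxk hx hη0 hpsi hβ' hηβ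
  rw [← hL] at hM
  have hM2 : M (k+1) ≤ x * (α * (1 - τ)) := by
    have hE : 0.75 * (η + β) ^ 2 / L ≤ 0.75 * (η + β) ^ 2 / L0 := by gcongr
    have hE0 : 0 ≤ 0.75 * (η + β) ^ 2 / L := by positivity
    have hE2 : 0.75 * (η + β + 0.75 * (η + β) ^ 2 / L) ^ 2 ≤ 0.75 * (η + β + 0.75 * (η + β) ^ 2 / L0) ^ 2 := by
      gcongr
    have h6 := psi_theta (show 1 ≤ x by linarith)
    have h7 : x * (β + 0.75 * (η + β) ^ 2 / L + 0.75 * (η + β + 0.75 * (η + β) ^ 2 / L) ^ 2) + 3.36 / s * x ≤ x * (α * (1 - τ)) := by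
      rw [mul_comm (3.36 / s) x, ← mul_add]
      apply mul_le_mul_of_nonneg_left _ hx0.le
      linarith
    linarith
  have hθy : x * (α * (1 - τ)) ≤ Chebyshev.theta y := by
    have := theta_ge' (by linarith) hsyx (by linarith) hlamy hlamy0
    have h8 : (1 - τ) * y ≤ (1 - (0.0932 + 8 * (lamy + 1 / sy) / sy + 3.36 / sy)) * y := by
      apply mul_le_mul_of_nonneg_right _ (by linarith)
      linarith
    have : x * (α * (1 - τ)) = (1 - τ) * y := by rw [hydef]; ring
    linarith
  refine (hM2.trans hθy).trans ?_
  rw [theta_eq_Nk]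
  apply Nk_mono
  rw [Nat.le_div_iff_mul_le (by omega)]
  -- counting
  have hcount : Nat.primeCounting ⌊x⌋₊ = k + 1 := by
    rw [hxk, Nat.floor_natCast, Nat.primeCounting, Nat.primeCounting', Nat.count_succ, if_pos (pnth k),
      Nat.count_nth_of_infinite Nat.infinite_setOfPred_prime]
  have hd := pi_diff (show 1 ≤ y by linarith) hyx
  rw [hcount, ← hL] at hd
  have hpi := pi_le hy
  set pc := (Nat.primeCounting ⌊y⌋₊ : ℝ) with hpc
  have hθx := theta_ge' (by linarith) hsx hx hlam hlam0
  have hθy2 := theta_le (show 0 ≤ y by linarith)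
  set ℓ := Real.log y with hℓ
  have hℓ0 : 0 < ℓ := by linarith
  have hpiL : pc * L ≤ x * (1.12 * (α * r * (1 + 1.6 / ly) + 61 * (lam / s))) := by
    have g1 : pc * L ≤ 1.12 * (y / ℓ + 1.6 * y / ℓ ^ 2 + 61) * L := by gcongr
    have g2 : 1.12 * (y / ℓ + 1.6 * y / ℓ ^ 2 + 61) * L = 1.12 * (y * (L / ℓ) * (1 + 1.6 / ℓ) + 61 * L) := by
      field_simp
    have g3 : L / ℓ ≤ r := by rw [div_le_iff₀ hℓ0]; exact hr
    have hr0 : 0 ≤ r := le_trans (by positivity) g3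
    have g4 : 1.6 / ℓ ≤ 1.6 / ly := by gcongr
    have hy0 : 0 ≤ y := by linarith
    have g5 : y * (L / ℓ) * (1 + 1.6 / ℓ) ≤ y * r * (1 + 1.6 / ly) := by gcongr
    have g6 : L ≤ lam / s * x := by
      rw [div_mul_eq_mul_div, le_div_iff₀ (by linarith)]
      calc L * s ≤ lam * √x * √x := by gcongr
        _ = _ := by rw [mul_assoc, hsq]
    have e : x * (1.12 * (α * r * (1 + 1.6 / ly) + 61 * (lam / s))) = 1.12 * (y * r * (1 + 1.6 / ly) + 61 * (lam / s * x)) := by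
      rw [hydef]; ring
    rw [e]
    linarith
  have hc1 : (0:ℝ) ≤ (c:ℝ) - 1 := by
    have : (1:ℝ) ≤ c := by exact_mod_cast hc
    linarith
  have hfin : ((c:ℝ) - 1) * (pc * L) ≤ (((k+1:ℕ):ℝ) - pc) * L := by
    have h9 : ((c:ℝ) - 1) * (pc * L) ≤ ((c:ℝ) - 1) * (x * (1.12 * (α * r * (1 + 1.6 / ly) + 61 * (lam / s)))) := by gcongr
    have h10 := mul_le_mul_of_nonneg_left h5 hx0.le
    have h11 : (1 - η - 3.36 / s) * x ≤ (1 - (0.0932 + 8 * (lam + 1 / s) / s + 3.36 / s)) * x := by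
      apply mul_le_mul_of_nonneg_right _ hx0.le
      linarith
    have e1 : ((c:ℝ) - 1) * (x * (1.12 * (α * r * (1 + 1.6 / ly) + 61 * (lam / s)))) = x * (((c:ℝ) - 1) * (1.12 * (α * r * (1 + 1.6 / ly) + 61 * (lam / s)))) := by ring
    have e2 : x * (1 - η - 3.36 / s - 1.12 * α) = (1 - η - 3.36 / s) * x - 1.12 * y := by rw [hydef]; ring
    linarith
  have : (pc * c) * L ≤ ((k+1:ℕ):ℝ) * L := by nlinarith
  have := le_of_mul_le_mul_right this hLpos
  rw [hpc] at this
  exact_mod_cast this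

end MP
end

section
namespace MP

theorem log_le_two {a : ℝ} (ha : 0 < a) {n m : ℕ} (hn : 0 < n) (h : a ^ n ≤ 2 ^ m) : Real.log a ≤ m / n * Real.log 2 := by
  have := Real.log_le_log (by positivity) h
  rw [Real.log_pow, Real.log_pow] at this
  have : (0:ℝ) < n := by exact_mod_cast hn
  rw [div_mul_eq_mul_div, le_div_iff₀ this]; linarith

theorem le_log_two {a : ℝ} {n m : ℕ} (hn : 0 < n) (h : 2 ^ m ≤ a ^ n) : m / n * Real.log 2 ≤ Real.log a := by
  have := Real.log_le_log (by positivity) h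
  rw [Real.log_pow, Real.log_pow] at this
  have : (0:ℝ) < n := by exact_mod_cast hn
  rw [div_mul_eq_mul_div, div_le_iff₀ this]; linarith

theorem log_sqrt_le {X x lam : ℝ} (hX : 9 ≤ X) (hx : X ≤ x) (h : Real.log X ≤ lam * √X) : Real.log x ≤ lam * √x := by
  have he : Real.exp 2 ≤ 9 := by
    have := Real.exp_one_lt_d9
    rw [show (2:ℝ) = 1 + 1 by norm_num, Real.exp_add]
    nlinarith [Real.exp_pos 1]
  have := Real.log_div_sqrt_antitoneOn (a := X) (b := x) (show Real.exp 2 ≤ X by linarith) (show Real.exp 2 ≤ x by linarith) hx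
  simp only at this
  have h1 : 0 < √X := Real.sqrt_pos.2 (by linarith)
  have h2 : 0 < √x := Real.sqrt_pos.2 (by linarith)
  have h3 : Real.log X / √X ≤ lam := by rw [div_le_iff₀ h1]; exact h
  have := this.trans h3
  rwa [div_le_iff₀ h2] at this

set_option exponentiation.threshold 2000 in
theorem big3 {k : ℕ} (hk : 20000 ≤ Nat.nth Nat.Prime k) : M (k+1) ≤ Real.log (Nk ((k+1)/3)) := by
  obtain ⟨x, hxk⟩ : ∃ x : ℝ, x = Nat.nth Nat.Prime k := ⟨_, rfl⟩
  have hx : 20000 ≤ x := by rw [hxk]; exact_mod_cast hk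
  have l1 := Real.log_two_gt_d9
  have l2 := Real.log_two_lt_d9
  have s1 : (141.42:ℝ) ≤ √20000 := by apply Real.le_sqrt_of_sq_le; norm_num
  have s2 : √(3600:ℝ) = 60 := by rw [show (3600:ℝ) = 60 ^ 2 by norm_num]; exact Real.sqrt_sq (by norm_num)
  have a1 := log_le_two (a := 20000) (n := 20) (m := 286) (by norm_num) (by norm_num) (by norm_num)
  have a2 := le_log_two (a := 20000) (n := 4) (m := 57) (by norm_num) (by norm_num)
  have a4 := log_le_two (a := 50/9) (n := 25) (m := 62) (by norm_num) (by norm_num) (by norm_num)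
  push_cast at a1 a2 a4
  have a5 : Real.log 0.18 = - Real.log (50/9) := by rw [← Real.log_inv]; norm_num
  have hL : Real.log 20000 ≤ Real.log x := Real.log_le_log (by norm_num) hx
  have hly : Real.log (0.18 * x) = Real.log 0.18 + Real.log x := Real.log_mul (by norm_num) (by linarith)
  have a3' : Real.log 3600 ≤ 8.215 := by
    have := log_le_two (a := 3600) (n := 13) (m := 154) (by norm_num) (by norm_num) (by norm_num)
    push_cast at this
    linarith
  refine big (α := 0.18) (s := 141) (lam := 0.0702) (L0 := 9.85) (sy := 60) (lamy := 0.137) (r := 1.2125) (ly := 8.13)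
    (η := 0.0977) (β := 0.0884) (τ := 0.17) hxk (by linarith) (by norm_num) (by norm_num) (by norm_num) (by norm_num) ?_ (by norm_num)
    ?_ (by norm_num) ?_ (by linarith) (by norm_num) ?_ (by norm_num) ?_ ?_ (by norm_num) ?_ (by norm_num) (by norm_num) (by norm_num) (by norm_num) (by norm_num) (by norm_num)
  · exact (by linarith : (141:ℝ) ≤ √20000).trans (Real.sqrt_le_sqrt hx)
  · apply log_sqrt_le (by norm_num) hx; linarith
  · linarith
  · rw [← s2]; apply Real.sqrt_le_sqrt; linarith
  · apply log_sqrt_le (X := 3600) (by norm_num) (by linarith); rw [s2]; linarith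
  · rw [hly]; linarith
  · rw [hly]; linarith

set_option exponentiation.threshold 2000 in
theorem big14 {k : ℕ} (hk : 969672728 ≤ Nat.nth Nat.Prime k) : M (k+1) ≤ Real.log (Nk ((k+1)/14)) := by
  obtain ⟨x, hxk⟩ : ∃ x : ℝ, x = Nat.nth Nat.Prime k := ⟨_, rfl⟩
  have hx : 969672728 ≤ x := by rw [hxk]; exact_mod_cast hk
  have l1 := Real.log_two_gt_d9
  have l2 := Real.log_two_lt_d9
  have s1 : (31139:ℝ) ≤ √969672728 := by apply Real.le_sqrt_of_sq_le; norm_num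
  have s2 : (6381:ℝ) ≤ √40726254 := by apply Real.le_sqrt_of_sq_le; norm_num
  have a1 := log_le_two (a := 969672728) (n := 10) (m := 299) (by norm_num) (by norm_num) (by norm_num)
  have a2 := le_log_two (a := 969672728) (n := 5) (m := 149) (by norm_num) (by norm_num)
  have a3 := log_le_two (a := 40726254) (n := 10) (m := 254) (by norm_num) (by norm_num) (by norm_num)
  have a4 := log_le_two (a := 500/21) (n := 100) (m := 459) (by norm_num) (by norm_num) (by norm_num)
  push_cast at a1 a2 a3 a4
  have a5 : Real.log 0.042 = - Real.log (500/21) := by rw [← Real.log_inv]; norm_num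
  have hL : Real.log 969672728 ≤ Real.log x := Real.log_le_log (by norm_num) hx
  have hly : Real.log (0.042 * x) = Real.log 0.042 + Real.log x := Real.log_mul (by norm_num) (by linarith)
  refine big (α := 0.042) (s := 31139) (lam := 0.000666) (L0 := 20.65) (sy := 6381) (lamy := 0.00276) (r := 1.1824) (ly := 17.45)
    (η := 0.0933) (β := 0.0247) (τ := 0.094) hxk (by linarith) (by norm_num) (by norm_num) (by norm_num) (by norm_num) ?_ (by norm_num)
    ?_ (by norm_num) ?_ (by linarith) (by norm_num) ?_ (by norm_num) ?_ ?_ (by norm_num) ?_ (by norm_num) (by norm_num) (by norm_num) (by norm_num) (by norm_num) (by norm_num)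
  · exact s1.trans (Real.sqrt_le_sqrt hx)
  · apply log_sqrt_le (by norm_num) hx; linarith
  · linarith
  · exact s2.trans (Real.sqrt_le_sqrt (by linarith))
  · apply log_sqrt_le (X := 40726254) (by norm_num) (by linarith); linarith
  · rw [hly]; linarith
  · rw [hly]; linarith

theorem part_c (k : ℕ) (hk : 969672728 ≤ k) : M k ≤ Real.log (Nk (k / 14)) := by
  obtain ⟨j, rfl⟩ : ∃ j, k = j + 1 := ⟨k - 1, by omega⟩
  apply big14
  have := Nat.add_two_le_nth_prime j
  omega

end MP
end

section
namespace MP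

/-- the literal value of `142!` -/
def F142 : ℕ := 269536413788816277658850750803729026709400851689139611079208959973446471469886705721287973193419489734024361060974102771686730776482217285444779897586125484868294790044340222989800738079091821598557128192667156480000000000000000000000000000000000

theorem F142_eq : F142 = Nat.factorial 142 := by decide +kernel

def ptest (n : ℕ) : Bool :=
  if n < 143 then Nat.ble 2 n && Nat.beq (Nat.gcd n (Nat.factorial (n - 1))) 1 else Nat.beq (Nat.gcd n F142) 1

theorem prime_iff_gcd {n B : ℕ} (hn : 2 ≤ n) (h1 : n < (B+1) * (B+1)) (h2 : B < n) : n.Prime ↔ Nat.gcd n (Nat.factorial B) = 1 := by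
  constructor
  · intro hp
    have := (Nat.coprime_primes hp hp)
    rw [← Nat.Coprime, Nat.Prime.coprime_iff_not_dvd hp, hp.dvd_factorial]
    omega
  · intro hg
    by_contra hp
    have h3 : n.minFac ^ 2 ≤ n := Nat.minFac_sq_le_self (by omega) hp
    have h4 : n.minFac ≤ B := by
      by_contra hc
      have : B + 1 ≤ n.minFac := by omega
      have := Nat.mul_le_mul this this
      rw [pow_two] at h3
      omega
    have h5 : n.minFac ∣ Nat.gcd n (Nat.factorial B) := Nat.dvd_gcd (Nat.minFac_dvd n) (Nat.dvd_factorial (Nat.minFac_pos n) h4)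
    rw [hg, Nat.dvd_one] at h5
    have := Nat.minFac_eq_one_iff.1 h5
    omega

theorem ptest_iff {n : ℕ} (hn : n < 20449) : ptest n = true ↔ n.Prime := by
  rw [ptest]
  split_ifs with h
  · rw [Bool.and_eq_true, Nat.ble_eq, Nat.beq_eq]
    constructor
    · rintro ⟨h1, h2⟩
      exact (prime_iff_gcd (B := n - 1) h1 (by rw [Nat.sub_add_cancel (by omega)]; exact lt_mul_self (by omega)) (by omega)).2 h2
    · intro hp
      have h1 := hp.two_le
      exact ⟨h1, (prime_iff_gcd (B := n - 1) h1 (by rw [Nat.sub_add_cancel (by omega)]; exact lt_mul_self (by omega)) (by omega)).1 hp⟩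
  · rw [Nat.beq_eq, F142_eq]
    exact (prime_iff_gcd (B := 142) (by omega) (by omega) (by omega)).symm

end MP
end

section
namespace MP

/-- evaluate the argument before applying the function (for kernel reduction) -/
def force {α : Sort*} (n : ℕ) (f : ℕ → α) : α := Nat.rec (f 0) (fun m _ => f (Nat.succ m)) n

theorem force_eq {α : Sort*} (n : ℕ) (f : ℕ → α) : force n f = f n := by
  cases n <;> rfl


/-- binary search for a lower bound of the binary logarithm -/
def bl (j n : ℕ) : ℕ → ℕ :=
  Nat.rec (motive := fun _ => ℕ → ℕ) (fun r => r)
    (fun j ih r => force (Nat.add r (Nat.pow 2 j)) fun r' =>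
      Bool.rec (ih r) (ih r') (Nat.ble (Nat.pow 2 r') n)) j

/-- lower approximation of `256 * log2 p` -/
def lg (p : ℕ) : ℕ := force (Nat.pow p 256) fun n => bl 12 n 0

def kcheck (A U : ℕ) : Bool :=
  Nat.ble (Nat.mul A (5617 * 512 * 10000000000))
    (Nat.mul (6931471803 * 10000000000000000)
      (force (Nat.div (Nat.pow (Nat.mul U 6931471803) 512) (Nat.pow 2560000000000 512)) fun n => bl 13 n 0))

/-- branch on a Boolean, with a failing `false` branch -/
def andk (b : Bool) (x : Bool) : Bool := Bool.rec false x b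

def loop (c K0 : ℕ) (l : List ℕ) : List ℕ → ℕ → ℕ → ℕ → ℕ → Bool :=
  List.rec (motive := fun _ => List ℕ → ℕ → ℕ → ℕ → ℕ → Bool)
    (fun _ _ _ _ _ => true)
    (fun p _ ih l2 k A T S =>
      force (Nat.add k 1) fun k' =>
      force (Nat.add (Nat.div (Nat.mul A p) (Nat.sub p 1)) 1) fun A' =>
      force (Nat.add T (lg p)) fun T' =>
      Bool.rec
        (andk (Bool.rec true (kcheck A' (Nat.add T' S)) (Nat.ble K0 k')) (ih l2 k' A' T' S))
        (List.rec false (fun q l2' _ => force (Nat.add S (lg q)) fun S' =>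
          andk (Bool.rec true (kcheck A' (Nat.add T' S')) (Nat.ble K0 k')) (ih l2' k' A' T' S')) l2)
        (Nat.beq (Nat.mod k' c) 0))
    l

def pl (f : ℕ) : ℕ → List ℕ :=
  Nat.rec (motive := fun _ => ℕ → List ℕ) (fun _ => [])
    (fun _ ih n => force (Nat.add n 1) fun n' => Bool.rec (ih n') (n :: ih n') (ptest n)) f

def ps (N : ℕ) : List ℕ := pl N 0

end MP
end

section
namespace MP

theorem bl_sound (n : ℕ) : ∀ (j r : ℕ), 2 ^ r ≤ n → 2 ^ (bl j n r) ≤ n := by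
  intro j
  induction j with
  | zero => intro r h; exact h
  | succ j ih =>
    intro r h
    have e : bl (j+1) n r = Bool.rec (bl j n r) (bl j n (Nat.add r (Nat.pow 2 j)))
        (Nat.ble (Nat.pow 2 (Nat.add r (Nat.pow 2 j))) n) := by
      have e0 : bl (j+1) n r = force (Nat.add r (Nat.pow 2 j)) (fun r' =>
        Bool.rec (bl j n r) (bl j n r') (Nat.ble (Nat.pow 2 r') n)) := rfl
      rw [e0, force_eq]
    rw [e]
    cases hb : Nat.ble (Nat.pow 2 (Nat.add r (Nat.pow 2 j))) n with
    | false => exact ih r h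
    | true => exact ih _ (Nat.le_of_ble_eq_true hb)

theorem bl_zero : ∀ (j r : ℕ), bl j 0 r = r := by
  intro j
  induction j with
  | zero => intro r; rfl
  | succ j ih =>
    intro r
    have e : bl (j+1) 0 r = Bool.rec (bl j 0 r) (bl j 0 (Nat.add r (Nat.pow 2 j)))
        (Nat.ble (Nat.pow 2 (Nat.add r (Nat.pow 2 j))) 0) := by
      have e0 : bl (j+1) 0 r = force (Nat.add r (Nat.pow 2 j)) (fun r' =>
        Bool.rec (bl j 0 r) (bl j 0 r') (Nat.ble (Nat.pow 2 r') 0)) := rfl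
      rw [e0, force_eq]
    rw [e]
    cases hb : Nat.ble (Nat.pow 2 (Nat.add r (Nat.pow 2 j))) 0 with
    | false => exact ih r
    | true =>
      have := Nat.le_of_ble_eq_true hb
      have h2 : 0 < 2 ^ (r + 2 ^ j) := by positivity
      exact absurd this (Nat.not_le.mpr h2)

theorem lg_sound {p : ℕ} (hp : 0 < p) : (lg p : ℝ) * log 2 / 256 ≤ log p := by
  have h : 2 ^ (lg p) ≤ p ^ 256 := by
    unfold lg
    rw [force_eq]
    exact bl_sound (Nat.pow p 256) 12 0 (Nat.one_le_iff_ne_zero.mpr (pow_ne_zero _ hp.ne'))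
  have h' : (2:ℝ) ^ (lg p) ≤ (p:ℝ) ^ 256 := by exact_mod_cast h
  have := Real.log_le_log (by positivity) h'
  rw [Real.log_pow, Real.log_pow] at this
  push_cast at this
  linarith

theorem Rk_pos (k : ℕ) : 0 < Rk k := by
  unfold Rk
  apply Finset.prod_pos
  intro i _
  have h : (2:ℝ) ≤ (Nat.nth Nat.Prime i : ℝ) := by exact_mod_cast (pnth i).two_le
  apply div_pos <;> linarith

set_option exponentiation.threshold 2000 in
theorem kcheck_sound (hg : exp (-eulerMascheroniConstant) ≤ 0.5617) {A U k c : ℕ}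
    (h : kcheck A U = true) (hA : Rk k ≤ A / 10 ^ 12)
    (hU : (U:ℝ) * log 2 / 256 ≤ log (Nk k) + log (Nk (k / c))) :
    M k ≤ log (Nk (k / c)) := by
  unfold kcheck at h
  rw [force_eq] at h
  have h := Nat.le_of_ble_eq_true h
  set n : ℕ := Nat.div (Nat.pow (Nat.mul U 6931471803) 512) (Nat.pow 2560000000000 512) with hn
  set a : ℕ := bl 13 n 0 with ha
  have hR := Rk_pos k
  have h1 : (A:ℝ) * (5617 * 512 * 10000000000) ≤ 6931471803 * 10000000000000000 * a := by
    exact_mod_cast h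
  have hApos : (0:ℝ) < A := by
    have : (0:ℝ) < A / 10 ^ 12 := lt_of_lt_of_le hR hA
    by_contra hc
    have : (A:ℝ) / 10 ^ 12 ≤ 0 := div_nonpos_of_nonpos_of_nonneg (not_lt.mp hc) (by positivity)
    linarith
  have hapos : (0:ℝ) < a := by linarith
  have hn0 : 1 ≤ n := by
    rw [Nat.one_le_iff_ne_zero]
    intro h0
    rw [h0, bl_zero] at ha
    rw [ha] at hapos
    simp at hapos
  have h2 : 2 ^ a ≤ n := bl_sound n 13 0 (by simpa using hn0)
  have h3 : 2 ^ a * 2560000000000 ^ 512 ≤ (U * 6931471803) ^ 512 := by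
    have : n * 2560000000000 ^ 512 ≤ (U * 6931471803) ^ 512 := Nat.div_mul_le_self _ _
    exact le_trans (Nat.mul_le_mul_right _ h2) this
  have h3' : (2:ℝ) ^ a * 2560000000000 ^ 512 ≤ ((U:ℝ) * 6931471803) ^ 512 := by exact_mod_cast h3
  have hUpos : (0:ℝ) < U := by
    rcases Nat.eq_zero_or_pos U with h0 | h0
    · exfalso
      rw [h0] at h3'
      have : (0:ℝ) < (2:ℝ) ^ a * 2560000000000 ^ 512 :=
        mul_pos (pow_pos two_pos _) (pow_pos (by norm_num) _)
      rw [Nat.cast_zero, zero_mul, zero_pow (by norm_num)] at h3'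
      linarith
    · exact_mod_cast h0
  have h4 : log ((2:ℝ) ^ a * 2560000000000 ^ 512) ≤ log (((U:ℝ) * 6931471803) ^ 512) :=
    Real.log_le_log (mul_pos (pow_pos two_pos _) (pow_pos (by norm_num) _)) h3'
  rw [Real.log_mul (pow_ne_zero _ two_ne_zero) (pow_ne_zero _ (by norm_num)), Real.log_pow,
    Real.log_pow, Real.log_pow] at h4
  clear h3 h3' h2 hn0 h
  clear_value a
  clear ha
  clear_value n
  clear hn
  have l2 := Real.log_two_gt_d9
  have h5 : (a:ℝ) / 512 * log 2 ≤ log ((U:ℝ) * 0.6931471803 / 256) := by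
    have : (U:ℝ) * 0.6931471803 / 256 = (U:ℝ) * 6931471803 / 2560000000000 := by ring
    rw [this, Real.log_div (by positivity) (by positivity)]
    push_cast at h4
    linarith
  have h6 : exp (-eulerMascheroniConstant) * Rk k ≤ (a:ℝ) / 512 * log 2 := by
    calc exp (-eulerMascheroniConstant) * Rk k ≤ 0.5617 * (A / 10 ^ 12) :=
          mul_le_mul hg hA hR.le (by norm_num)
      _ ≤ (a:ℝ) / 512 * 0.6931471803 := by linarith
      _ ≤ _ := by gcongr
  have h7 : exp (exp (-eulerMascheroniConstant) * Rk k) ≤ (U:ℝ) * 0.6931471803 / 256 := by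
    rw [← Real.le_log_iff_exp_le (by positivity)]
    exact h6.trans h5
  have h8 : (U:ℝ) * 0.6931471803 / 256 ≤ (U:ℝ) * log 2 / 256 := by gcongr
  rw [M_eq]
  linarith

theorem loop_cons (c K0 p : ℕ) (l l2 : List ℕ) (k A T S : ℕ) :
    loop c K0 (p :: l) l2 k A T S =
      Bool.rec
        (andk (Bool.rec true (kcheck (A * p / (p - 1) + 1) (T + lg p + S)) (Nat.ble K0 (k+1)))
          (loop c K0 l l2 (k+1) (A * p / (p - 1) + 1) (T + lg p) S))
        (List.rec false (fun q l2' _ =>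
          andk (Bool.rec true (kcheck (A * p / (p - 1) + 1) (T + lg p + (S + lg q))) (Nat.ble K0 (k+1)))
            (loop c K0 l l2' (k+1) (A * p / (p - 1) + 1) (T + lg p) (S + lg q))) l2)
        (Nat.beq (Nat.mod (k+1) c) 0) := by
  have e0 : loop c K0 (p :: l) l2 k A T S =
      (force (k + 1) fun k' =>
      force (A * p / (p - 1) + 1) fun A' =>
      force (T + lg p) fun T' =>
      Bool.rec
        (andk (Bool.rec true (kcheck A' (Nat.add T' S)) (Nat.ble K0 k')) (loop c K0 l l2 k' A' T' S))
        (List.rec false (fun q l2' _ => force (Nat.add S (lg q)) fun S' =>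
          andk (Bool.rec true (kcheck A' (Nat.add T' S')) (Nat.ble K0 k'))
            (loop c K0 l l2' k' A' T' S')) l2)
        (Nat.beq (Nat.mod k' c) 0)) := rfl
  rw [e0, force_eq, force_eq, force_eq]
  cases l2 with
  | nil => rfl
  | cons q l2 => 
    congr 1
    exact force_eq _ _

theorem andk_true {b x : Bool} (h : andk b x = true) : b = true ∧ x = true := by
  cases b
  · exact absurd h Bool.false_ne_true
  · exact ⟨rfl, h⟩

theorem Rk_step {k A : ℕ} (hA : Rk k ≤ A / 10 ^ 12) :
    Rk (k+1) ≤ ((A * Nat.nth Nat.Prime k / (Nat.nth Nat.Prime k - 1) + 1 : ℕ) : ℝ) / 10 ^ 12 := by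
  set p := Nat.nth Nat.Prime k with hp
  have h2 : 2 ≤ p := (pnth k).two_le
  have e : Rk (k+1) = Rk k * ((p:ℝ) / ((p:ℝ) - 1)) := by
    unfold Rk; rw [Finset.prod_range_succ]
  have h2' : (2:ℝ) ≤ p := by exact_mod_cast h2
  have hq : (0:ℝ) < (p:ℝ) - 1 := by linarith
  have h1 : A * p < (A * p / (p - 1) + 1) * (p - 1) := by
    have := Nat.lt_div_mul_add (a := A * p) (b := p - 1) (by omega)
    linarith
  have h1' : (A:ℝ) * p ≤ ((A * p / (p - 1) + 1 : ℕ) : ℝ) * ((p:ℝ) - 1) := by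
    have : ((p - 1 : ℕ) : ℝ) = (p:ℝ) - 1 := by
      rw [Nat.cast_sub (by omega)]; simp
    rw [← this]
    exact_mod_cast h1.le
  rw [e]
  calc Rk k * ((p:ℝ) / ((p:ℝ) - 1)) ≤ A / 10 ^ 12 * ((p:ℝ) / ((p:ℝ) - 1)) := by gcongr
    _ = (A * p) / ((p:ℝ) - 1) / 10 ^ 12 := by ring
    _ ≤ _ := by
      gcongr
      rw [div_le_iff₀ hq]
      exact h1'

theorem T_step {k T : ℕ} (hT : (T:ℝ) * log 2 / 256 ≤ log (Nk k)) :
    ((T + lg (Nat.nth Nat.Prime k) : ℕ) : ℝ) * log 2 / 256 ≤ log (Nk (k+1)) := by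
  have h := lg_sound (pnth k).pos
  rw [log_Nk] at hT ⊢
  rw [Finset.sum_range_succ]
  push_cast
  linarith

theorem loop_sound (hg : exp (-eulerMascheroniConstant) ≤ 0.5617) {c K0 : ℕ} (hc : 0 < c) :
    ∀ (r k r2 A T S : ℕ),
      loop c K0 ((List.range' k r).map (Nat.nth Nat.Prime))
        ((List.range' (k / c) r2).map (Nat.nth Nat.Prime)) k A T S = true →
      Rk k ≤ A / 10 ^ 12 → (T:ℝ) * log 2 / 256 ≤ log (Nk k) →
      (S:ℝ) * log 2 / 256 ≤ log (Nk (k / c)) →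
      ∀ j, k < j → j ≤ k + r → K0 ≤ j → M j ≤ log (Nk (j / c)) := by
  intro r
  induction r with
  | zero => intro k r2 A T S _ _ _ _ j h1 h2; omega
  | succ r ih =>
    intro k r2 A T S h hA hT hS j h1 h2 h3
    rw [List.range'_succ, List.map_cons, loop_cons] at h
    have hA' := Rk_step hA
    have hT' := T_step hT
    have key : ∀ (S' : ℕ) (r2' : ℕ), (S':ℝ) * log 2 / 256 ≤ log (Nk ((k+1) / c)) →
        andk (Bool.rec true (kcheck (A * Nat.nth Nat.Prime k / (Nat.nth Nat.Prime k - 1) + 1)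
          (T + lg (Nat.nth Nat.Prime k) + S')) (Nat.ble K0 (k+1)))
          (loop c K0 ((List.range' (k+1) r).map (Nat.nth Nat.Prime))
            ((List.range' ((k+1) / c) r2').map (Nat.nth Nat.Prime)) (k+1)
            (A * Nat.nth Nat.Prime k / (Nat.nth Nat.Prime k - 1) + 1)
            (T + lg (Nat.nth Nat.Prime k)) S') = true →
        M j ≤ log (Nk (j / c)) := by
      intro S' r2' hS' hh
      obtain ⟨g1, g2⟩ := andk_true hh
      rcases Nat.lt_or_ge (k+1) j with hj | hj
      · exact ih (k+1) r2' _ _ S' g2 hA' hT' hS' j hj (by omega) h3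
      · have hj' : j = k + 1 := by omega
        subst hj'
        have hb : Nat.ble K0 (k+1) = true := Nat.ble_eq_true_of_le h3
        rw [hb] at g1
        refine kcheck_sound hg g1 hA' ?_
        push_cast at hT' ⊢
        linarith
    cases hb : Nat.beq (Nat.mod (k+1) c) 0 with
    | false =>
      rw [hb] at h
      have hnd : ¬ c ∣ k + 1 := by
        intro hd
        have := Nat.mod_eq_zero_of_dvd hd
        have h0 : Nat.mod (k+1) c = 0 := this
        rw [h0] at hb
        exact absurd hb (by decide)
      have hdiv : (k+1) / c = k / c := by
        rw [Nat.succ_div, if_neg hnd, add_zero]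
      refine key S r2 (by rw [hdiv]; exact hS) ?_
      rw [hdiv]
      exact h
    | true =>
      rw [hb] at h
      have hd : c ∣ k + 1 := Nat.dvd_of_mod_eq_zero (Nat.eq_of_beq_eq_true hb)
      have hdiv : (k+1) / c = k / c + 1 := by
        rw [Nat.succ_div, if_pos hd]
      cases r2 with
      | zero => exact absurd h Bool.false_ne_true
      | succ r2 =>
        rw [List.range'_succ, List.map_cons] at h
        refine key (S + lg (Nat.nth Nat.Prime (k / c))) r2 ?_ ?_
        · rw [hdiv]; exact T_step hS
        · rw [hdiv]; exact h

theorem pl_eq : ∀ (f n : ℕ), pl f n = (List.range' n f).filter ptest := by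
  intro f
  induction f with
  | zero => intro n; rfl
  | succ f ih =>
    intro n
    have e : pl (f+1) n = Bool.rec (pl f (n+1)) (n :: pl f (n+1)) (ptest n) := by
      change force (Nat.add n 1) _ = _
      rw [force_eq]; rfl
    rw [e, List.range'_succ, List.filter_cons, ih]
    cases ptest n <;> rfl

theorem list_filter_nth (N : ℕ) : (List.range N).filter (fun n => decide n.Prime) =
    (List.range (Nat.count Nat.Prime N)).map (Nat.nth Nat.Prime) := by
  induction N with
  | zero => simp
  | succ N ih =>
    rw [List.range_succ, List.filter_append, ih, Nat.count_succ]
    by_cases h : N.Prime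
    · simp [h, List.range_succ, Nat.nth_count h]
    · simp [h]

theorem ps_eq {N : ℕ} (hN : N ≤ 20449) : ps N =
    (List.range' 0 (Nat.count Nat.Prime N)).map (Nat.nth Nat.Prime) := by
  unfold ps
  rw [pl_eq, ← List.range_eq_range', ← List.range_eq_range', ← list_filter_nth]
  apply List.filter_congr
  intro n hn
  have hn' : n < 20449 := lt_of_lt_of_le (List.mem_range.mp hn) hN
  have := ptest_iff hn'
  rw [Bool.eq_iff_iff, this]
  simp

theorem finite_check (hg : exp (-eulerMascheroniConstant) ≤ 0.5617) {c K0 N : ℕ} (hc : 0 < c)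
    (hN : N ≤ 20449) (h : loop c K0 (ps N) (ps N) 0 1000000000000 0 0 = true)
    (j : ℕ) (h0 : 0 < j) (h1 : j ≤ Nat.count Nat.Prime N) (h2 : K0 ≤ j) :
    M j ≤ log (Nk (j / c)) := by
  rw [ps_eq hN] at h
  have e : ∀ x : ℕ, x = 0 → (x : ℝ) * log 2 / 256 ≤ log (Nk x) := by
    intro x hx; subst hx; rw [log_Nk]; simp
  refine loop_sound hg hc (Nat.count Nat.Prime N) 0 (Nat.count Nat.Prime N) 1000000000000 0 0
    (by rw [Nat.zero_div]; exact h) ?_ ?_ ?_ j h0 (by omega) h2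
  · simp [Rk]; norm_num
  · exact e 0 rfl
  · rw [Nat.zero_div]; exact e 0 rfl

set_option maxRecDepth 100000 in
theorem cert2 : loop 2 18 (ps 173) (ps 173) 0 1000000000000 0 0 = true := by decide +kernel

set_option maxRecDepth 100000 in
theorem cert3 : loop 3 39 (ps 20000) (ps 20000) 0 1000000000000 0 0 = true := by decide +kernel

theorem count173 : 39 ≤ Nat.count Nat.Prime 173 := by
  have h : (ps 173).length = 39 := by decide +kernel
  rw [ps_eq (by norm_num)] at h
  simp at h
  omega

/-- fixed point harmonic sum -/
def hs (n : ℕ) : ℕ → ℕ :=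
  Nat.rec (motive := fun _ => ℕ → ℕ) (fun s => s)
    (fun i ih s => force (Nat.add s (Nat.div 1000000000000 (Nat.succ i))) fun s' => ih s') n

theorem hs_sound : ∀ (n s : ℕ), (hs n s : ℝ) ≤ s + 10 ^ 12 * Hr n := by
  intro n
  induction n with
  | zero => intro s; simp [hs, Hr]
  | succ n ih =>
    intro s
    have e : hs (n+1) s = hs n (s + 1000000000000 / (n+1)) := by
      change force (Nat.add s (Nat.div 1000000000000 (Nat.succ n))) _ = _
      rw [force_eq]; rfl
    rw [e, Hr_succ]
    have h1 := ih (s + 1000000000000 / (n+1))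
    have h2 : ((1000000000000 / (n+1) : ℕ) : ℝ) ≤ 1000000000000 / (n+1) := by
      have := @Nat.cast_div_le ℝ _ _ _ 1000000000000 (n+1)
      push_cast at this
      exact_mod_cast this
    push_cast at h1
    have h3 : (10:ℝ) ^ 12 * (Hr n + 1 / ((n:ℝ)+1)) = 10 ^ 12 * Hr n + 1000000000000 / (n+1) := by
      ring
    push_cast
    linarith

theorem Hr_2047 : (8.20158 : ℝ) ≤ Hr 2047 := by
  have h : Nat.ble 8201580000000 (hs 2047 0) = true := by decide +kernel
  have h1 : (8201580000000 : ℝ) ≤ (hs 2047 0 : ℝ) := by exact_mod_cast Nat.le_of_ble_eq_true h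
  have h2 := hs_sound 2047 0
  push_cast at h2
  linarith

theorem exp_gamma : exp (-eulerMascheroniConstant) ≤ 0.5617 := by
  have h1 := Hr_gamma_low 2047
  have h2 : log (((2047:ℕ):ℝ) + 1) = 11 * log 2 := by
    rw [show (((2047:ℕ):ℝ) + 1) = 2 ^ 11 by norm_num, Real.log_pow]; norm_num
  rw [h2] at h1
  have h3 := Real.log_two_lt_d9
  have h4 := Hr_2047
  have h6 : (-(139 / 167 : ℝ)) * log 2 ≤ log 0.5617 := by
    have : (2:ℝ)⁻¹ ^ 139 ≤ 0.5617 ^ 167 := by norm_num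
    have := Real.log_le_log (by positivity) this
    rw [Real.log_pow, Real.log_pow, Real.log_inv] at this
    push_cast at this
    linarith
  rw [← Real.le_log_iff_exp_le (by norm_num)]
  linarith

theorem part_a (k : ℕ) (hk : 39 ≤ k) : M k ≤ log (Nk (k / 3)) := by
  rcases Nat.lt_or_ge (Nat.count Nat.Prime 20000) k with h | h
  · obtain ⟨j, rfl⟩ : ∃ j, k = j + 1 := ⟨k - 1, by omega⟩
    apply big3
    by_contra hc
    have h1 : Nat.nth Nat.Prime j < 20000 := not_le.mp hc
    have h2 := Nat.count_strict_mono (pnth j) h1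
    rw [Nat.count_nth_of_infinite Nat.infinite_setOfPred_prime] at h2
    omega
  · exact finite_check exp_gamma (by norm_num) (by norm_num) cert3 k (by omega) h hk

theorem part_b (k : ℕ) (hk : 18 ≤ k) : M k ≤ log (Nk (k / 2)) := by
  rcases Nat.lt_or_ge k 39 with h | h
  · exact finite_check exp_gamma (by norm_num) (by norm_num) cert2 k (by omega)
      (by have := count173; omega) hk
  · exact (part_a k h).trans (Nk_mono (by omega))

end MP
end

theorem M_le_log_primorial_div :
    (∀ k : ℕ, 39 ≤ k → M k ≤ Real.log (Nk (k / 3))) ∧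
    (∀ k : ℕ, 18 ≤ k → M k ≤ Real.log (Nk (k / 2))) ∧
    (∀ k : ℕ, 969672728 ≤ k → M k ≤ Real.log (Nk (k / 14))) := by
  exact ⟨MP.part_a, MP.part_b, MP.part_c⟩
end

section
/- For every integer k ≥ 4, the primorial N_k satisfies σ(N_k)/N_k < e^γ · log(log N_k); equivalently, ∏_{i=1}^{k} (1 + 1/p_i) < e^γ · log(log N_k). -/
open Real Finset

namespace PR

/-- Trial division test, correct for numbers below 4096. -/
def isP (n : ℕ) : Bool :=
  Nat.ble 2 n && (List.range' 2 62).all (fun d => !(Nat.beq (n % d) 0) || Nat.beq n d)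

theorem isP_iff (n : ℕ) (hn : n < 4096) : isP n = true ↔ n.Prime := by
  unfold isP
  rw [Bool.and_eq_true, List.all_eq_true, Nat.ble_eq]
  constructor
  · rintro ⟨h2, h⟩
    by_contra hc
    have hm := Nat.minFac_sq_le_self (by omega) hc
    have hm2 := (Nat.minFac_prime (by omega : n ≠ 1)).two_le
    have hm3 : n.minFac < 64 := by nlinarith
    have := h n.minFac (by simp [List.mem_range']; refine ⟨n.minFac - 2, by omega, by omega⟩)
    have hd : n % n.minFac = 0 := Nat.mod_eq_zero_of_dvd (Nat.minFac_dvd n)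
    rw [hd] at this
    simp at this
    apply hc
    rw [this]
    exact Nat.minFac_prime (by omega)
  · intro hp
    refine ⟨hp.two_le, fun d hd => ?_⟩
    simp [List.mem_range'] at hd
    by_contra hc
    simp [Nat.beq_eq] at hc
    have := (Nat.dvd_prime hp).1 (Nat.dvd_of_mod_eq_zero hc.1)
    omega

/-- Binary product of `f` over `[a, a + 2^m)`. -/
def tprod (f : ℕ → ℕ) : ℕ → ℕ → ℕ
  | 0, a => f a
  | m + 1, a => Nat.mul (tprod f m a) (tprod f m (Nat.add a (Nat.pow 2 m)))

/-- Binary sum of `f` over `[a, a + 2^m)`. -/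
def tsm (f : ℕ → ℕ) : ℕ → ℕ → ℕ
  | 0, a => f a
  | m + 1, a => Nat.add (tsm f m a) (tsm f m (Nat.add a (Nat.pow 2 m)))

theorem tprod_eq (f : ℕ → ℕ) (m a : ℕ) : tprod f m a = ∏ i ∈ Finset.Ico a (a + 2 ^ m), f i := by
  induction m generalizing a with
  | zero => simp [tprod]
  | succ m ih =>
    show tprod f m a * tprod f m (a + 2 ^ m) = _
    rw [ih, ih, Finset.prod_Ico_consecutive _ (Nat.le_add_right _ _) (Nat.le_add_right _ _)]
    congr 2; ring

theorem tsm_eq (f : ℕ → ℕ) (m a : ℕ) : tsm f m a = ∑ i ∈ Finset.Ico a (a + 2 ^ m), f i := by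
  induction m generalizing a with
  | zero => simp [tsm]
  | succ m ih =>
    show tsm f m a + tsm f m (a + 2 ^ m) = _
    rw [ih, ih, Finset.sum_Ico_consecutive _ (Nat.le_add_right _ _) (Nat.le_add_right _ _)]
    congr 2; ring

def fden (n : ℕ) : ℕ := cond (isP n) n 1
def fnum (n : ℕ) : ℕ := cond (isP n) (Nat.succ n) 1
def flog (n : ℕ) : ℕ :=
  cond (isP n) (Nat.div (Nat.mul (Nat.log2 (Nat.pow n 64)) 1000000) (Nat.mul 64 n)) 0

theorem tprod_primes (g : ℕ → ℕ) (m : ℕ) (hm : m ≤ 12) :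
    tprod (fun n => cond (isP n) (g n) 1) m 0 = ∏ p ∈ Nat.primesLE (2 ^ m - 1), g p := by
  have h2 : 0 < 2 ^ m := by positivity
  have h3 : 2 ^ m ≤ 2 ^ 12 := Nat.pow_le_pow_right (by norm_num) hm
  rw [tprod_eq, Nat.primesLE_eq_filter_range, Finset.prod_filter, zero_add,
    Nat.sub_add_cancel h2, Finset.range_eq_Ico]
  refine Finset.prod_congr rfl fun i hi => ?_
  rw [Finset.mem_Ico] at hi
  have := isP_iff i (by omega)
  by_cases h : isP i = true
  · rw [if_pos (this.1 h), h]; rfl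
  · rw [if_neg (fun hh => h (this.2 hh))]; simp at h; rw [h]; rfl

theorem tsm_primes (g : ℕ → ℕ) (m : ℕ) (hm : m ≤ 12) :
    tsm (fun n => cond (isP n) (g n) 0) m 0 = ∑ p ∈ Nat.primesLE (2 ^ m - 1), g p := by
  have h2 : 0 < 2 ^ m := by positivity
  have h3 : 2 ^ m ≤ 2 ^ 12 := Nat.pow_le_pow_right (by norm_num) hm
  rw [tsm_eq, Nat.primesLE_eq_filter_range, Finset.sum_filter, zero_add,
    Nat.sub_add_cancel h2, Finset.range_eq_Ico]
  refine Finset.sum_congr rfl fun i hi => ?_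
  rw [Finset.mem_Ico] at hi
  have := isP_iff i (by omega)
  by_cases h : isP i = true
  · rw [if_pos (this.1 h), h]; rfl
  · rw [if_neg (fun hh => h (this.2 hh))]; simp at h; rw [h]; rfl

theorem comp7 : Nat.ble (Nat.mul (tprod fnum 7 0) 1000) (Nat.mul (tprod fden 7 0) 5347) = true ∧
    Nat.ble (Nat.pow 2 161) (tprod fden 7 0) = true := by
  constructor <;> decide +kernel
theorem comp9 : Nat.ble (Nat.mul (tprod fnum 9 0) 1000) (Nat.mul (tprod fden 9 0) 6814) = true ∧
    Nat.ble (Nat.pow 2 702) (tprod fden 9 0) = true := by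
  constructor <;> decide +kernel
theorem comp12 :
    Nat.ble (Nat.mul (tprod fnum 12 0) 1000) (Nat.mul (tprod fden 12 0) 9026) = true := by
  decide +kernel
theorem complog : Nat.ble 10070000 (tsm flog 12 0) = true := by
  decide +kernel

end PR
namespace PR
open Chebyshev

/-- Product of `1 + 1/p` over primes up to `n`. -/
noncomputable def P (n : ℕ) : ℝ := ∏ p ∈ Nat.primesLE n, (1 + 1 / (p : ℝ))
/-- Sum of `log p / p` over primes up to `n`. -/
noncomputable def A (n : ℕ) : ℝ := ∑ p ∈ Nat.primesLE n, Real.log p / p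

theorem primesLE_succ (n : ℕ) : Nat.primesLE (n + 1) =
    if (n + 1).Prime then insert (n + 1) (Nat.primesLE n) else Nat.primesLE n := by
  rw [Nat.primesLE_eq_filter_range, Finset.range_add_one, Finset.filter_insert]
  rfl

theorem notMem_primesLE (n : ℕ) : n + 1 ∉ Nat.primesLE n := by
  rw [Nat.mem_primesLE]; omega

theorem P_pos (n : ℕ) : 0 < P n := Finset.prod_pos fun p _ => by positivity

theorem P_mono {m n : ℕ} (h : m ≤ n) : P m ≤ P n := by
  unfold P
  refine Finset.prod_le_prod_of_subset_of_one_le ?_ (fun p _ => by positivity) ?_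
  · intro p hp
    rw [Nat.mem_primesLE] at *
    exact ⟨hp.1.trans h, hp.2⟩
  · intro p _ _
    have : (0 : ℝ) ≤ 1 / (p : ℝ) := by positivity
    linarith

theorem log_factorial_le (n : ℕ) (hn : 1 ≤ n) :
    Real.log (n.factorial) ≤ n * Real.log n - n + Real.log n + 1 := by
  induction n, hn using Nat.le_induction with
  | base => simp
  | succ n hn ih =>
    have hn' : (0 : ℝ) < n := by exact_mod_cast hn
    have h1 : Real.log ((n : ℝ) / (n + 1)) ≤ (n : ℝ) / (n + 1) - 1 :=
      Real.log_le_sub_one_of_pos (by positivity)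
    rw [Real.log_div (by positivity) (by positivity)] at h1
    have h2 : ((n : ℝ) + 1) * (Real.log n - Real.log (n + 1)) ≤ -1 := by
      calc _ ≤ ((n : ℝ) + 1) * ((n : ℝ) / (n + 1) - 1) := by gcongr
        _ = -1 := by field_simp; ring
    rw [Nat.factorial_succ]
    push_cast
    rw [Real.log_mul (by positivity) (by positivity)]
    linarith

theorem sum_le_log_factorial (n : ℕ) :
    ∑ p ∈ Nat.primesLE n, ((n / p : ℕ) : ℝ) * Real.log p ≤ Real.log (n.factorial) := by
  have hdvd : ∏ p ∈ Nat.primesLE n, p ^ (n / p) ∣ n.factorial := by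
    refine Finset.prod_dvd_of_isRelPrime ?_ ?_
    · intro p hp q hq hpq
      have hp' := Nat.prime_of_mem_primesLE hp
      have hq' := Nat.prime_of_mem_primesLE hq
      exact Nat.coprime_iff_isRelPrime.1 (Nat.Coprime.pow _ _ ((Nat.coprime_primes hp' hq').2 hpq))
    · intro p hp
      have hp' := Nat.prime_of_mem_primesLE hp
      rw [hp'.pow_dvd_factorial_iff (b := Nat.log p n + 2) (by omega)]
      calc n / p = n / p ^ 1 := by simp
        _ ≤ _ := Finset.single_le_sum (f := fun i => n / p ^ i) (fun _ _ => Nat.zero_le _)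
            (by simp)
  have hle := Nat.le_of_dvd (Nat.factorial_pos n) hdvd
  have hpos : 0 < ∏ p ∈ Nat.primesLE n, p ^ (n / p) :=
    Finset.prod_pos fun p hp => pow_pos (Nat.prime_of_mem_primesLE hp).pos _
  have := Real.log_le_log (by exact_mod_cast hpos) (by exact_mod_cast hle : ((∏ p ∈ Nat.primesLE n, p ^ (n / p) : ℕ) : ℝ) ≤ (n.factorial : ℝ))
  refine le_trans (le_of_eq ?_) this
  push_cast
  rw [Real.log_prod (fun p hp => by
    have := (Nat.prime_of_mem_primesLE hp).pos
    positivity)]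
  simp

theorem A_le (n : ℕ) (hn : 4096 ≤ n) :
    A n ≤ Real.log n + 0.3891 := by
  have hn' : (4096 : ℝ) ≤ n := by exact_mod_cast hn
  have h1 := sum_le_log_factorial n
  have h2 := log_factorial_le n (by omega)
  have h3 := theta_le_log4_mul_x (x := (n : ℝ)) (by positivity)
  rw [theta_eq_sum_primesLE_log] at h3
  have h4 : n * A n - ∑ p ∈ Nat.primesLE n, Real.log p ≤
      ∑ p ∈ Nat.primesLE n, ((n / p : ℕ) : ℝ) * Real.log p := by
    unfold A
    rw [Finset.mul_sum, ← Finset.sum_sub_distrib]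
    refine Finset.sum_le_sum fun p hp => ?_
    have hp' := (Nat.prime_of_mem_primesLE hp)
    have hp0 : (0 : ℝ) < p := by exact_mod_cast hp'.pos
    have hl : 0 ≤ Real.log p := Real.log_natCast_nonneg p
    have hf : (n : ℝ) / p - 1 ≤ ((n / p : ℕ) : ℝ) := by
      have := Nat.lt_div_mul_add (a := n) hp'.pos
      have h' : (n : ℝ) < ((n / p : ℕ) : ℝ) * p + p := by exact_mod_cast this
      rw [sub_le_iff_le_add, div_le_iff₀ hp0]
      linarith
    calc (n : ℝ) * (Real.log p / p) - Real.log p = ((n : ℝ) / p - 1) * Real.log p := by ring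
      _ ≤ _ := by gcongr
  have h5 : Real.log n ≤ n / 4096 - 1 + 12 * Real.log 2 := by
    have := Real.log_le_sub_one_of_pos (x := (n : ℝ) / 4096) (by positivity)
    rw [Real.log_div (by positivity) (by norm_num)] at this
    have h6 : Real.log (4096 : ℝ) = 12 * Real.log 2 := by
      rw [show (4096 : ℝ) = 2 ^ 12 by norm_num, Real.log_pow]; norm_num
    linarith
  have h7 : Real.log (4 : ℝ) = 2 * Real.log 2 := by
    rw [show (4 : ℝ) = 2 ^ 2 by norm_num, Real.log_pow]; norm_num
  rw [h7] at h3
  have l2 := Real.log_two_lt_d9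
  have h8 : n * A n ≤ n * (Real.log n + 0.3891) := by
    nlinarith
  exact le_of_mul_le_mul_left h8 (by positivity)

/-- Discrete partial summation. -/
theorem abel (C : ℝ) (hC : ∀ n : ℕ, 4096 ≤ n → A n - A 4096 ≤ Real.log n - Real.log 4096 + C)
    (n : ℕ) (hn : 4096 ≤ n) :
    Real.log (P n) + (Real.log n - Real.log 4096 + C - (A n - A 4096)) / Real.log n ≤
      Real.log (P 4096) + Real.log (Real.log n) - Real.log (Real.log 4096) + C / Real.log 4096 := by
  induction n, hn using Nat.le_induction with
  | base => simp
  | succ n hn ih =>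
    have hn' : (4096 : ℝ) ≤ n := by exact_mod_cast hn
    have hv : 0 < Real.log n := Real.log_pos (by linarith)
    have hu : 0 < Real.log ((n : ℝ) + 1) := Real.log_pos (by linarith)
    have huv : Real.log n ≤ Real.log ((n : ℝ) + 1) := Real.log_le_log (by linarith) (by linarith)
    have hD := hC n hn
    push_cast
    have key : Real.log (P (n + 1)) - (A (n + 1)) / Real.log ((n : ℝ) + 1) ≤
        Real.log (P n) - (A n) / Real.log ((n : ℝ) + 1) := by
      unfold P A
      rw [primesLE_succ]
      split_ifs with hp
      · rw [Finset.prod_insert (notMem_primesLE n), Finset.sum_insert (notMem_primesLE n),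
          Real.log_mul (by positivity) (by exact (P_pos n).ne'), add_div]
        have : Real.log (1 + 1 / ((n + 1 : ℕ) : ℝ)) ≤ 1 / ((n + 1 : ℕ) : ℝ) := by
          have := Real.log_le_sub_one_of_pos (x := 1 + 1 / ((n + 1 : ℕ) : ℝ)) (by positivity)
          linarith
        have h2 : Real.log ((n + 1 : ℕ) : ℝ) / ((n + 1 : ℕ) : ℝ) / Real.log ((n : ℝ) + 1) =
            1 / ((n + 1 : ℕ) : ℝ) := by
          push_cast
          field_simp
        rw [h2]
        linarith
      · exact le_rfl
    have h1 : (Real.log n - Real.log 4096 + C - (A n - A 4096)) / Real.log ((n : ℝ) + 1) ≤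
        (Real.log n - Real.log 4096 + C - (A n - A 4096)) / Real.log n := by
      apply div_le_div_of_nonneg_left _ hv huv
      linarith
    have h2 : (Real.log ((n : ℝ) + 1) - Real.log n) / Real.log ((n : ℝ) + 1) ≤
        Real.log (Real.log ((n : ℝ) + 1)) - Real.log (Real.log n) := by
      have := Real.log_le_sub_one_of_pos (x := Real.log n / Real.log ((n : ℝ) + 1)) (by positivity)
      rw [Real.log_div hv.ne' hu.ne'] at this
      rw [sub_div, div_self hu.ne']
      linarith
    simp only [sub_div, add_div] at *
    linarith

theorem theta_lower (n : ℕ) (hn : 4096 ≤ n) : (n : ℝ) / 4 ≤ θ n := by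
  have hn' : (4096 : ℝ) ≤ n := by exact_mod_cast hn
  have h := theta_ge n
  set s := √(n : ℝ) with hs
  have hss : s * s = n := Real.mul_self_sqrt (by positivity)
  have hs64 : 64 ≤ s := Real.le_sqrt_of_sq_le (by linarith)
  have l2 := Real.log_two_lt_d9
  have l2' := Real.log_two_gt_d9
  have hls : Real.log s ≤ s / 64 - 1 + 6 * Real.log 2 := by
    have := Real.log_le_sub_one_of_pos (x := s / 64) (by positivity)
    rw [Real.log_div (by positivity) (by norm_num)] at this
    have h6 : Real.log (64 : ℝ) = 6 * Real.log 2 := by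
      rw [show (64 : ℝ) = 2 ^ 6 by norm_num, Real.log_pow]; norm_num
    linarith
  have hln : Real.log n = 2 * Real.log s := by
    rw [← hss, Real.log_mul (by positivity) (by positivity)]; ring
  have hln1 : Real.log ((n : ℝ) + 1) ≤ Real.log n + 1 := by
    have := Real.log_le_sub_one_of_pos (x := ((n : ℝ) + 1) / n) (by positivity)
    rw [Real.log_div (by positivity) (by positivity)] at this
    have h3 : ((n : ℝ) + 1) / n - 1 ≤ 1 := by
      rw [add_div, div_self (by positivity)]
      have : 1 / (n : ℝ) ≤ 1 := by rw [div_le_one (by positivity)]; linarith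
      linarith
    linarith
  have hls' : Real.log s ≤ s / 64 + 3.16 := by linarith
  have h9 : 2 * s * Real.log n ≤ 4 * s * (s / 64 + 3.16) := by
    rw [hln]; nlinarith
  have h10 : (0.693 : ℝ) * n ≤ n * Real.log 2 := by nlinarith
  nlinarith

end PR
namespace PR
open Chebyshev

theorem exp_gamma_gt : (1.6487 : ℝ) < Real.exp Real.eulerMascheroniConstant := by
  have h1 := Real.exp_lt_exp.2 Real.one_half_lt_eulerMascheroniConstant
  refine lt_trans ?_ h1
  refine lt_of_pow_lt_pow_left₀ 2 (Real.exp_pos _).le ?_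
  rw [← Real.exp_nat_mul]
  norm_num
  have := Real.exp_one_gt_d9
  linarith

theorem exp_le_of (m q : ℕ) (hq : q ≠ 0) (t : ℝ) (ht : 0 ≤ t)
    (h : (2.7182818286 : ℝ) ^ m ≤ t ^ q) : Real.exp ((m : ℝ) / q) ≤ t := by
  refine le_of_pow_le_pow_left₀ hq ht ?_
  rw [← Real.exp_nat_mul, mul_div_cancel₀ _ (by exact_mod_cast hq), ← mul_one (m : ℝ),
    Real.exp_nat_mul]
  refine le_trans ?_ h
  gcongr
  exact Real.exp_one_lt_d9.le

theorem theta_ge_of (a j q N : ℕ) (hN : ∏ p ∈ Nat.primesLE a, p = N) (h : 2 ^ j ≤ N ^ q) :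
    (j : ℝ) * Real.log 2 ≤ q * θ a := by
  have h1 : θ a = Real.log N := by
    rw [theta_eq_sum_primesLE_log, ← hN]
    push_cast
    rw [Real.log_prod (fun p hp => by
      have := (Nat.prime_of_mem_primesLE hp).pos
      positivity)]
  rw [h1, ← Real.log_pow, ← Real.log_pow]
  exact Real.log_le_log (by positivity) (by exact_mod_cast h)

theorem block (a b n m q j u N : ℕ) (t B : ℝ) (ha : a ≤ n) (hb : n ≤ b) (hP : P b ≤ B)
    (hN : ∏ p ∈ Nat.primesLE a, p = N) (h : 2 ^ j ≤ N ^ u) (hu : 0 < u)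
    (ht0 : 0 ≤ t) (htj : u * t ≤ j * 0.6931471803) (hq : q ≠ 0)
    (het : (2.7182818286 : ℝ) ^ m ≤ t ^ q) (hB : B < 1.6487 * ((m : ℝ) / q)) :
    P n < Real.exp Real.eulerMascheroniConstant * Real.log (θ n) := by
  have h1 := theta_ge_of a j u N hN h
  have h2 := exp_le_of m q hq t ht0 het
  have hu' : (0 : ℝ) < u := by exact_mod_cast hu
  have h3 : t ≤ θ a := by
    have : (j : ℝ) * 0.6931471803 ≤ j * Real.log 2 := by
      gcongr
      exact Real.log_two_gt_d9.le
    exact le_of_mul_le_mul_left (by linarith) hu'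
  have h4 : θ a ≤ θ n := theta_mono (by exact_mod_cast ha)
  have h5 : (m : ℝ) / q ≤ Real.log (θ n) := by
    rw [Real.le_log_iff_exp_le (lt_of_lt_of_le (Real.exp_pos _) (h2.trans (h3.trans h4)))]
    linarith
  have h6 := exp_gamma_gt
  have h7 : (0 : ℝ) ≤ (m : ℝ) / q := by positivity
  calc P n ≤ P b := P_mono hb
    _ ≤ B := hP
    _ < 1.6487 * ((m : ℝ) / q) := hB
    _ ≤ _ := by gcongr

theorem P_eq_div (n : ℕ) : P n =
    ((∏ p ∈ Nat.primesLE n, (p + 1) : ℕ) : ℝ) / ((∏ p ∈ Nat.primesLE n, p : ℕ) : ℝ) := by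
  unfold P
  push_cast
  rw [← Finset.prod_div_distrib]
  refine Finset.prod_congr rfl fun p hp => ?_
  have : (p : ℝ) ≠ 0 := by exact_mod_cast (Nat.prime_of_mem_primesLE hp).ne_zero
  field_simp

theorem P_le_of_comp (m B : ℕ) (hm : m ≤ 12)
    (h : Nat.ble (Nat.mul (tprod fnum m 0) 1000) (Nat.mul (tprod fden m 0) B) = true) :
    P (2 ^ m - 1) ≤ (B : ℝ) / 1000 := by
  have h1 := Nat.le_of_ble_eq_true h
  have h2 : tprod fnum m 0 = ∏ p ∈ Nat.primesLE (2 ^ m - 1), (p + 1) := tprod_primes _ m hm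
  have h3 : tprod fden m 0 = ∏ p ∈ Nat.primesLE (2 ^ m - 1), p := tprod_primes _ m hm
  rw [h2, h3] at h1
  have h1' : (∏ p ∈ Nat.primesLE (2 ^ m - 1), (p + 1)) * 1000 ≤
    (∏ p ∈ Nat.primesLE (2 ^ m - 1), p) * B := h1
  have hpos : 0 < ∏ p ∈ Nat.primesLE (2 ^ m - 1), p :=
    Finset.prod_pos fun p hp => (Nat.prime_of_mem_primesLE hp).pos
  rw [P_eq_div, div_le_div_iff₀ (by exact_mod_cast hpos) (by norm_num)]
  rw [mul_comm (B : ℝ)]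
  exact_mod_cast h1'

theorem primes10 : Nat.primesLE 10 = {2, 3, 5, 7} := by decide +kernel
theorem primes7 : Nat.primesLE 7 = {2, 3, 5, 7} := by decide +kernel
theorem primes11 : Nat.primesLE 11 = {2, 3, 5, 7, 11} := by decide +kernel
theorem primes16 : Nat.primesLE 16 = {2, 3, 5, 7, 11, 13} := by decide +kernel
theorem primes17 : Nat.primesLE 17 = {2, 3, 5, 7, 11, 13, 17} := by decide +kernel
theorem primes36 : Nat.primesLE 36 = {2, 3, 5, 7, 11, 13, 17, 19, 23, 29, 31} := by decide +kernel
theorem primes37 : Nat.primesLE 37 = {2, 3, 5, 7, 11, 13, 17, 19, 23, 29, 31, 37} := by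
  decide +kernel

theorem h161 : 2 ^ 161 ≤ (tprod fden 7 0) ^ 1 :=
  (Nat.le_of_ble_eq_true comp7.2).trans_eq (pow_one _).symm
set_option exponentiation.threshold 1000 in
theorem h702 : 2 ^ 702 ≤ (tprod fden 9 0) ^ 1 :=
  (Nat.le_of_ble_eq_true comp9.2).trans_eq (pow_one _).symm

set_option exponentiation.threshold 1000 in
theorem small (n : ℕ) (hn : 7 ≤ n) (hn' : n ≤ 4095) :
    P n < Real.exp Real.eulerMascheroniConstant * Real.log (θ n) := by
  rcases le_or_gt n 10 with h | h
  · exact block 7 10 n 5 3 77 10 210 5.3 2.7429 hn h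
      (by rw [P, primes10]; norm_num) (by rw [primes7]; rfl)
      (by norm_num) (by norm_num) (by norm_num) (by norm_num) (by norm_num) (by norm_num)
      (by norm_num)
  rcases le_or_gt n 16 with h2 | h2
  · exact block 11 16 n 2 1 11 1 2310 7.5 3.2224 h h2
      (by rw [P, primes16]; norm_num) (by rw [primes11]; rfl)
      (by norm_num) (by norm_num) (by norm_num) (by norm_num) (by norm_num) (by norm_num)
      (by norm_num)
  rcases le_or_gt n 36 with h3 | h3
  · exact block 17 36 n 5 2 18 1 510510 12.3 4.002 h2 h3
      (by rw [P, primes36]; norm_num) (by rw [primes17]; rfl)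
      (by norm_num) (by norm_num) (by norm_num) (by norm_num) (by norm_num) (by norm_num)
      (by norm_num)
  rcases le_or_gt n 127 with h4 | h4
  · exact block 37 127 n 10 3 42 1 7420738134810 29 5.347 h3 h4
      (by have := P_le_of_comp 7 5347 (by norm_num) comp7.1
          norm_num at this ⊢; exact this) (by rw [primes37]; rfl)
      (by norm_num) (by norm_num) (by norm_num) (by norm_num) (by norm_num) (by norm_num)
      (by norm_num)
  rcases le_or_gt n 511 with h5 | h5
  · exact block 127 511 n 9 2 161 1 (tprod fden 7 0) 111 6.814 h4.le h5
      (by have := P_le_of_comp 9 6814 (by norm_num) comp9.1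
          norm_num at this ⊢; exact this) (tprod_primes _ 7 (by norm_num)).symm
      h161
      (by norm_num) (by norm_num) (by norm_num) (by norm_num) (by norm_num)
      (by norm_num)
  · exact block 511 4095 n 6 1 702 1 (tprod fden 9 0) 486 9.026 h5.le hn'
      (by have := P_le_of_comp 12 9026 (by norm_num) comp12
          norm_num at this ⊢; exact this) (tprod_primes _ 9 (by norm_num)).symm
      h702
      (by norm_num) (by norm_num) (by norm_num) (by norm_num) (by norm_num)
      (by norm_num)

theorem primesLE_4096 : Nat.primesLE 4096 = Nat.primesLE 4095 := by
  rw [primesLE_succ 4095, if_neg (by norm_num)]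

theorem flog_le (p : ℕ) (hp : p.Prime) :
    ((Nat.div (Nat.mul (Nat.log2 (Nat.pow p 64)) 1000000) (Nat.mul 64 p) : ℕ) : ℝ) *
      (Real.log 2 / 1000000) ≤ Real.log p / p := by
  have hp0 : (0 : ℝ) < p := by exact_mod_cast hp.pos
  have h2 : 0 < Real.log 2 := Real.log_pos (by norm_num)
  set L := Nat.log2 (Nat.pow p 64) with hL
  have h1 : 2 ^ L ≤ p ^ 64 := by
    have := Nat.log2_self_le (n := p ^ 64) (by have := hp.pos; positivity)
    exact this
  have h3 : (L : ℝ) * Real.log 2 ≤ 64 * Real.log p := by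
    have : Real.log ((2 : ℝ) ^ L) ≤ Real.log ((p : ℝ) ^ 64) :=
      Real.log_le_log (by positivity) (by exact_mod_cast h1)
    rw [Real.log_pow, Real.log_pow] at this
    exact_mod_cast this
  have h4 : ((L * 1000000 / (64 * p) : ℕ) : ℝ) ≤ (L * 1000000 : ℝ) / (64 * p) := by
    refine Nat.cast_div_le.trans ?_
    push_cast; exact le_rfl
  calc _ = ((L * 1000000 / (64 * p) : ℕ) : ℝ) * (Real.log 2 / 1000000) := rfl
    _ ≤ (L * 1000000 : ℝ) / (64 * p) * (Real.log 2 / 1000000) := by gcongr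
    _ = (L * Real.log 2) / (64 * p) := by field_simp
    _ ≤ (64 * Real.log p) / (64 * p) := by gcongr
    _ = _ := by field_simp

theorem A_4096 : 10.07 * Real.log 2 ≤ A 4096 := by
  have h1 := Nat.le_of_ble_eq_true complog
  have h2 : tsm flog 12 0 = ∑ p ∈ Nat.primesLE (2 ^ 12 - 1), _ := tsm_primes _ 12 le_rfl
  rw [h2] at h1
  have h3 : (10070000 : ℝ) ≤ ((∑ p ∈ Nat.primesLE (2 ^ 12 - 1),
    Nat.div (Nat.mul (Nat.log2 (Nat.pow p 64)) 1000000) (Nat.mul 64 p) : ℕ) : ℝ) := by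
    exact_mod_cast h1
  unfold A
  rw [primesLE_4096]
  have h4 : (10070000 : ℝ) * (Real.log 2 / 1000000) ≤ _ :=
    mul_le_mul_of_nonneg_right h3 (by have : 0 < Real.log 2 := Real.log_pos (by norm_num); positivity)
  calc 10.07 * Real.log 2 = (10070000 : ℝ) * (Real.log 2 / 1000000) := by ring
    _ ≤ _ := h4
    _ ≤ _ := by
      rw [Nat.cast_sum, Finset.sum_mul]
      exact Finset.sum_le_sum fun p hp => flog_le p (Nat.prime_of_mem_primesLE hp)

theorem large (n : ℕ) (hn : 4096 ≤ n) :
    P n < Real.exp Real.eulerMascheroniConstant * Real.log (θ n) := by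
  have hn' : (4096 : ℝ) ≤ n := by exact_mod_cast hn
  have l2 := Real.log_two_lt_d9
  have l2' := Real.log_two_gt_d9
  have hA0 := A_4096
  have h6 : Real.log (4096 : ℝ) = 12 * Real.log 2 := by
    rw [show (4096 : ℝ) = 2 ^ 12 by norm_num, Real.log_pow]; norm_num
  have hC : ∀ m : ℕ, 4096 ≤ m → A m - A 4096 ≤ Real.log m - Real.log 4096 + 1.727 := by
    intro m hm
    have := A_le m hm
    rw [h6]
    linarith
  have hab := abel 1.727 hC n hn
  have hD := hC n hn
  have hl : Real.log 4096 ≤ Real.log n := Real.log_le_log (by norm_num) hn'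
  have hlpos : 0 < Real.log n := by linarith
  have h7 : 0 ≤ (Real.log n - Real.log 4096 + 1.727 - (A n - A 4096)) / Real.log n := by
    apply div_nonneg _ hlpos.le
    linarith
  have h8 : 1.727 / Real.log 4096 ≤ 0.21 := by
    rw [h6, div_le_iff₀ (by linarith)]
    linarith
  have hP0 : P 4096 ≤ 9.026 := by
    have := P_le_of_comp 12 9026 (by norm_num) comp12
    have h' : P 4096 = P 4095 := by rw [P, P, primesLE_4096]
    rw [h']
    norm_num at this ⊢; exact this
  have hP0' := P_pos 4096
  generalize P 4096 = p0 at *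
  generalize A 4096 = a0 at *
  have h9 : p0 / Real.log 4096 * (6 / 5) ≤ Real.exp 0.29 := by
    have := Real.quadratic_le_exp_of_nonneg (x := 0.29) (by norm_num)
    refine le_trans ?_ this
    have : p0 / Real.log 4096 ≤ 1.0852 := by
      rw [div_le_iff₀ (by linarith), h6]
      linarith
    linarith
  have h10 : P n ≤ p0 / Real.log 4096 * Real.log n * Real.exp 0.21 := by
    have e1 : Real.log (P n) ≤
        Real.log (p0 / Real.log 4096 * Real.log n * Real.exp 0.21) := by
      have q1 : 0 < Real.log 4096 := by linarith
      rw [Real.log_mul (by positivity) (by positivity), Real.log_mul (by positivity) (by positivity),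
        Real.log_div (by positivity) (by positivity), Real.log_exp]
      linarith
    have q1 : 0 < Real.log 4096 := by linarith
    exact (Real.log_le_log_iff (P_pos n) (by positivity)).1 e1
  have h11 : 5 / 6 * Real.log n ≤ Real.log (θ n) := by
    have h' := Real.log_le_log (by positivity) (theta_lower n hn)
    have h4 : Real.log (4 : ℝ) = 2 * Real.log 2 := by
      rw [show (4 : ℝ) = 2 ^ 2 by norm_num, Real.log_pow]; norm_num
    rw [Real.log_div (by positivity) (by norm_num), h4] at h'
    linarith
  have h12 : P n ≤ Real.exp (1 / 2) * (5 / 6 * Real.log n) := by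
    calc P n ≤ _ := h10
      _ = (p0 / Real.log 4096 * (6 / 5)) * (5 / 6 * Real.log n) * Real.exp 0.21 := by ring
      _ ≤ Real.exp 0.29 * (5 / 6 * Real.log n) * Real.exp 0.21 := by gcongr
      _ = Real.exp (0.29 + 0.21) * (5 / 6 * Real.log n) := by rw [Real.exp_add]; ring
      _ = _ := by norm_num
  have h13 := Real.exp_lt_exp.2 Real.one_half_lt_eulerMascheroniConstant
  calc P n ≤ _ := h12
    _ < Real.exp Real.eulerMascheroniConstant * (5 / 6 * Real.log n) := by gcongr
    _ ≤ _ := by gcongr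

theorem image_nth (k : ℕ) (hk : 1 ≤ k) :
    (Finset.range k).image (Nat.nth Nat.Prime) = Nat.primesLE (Nat.nth Nat.Prime (k - 1)) := by
  ext p
  rw [Finset.mem_image, Nat.mem_primesLE]
  constructor
  · rintro ⟨i, hi, rfl⟩
    rw [Finset.mem_range] at hi
    exact ⟨(Nat.nth_le_nth Nat.infinite_setOfPred_prime).2 (by omega), Nat.prime_nth_prime i⟩
  · rintro ⟨h, hp⟩
    refine ⟨Nat.count Nat.Prime p, ?_, Nat.nth_count hp⟩
    rw [← Nat.nth_count hp, Nat.nth_le_nth Nat.infinite_setOfPred_prime] at h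
    rw [Finset.mem_range]; omega

theorem prod_nth {R : Type*} [CommMonoid R] (f : ℕ → R) (k : ℕ) (hk : 1 ≤ k) :
    ∏ i ∈ Finset.range k, f (Nat.nth Nat.Prime i) =
      ∏ p ∈ Nat.primesLE (Nat.nth Nat.Prime (k - 1)), f p := by
  rw [← image_nth k hk, Finset.prod_image]
  intro a _ b _ h
  exact Nat.nth_injective Nat.infinite_setOfPred_prime h

end PR

theorem primorial_robin (k : ℕ) (hk : 4 ≤ k) :
    (ArithmeticFunction.sigma 1 (Nk k) : ℝ) / (Nk k : ℝ) <
      Real.exp Real.eulerMascheroniConstant * Real.log (Real.log (Nk k)) ∧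
    ∏ i ∈ Finset.range k, (1 + 1 / (Nat.nth Nat.Prime i : ℝ)) <
      Real.exp Real.eulerMascheroniConstant * Real.log (Real.log (Nk k)) := by
  set n := Nat.nth Nat.Prime (k - 1) with hn
  have hNk : Nk k = ∏ p ∈ Nat.primesLE n, p := PR.prod_nth (fun p => p) k (by omega)
  have hP : ∏ i ∈ Finset.range k, (1 + 1 / (Nat.nth Nat.Prime i : ℝ)) = PR.P n :=
    PR.prod_nth (fun p => 1 + 1 / (p : ℝ)) k (by omega)
  have hlog : Real.log (Nk k) = Chebyshev.theta n := by
    rw [Chebyshev.theta_eq_sum_primesLE_log, hNk]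
    push_cast
    rw [Real.log_prod (fun p hp => by
      have := (Nat.prime_of_mem_primesLE hp).pos
      positivity)]
  have hs : (ArithmeticFunction.sigma 1 (Nk k) : ℝ) / (Nk k : ℝ) = PR.P n := by
    rw [PR.P_eq_div, hNk, ArithmeticFunction.IsMultiplicative.map_prod_of_prime
      ArithmeticFunction.isMultiplicative_sigma _ (fun p hp => Nat.prime_of_mem_primesLE hp)]
    congr 2
    refine Finset.prod_congr rfl fun p hp => ?_
    have hp' := Nat.prime_of_mem_primesLE hp
    rw [ArithmeticFunction.sigma_one_apply, hp'.sum_divisors]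
  have h7 : 7 ≤ n := by
    have h3 : Nat.nth Nat.Prime 3 = 7 := by
      have : Nat.count Nat.Prime 7 = 3 := by decide +kernel
      rw [← this]
      exact Nat.nth_count (by norm_num)
    rw [← h3, hn]
    exact (Nat.nth_le_nth Nat.infinite_setOfPred_prime).2 (by omega)
  have main : PR.P n < Real.exp Real.eulerMascheroniConstant * Real.log (Chebyshev.theta n) := by
    rcases le_or_gt n 4095 with h | h
    · exact PR.small n h7 h
    · exact PR.large n h
  rw [hs, hP, hlog]
  exact ⟨main, main⟩
end
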